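/- Let q ≥ 2 be an integer, K ⊂ ℚ̄ a number field, f an M_q-function with Taylor coefficients in K, and α ∈ K with 0 < |α| < 1 which is not a pole of f. Then either f(α) ∈ K or f(α) is transcendental. -/

import Mathlib

noncomputable section

/-- The derivative `d/dz` of a formal power series over `ℂ`. -/
def psD (f : PowerSeries ℂ) : PowerSeries ℂ :=
  PowerSeries.mk fun n => ((n : ℂ) + 1) * PowerSeries.coeff (n + 1) f

/-- The Mahler operator `σ_q : f(z) ↦ f(z^q)` on formal power series over `ℂ`. -/
def psSigma (q : ℕ) (f : PowerSeries ℂ) : PowerSeries ℂ :=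
  PowerSeries.mk fun n => if q ∣ n then PowerSeries.coeff (n / q) f else 0

/-- The canonical embedding of polynomials into power series. -/
def polyPS : Polynomial ℂ →+* PowerSeries ℂ := Polynomial.coeToPowerSeries.ringHom

/-- The power series `∑ (a n / n!) zⁿ` attached to a sequence `a` of coefficients. -/
def ePS (a : ℕ → ℂ) : PowerSeries ℂ := PowerSeries.mk fun n => a n / (n.factorial : ℂ)

/-- `IsE a` : the power series `∑ (a n / n!) zⁿ` is an E-function: its coefficients are
algebraic, it satisfies a nonzero linear differential equation over `ℚ̄[z]`, and the size of
the conjugates of the `a n` as well as their common denominators grow at most geometrically. -/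
def IsE (a : ℕ → ℂ) : Prop :=
  (∀ n, IsAlgebraic ℚ (a n)) ∧
  (∃ (m : ℕ) (p : ℕ → Polynomial ℂ),
      (∀ i k, IsAlgebraic ℚ ((p i).coeff k)) ∧ (∃ i, i ≤ m ∧ p i ≠ 0) ∧
      ∑ i ∈ Finset.range (m + 1), polyPS (p i) * psD^[i] (ePS a) = 0) ∧
  (∃ C : ℝ, 0 < C ∧ ∃ d : ℕ → ℕ, ∀ n : ℕ, 1 ≤ n →
      1 ≤ d n ∧ (d n : ℝ) ≤ C ^ n ∧
      (∀ σ : (integralClosure ℚ ℂ) →+* ℂ, ∀ h : a n ∈ integralClosure ℚ ℂ,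
        ‖σ ⟨a n, h⟩‖ ≤ C ^ n) ∧
      (∀ i, 1 ≤ i → i ≤ n → IsIntegral ℤ ((d n : ℂ) * a i)))

/-- The value at `α` of the E-function with coefficient sequence `a`
(E-functions are entire, so this series converges for all `α`). -/
def evalE (a : ℕ → ℂ) (α : ℂ) : ℂ := ∑' n : ℕ, a n / (n.factorial : ℂ) * α ^ n

/-- `IsM q f` : the formal power series `f` is an M_q-function, i.e. it has algebraic
coefficients and satisfies a linear `σ_q`-difference equation over `ℚ̄[z]` with
not-all-zero polynomial coefficients. -/
def IsM (q : ℕ) (f : PowerSeries ℂ) : Prop :=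
  (∀ n, IsAlgebraic ℚ (PowerSeries.coeff n f)) ∧
  ∃ (m : ℕ) (p : ℕ → Polynomial ℂ),
    (∀ i k, IsAlgebraic ℚ ((p i).coeff k)) ∧ (∃ i, i ≤ m ∧ p i ≠ 0) ∧
    ∑ i ∈ Finset.range (m + 1), polyPS (p i) * (psSigma q)^[i] f = 0

/-- `MahlerValue f α v` : the meromorphic extension of (the sum of) the power series `f`
to the open unit disk has no pole at `α` and takes the value `v` there. -/
def MahlerValue (f : PowerSeries ℂ) (α v : ℂ) : Prop :=
  ∃ F : ℂ → ℂ, MeromorphicOn F (Metric.ball (0 : ℂ) 1) ∧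
    (∀ᶠ z in nhds (0 : ℂ), HasSum (fun n => PowerSeries.coeff n f * z ^ n) (F z)) ∧
    AnalyticAt ℂ F α ∧ F α = v

/-- The power series `f` converges (hence defines an analytic function) on the open
disk `D(0,R)`. -/
def AnOnBall (f : PowerSeries ℂ) (R : ℝ) : Prop :=
  ∀ z : ℂ, ‖z‖ < R → Summable fun n => PowerSeries.coeff n f * z ^ n

/-- The value at `z` of (the sum of) the power series `f`. -/
def psEval (f : PowerSeries ℂ) (z : ℂ) : ℂ := ∑' n : ℕ, PowerSeries.coeff n f * z ^ n

/-- `Banal fv α P` : the homogeneous algebraic relation `P` among the values at `α` of the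
power series `fv 1, …, fv r` is banal: it is the specialization at `z = α` of some
`Q ∈ ℚ̄[z, X₁, …, X_r]`, homogeneous in `X₁, …, X_r`, with `Q(z, fv 1, …, fv r) = 0`. -/
def Banal {r : ℕ} (fv : Fin r → PowerSeries ℂ) (α : ℂ) (P : MvPolynomial (Fin r) ℂ) : Prop :=
  ∃ Q : MvPolynomial (Fin r) (Polynomial ℂ),
    (∀ v k, IsAlgebraic ℚ ((MvPolynomial.coeff v Q).coeff k)) ∧
    (∃ e, Q.IsHomogeneous e) ∧
    MvPolynomial.eval₂ polyPS fv Q = 0 ∧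
    MvPolynomial.map (Polynomial.evalRingHom α) Q = P

/-- `Eset S` : the set of values at `z = 1` of all E-functions with coefficients in `S`. -/
def Eset (S : Set ℂ) : Set ℂ :=
  {x | ∃ a : ℕ → ℂ, IsE a ∧ (∀ n, a n ∈ S) ∧ x = evalE a 1}

/-- `Mset q α S` : the set of values at `α` of all M_q-functions with coefficients in `S`
having no pole at `α`. -/
def Mset (q : ℕ) (α : ℂ) (S : Set ℂ) : Set ℂ :=
  {x | ∃ f : PowerSeries ℂ, IsM q f ∧ (∀ n, PowerSeries.coeff n f ∈ S) ∧ MahlerValue f α x}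

namespace Mahler
open Filter Topology Polynomial

/-- The ring of germs at `0` of meromorphic functions. -/
def mgermSubring : Subring (Germ (𝓝[≠] (0 : ℂ)) ℂ) where
  carrier := {φ | ∃ f : ℂ → ℂ, MeromorphicAt f 0 ∧ (f : Germ (𝓝[≠] (0 : ℂ)) ℂ) = φ}
  mul_mem' := by
    rintro _ _ ⟨f, hf, rfl⟩ ⟨g, hg, rfl⟩
    exact ⟨f * g, hf.mul hg, rfl⟩
  one_mem' := ⟨fun _ => 1, MeromorphicAt.const 1 0, rfl⟩
  add_mem' := by
    rintro _ _ ⟨f, hf, rfl⟩ ⟨g, hg, rfl⟩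
    exact ⟨f + g, hf.add hg, rfl⟩
  zero_mem' := ⟨fun _ => 0, MeromorphicAt.const 0 0, rfl⟩
  neg_mem' := by
    rintro _ ⟨f, hf, rfl⟩
    exact ⟨-f, hf.neg, rfl⟩

/-- Germs at `0` of meromorphic functions. -/
def MGerm : Type := mgermSubring

namespace MGerm

instance : CommRing MGerm := inferInstanceAs (CommRing mgermSubring)

/-- The germ of a function meromorphic at `0`. -/
def mk (f : ℂ → ℂ) (hf : MeromorphicAt f 0) : MGerm := ⟨f, f, hf, rfl⟩

theorem mk_eq_mk {f g : ℂ → ℂ} {hf : MeromorphicAt f 0} {hg : MeromorphicAt g 0} :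
    mk f hf = mk g hg ↔ f =ᶠ[𝓝[≠] 0] g :=
  Subtype.ext_iff.trans Germ.coe_eq

theorem exists_rep (φ : MGerm) : ∃ f hf, mk f hf = φ := by
  obtain ⟨_, f, hf, rfl⟩ := φ
  exact ⟨f, hf, rfl⟩

theorem mk_add {f g : ℂ → ℂ} (hf : MeromorphicAt f 0) (hg : MeromorphicAt g 0) :
    mk f hf + mk g hg = mk (f + g) (hf.add hg) := rfl

theorem mk_mul {f g : ℂ → ℂ} (hf : MeromorphicAt f 0) (hg : MeromorphicAt g 0) :
    mk f hf * mk g hg = mk (f * g) (hf.mul hg) := rfl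

theorem mk_zero : mk (fun _ => 0) (MeromorphicAt.const 0 0) = 0 := rfl

theorem mk_one : mk (fun _ => 1) (MeromorphicAt.const 1 0) = 1 := rfl

theorem mk_eq_zero {f : ℂ → ℂ} {hf : MeromorphicAt f 0} :
    mk f hf = 0 ↔ ∀ᶠ z in 𝓝[≠] 0, f z = 0 :=
  mk_eq_mk (hg := MeromorphicAt.const 0 0)

instance : Inv MGerm where
  inv φ := ⟨(φ.1)⁻¹, by
    obtain ⟨_, f, hf, rfl⟩ := φ
    exact ⟨f⁻¹, hf.inv, rfl⟩⟩

theorem mk_inv {f : ℂ → ℂ} (hf : MeromorphicAt f 0) : (mk f hf)⁻¹ = mk f⁻¹ hf.inv := rfl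

instance : Field MGerm where
  exists_pair_ne := ⟨0, 1, fun h => by
    have := mk_eq_zero.mp (mk_one.trans h.symm)
    simpa using this.exists⟩
  mul_inv_cancel φ hφ := by
    obtain ⟨f, hf, rfl⟩ := φ.exists_rep
    have h := hf.eventually_eq_zero_or_eventually_ne_zero.resolve_left
      fun h => hφ (mk_eq_zero.mpr h)
    rw [mk_inv, mk_mul, ← mk_one, mk_eq_mk]
    filter_upwards [h] with z hz
    simp [hz]
  inv_zero := by
    rw [← mk_zero, mk_inv, mk_eq_mk]
    filter_upwards with z
    simp
  nnqsmul := _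
  nnqsmul_def := fun _ _ => rfl
  qsmul := _
  qsmul_def := fun _ _ => rfl

theorem meromorphicAt_eval (p : ℂ[X]) (z : ℂ) : MeromorphicAt (fun z => p.eval z) z :=
  (AnalyticAt.aeval_polynomial analyticAt_id p).meromorphicAt

/-- The germ at `0` of a polynomial. -/
def polyHom : ℂ[X] →+* MGerm where
  toFun p := mk (fun z => p.eval z) (meromorphicAt_eval p 0)
  map_one' := by simp [← mk_one]
  map_mul' p r := by rw [mk_mul, mk_eq_mk]; simp; rfl
  map_zero' := by simp [← mk_zero]
  map_add' p r := by rw [mk_add, mk_eq_mk]; simp; rfl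

instance : Algebra ℂ[X] MGerm := polyHom.toAlgebra

theorem algebraMap_eq (p : ℂ[X]) :
    algebraMap ℂ[X] MGerm p = mk (fun z => p.eval z) (meromorphicAt_eval p 0) := rfl

theorem algebraMap_poly_injective : Function.Injective (algebraMap ℂ[X] MGerm) := by
  rw [injective_iff_map_eq_zero]
  intro p hp
  rw [algebraMap_eq, mk_eq_zero] at hp
  by_contra h0
  refine h0 (p.eq_zero_of_infinite_isRoot ?_)
  exact fun hfin => infinite_of_mem_nhds (0 : ℂ) (insert_mem_nhds_iff.mpr hp) (hfin.insert 0)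

theorem tendsto_pow_nhdsNE {q : ℕ} (hq : q ≠ 0) :
    Tendsto (fun z : ℂ => z ^ q) (𝓝[≠] 0) (𝓝[≠] 0) := by
  refine tendsto_nhdsWithin_iff.mpr ⟨?_, ?_⟩
  · have : Tendsto (fun z : ℂ => z ^ q) (𝓝 0) (𝓝 (0 ^ q)) := (continuous_pow q).tendsto 0
    rw [zero_pow hq] at this
    exact this.mono_left nhdsWithin_le_nhds
  · filter_upwards [self_mem_nhdsWithin] with z hz
    exact pow_ne_zero q hz

theorem meromorphicAt_comp_pow {f : ℂ → ℂ} {q : ℕ} (hq : q ≠ 0) (hf : MeromorphicAt f 0) :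
    MeromorphicAt (fun z => f (z ^ q)) 0 := by
  have : MeromorphicAt f ((fun z : ℂ => z ^ q) 0) := by simpa [hq] using hf
  exact this.comp_analyticAt (g := fun z : ℂ => z ^ q) (analyticAt_id.pow q)

/-- The endomorphism `φ(z) ↦ φ(z ^ q)` of the field of meromorphic germs. -/
def sigma {q : ℕ} (hq : q ≠ 0) : MGerm →+* MGerm where
  toFun φ := ⟨φ.1.compTendsto (fun z : ℂ => z ^ q) (tendsto_pow_nhdsNE hq), by
    obtain ⟨_, f, hf, rfl⟩ := φ
    exact ⟨fun z => f (z ^ q), meromorphicAt_comp_pow hq hf, rfl⟩⟩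
  map_one' := rfl
  map_mul' φ ψ := by
    obtain ⟨f, hf, rfl⟩ := φ.exists_rep
    obtain ⟨g, hg, rfl⟩ := ψ.exists_rep
    rfl
  map_zero' := rfl
  map_add' φ ψ := by
    obtain ⟨f, hf, rfl⟩ := φ.exists_rep
    obtain ⟨g, hg, rfl⟩ := ψ.exists_rep
    rfl

theorem sigma_mk {q : ℕ} (hq : q ≠ 0) {f : ℂ → ℂ} (hf : MeromorphicAt f 0) :
    sigma hq (mk f hf) = mk (fun z => f (z ^ q)) (meromorphicAt_comp_pow hq hf) := rfl

end MGerm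
end Mahler

namespace Mahler
open TensorProduct

/-- A family `g` in `E` admits no nontrivial relation with coefficients algebraic over `k`. -/
def AlgIndepCoeff (k : Type*) {E ι : Type*} [Field k] [Field E] [Algebra k E] [Fintype ι]
    (g : ι → E) : Prop :=
  ∀ y : ι → E, (∀ j, IsAlgebraic k (y j)) → ∑ j, g j * y j = 0 → ∀ j, y j = 0

theorem AlgIndepCoeff.finite_extension {k E F ι : Type*} [Field k] [CharZero k] [Field E]
    [Algebra k E] [Fintype ι] {g : ι → E} (hg : AlgIndepCoeff k g) [Field F] [Algebra E F]
    [FiniteDimensional E F] [Algebra k F] [IsScalarTower k E F] (y : ι → F)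
    (hy : ∀ j, IsAlgebraic k (y j)) (h : ∑ j, g j • y j = 0) (j : ι) : y j = 0 := by
  by_contra hj
  have hInt : ∀ i, IsAlgebraic k (Algebra.trace E F (y i * (y j)⁻¹)) := fun i =>
    (Algebra.isIntegral_trace ((hy i).mul (hy j).inv).isIntegral).isAlgebraic
  have hsum : ∑ i, g i * Algebra.trace E F (y i * (y j)⁻¹) = 0 := by
    have := congrArg (fun t => Algebra.trace E F (t * (y j)⁻¹)) h
    simpa [Finset.sum_mul, map_sum] using this
  have h1 := hg _ hInt hsum j
  rw [mul_inv_cancel₀ hj, ← map_one (algebraMap E F), Algebra.trace_algebraMap] at h1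
  have : CharZero E := charZero_of_injective_algebraMap (algebraMap k E).injective
  simp [Module.finrank_pos.ne'] at h1

theorem AlgIndepCoeff.isUnit_tmul {k E κ ι : Type*} [Field k] [CharZero k] [Field E]
    [Algebra k E] [Fintype ι] {g : ι → E} (hg : AlgIndepCoeff k g) [Field κ] [Algebra k κ]
    [FiniteDimensional k κ] (x : ι → κ) (j : ι) (hj : x j ≠ 0) :
    IsUnit (∑ i, g i ⊗ₜ[k] x i : E ⊗[k] κ) := by
  by_contra hu
  obtain ⟨n, hn, hmem⟩ := exists_max_ideal_of_mem_nonunits hu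
  let _ : Field ((E ⊗[k] κ) ⧸ n) := Ideal.Quotient.field n
  have : Module.Finite E ((E ⊗[k] κ) ⧸ n) :=
    Module.Finite.of_surjective (Ideal.Quotient.mkₐ E n).toLinearMap Ideal.Quotient.mk_surjective
  let φ : κ →ₐ[k] ((E ⊗[k] κ) ⧸ n) :=
    (Ideal.Quotient.mkₐ k n).comp Algebra.TensorProduct.includeRight
  have key := hg.finite_extension (fun i => φ (x i))
    (fun i => ((Algebra.IsIntegral.isIntegral (R := k) (x i)).map φ).isAlgebraic) (by
      have h0 := Ideal.Quotient.eq_zero_iff_mem.mpr hmem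
      rw [map_sum] at h0
      rw [← h0]
      refine Finset.sum_congr rfl fun i _ => ?_
      have : (g i ⊗ₜ[k] x i : E ⊗[k] κ) = g i • ((1 : E) ⊗ₜ[k] x i) := by
        simp [TensorProduct.smul_tmul']
      rw [this]
      rfl) j
  exact hj ((map_eq_zero φ).mp key)

/-- If `g` has no relations with algebraic coefficients and `x ≠ 0`, then `∑ gⱼ ⊗ xⱼ` is not
a zero divisor in `E ⊗ D`, for every finitely generated domain `D`. -/
theorem AlgIndepCoeff.eq_zero_of_mul_eq_zero {k E D ι : Type*} [Field k] [CharZero k] [Field E]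
    [Algebra k E] [Fintype ι] {g : ι → E} (hg : AlgIndepCoeff k g) [CommRing D] [IsDomain D]
    [Algebra k D] [Algebra.FiniteType k D] (x : ι → D) (j : ι) (hj : x j ≠ 0)
    (u : E ⊗[k] D) (hu : u * ∑ i, g i ⊗ₜ[k] x i = 0) : u = 0 := by
  classical
  have hfun : ∀ l : E →ₗ[k] k, TensorProduct.lid k D (l.rTensor D u) = 0 := by
    intro l
    by_contra hw
    set w := TensorProduct.lid k D (l.rTensor D u) with hwdef
    have hjac : IsJacobsonRing D := isJacobsonRing_of_finiteType (A := k)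
    have hne : w * x j ∉ (⊥ : Ideal D).jacobson := by
      rw [hjac.out (Ideal.IsPrime.isRadical (Ideal.isPrime_bot))]
      simpa using ⟨hw, hj⟩
    obtain ⟨m, hm, hmw⟩ : ∃ m : Ideal D, m.IsMaximal ∧ w * x j ∉ m := by
      rw [Ideal.jacobson, Ideal.mem_sInf] at hne
      push Not at hne
      obtain ⟨m, hm, h⟩ := hne
      exact ⟨m, hm.2, h⟩
    let _ : Field (D ⧸ m) := Ideal.Quotient.field m
    have : Module.Finite k (D ⧸ m) := finite_of_finite_type_of_isJacobsonRing k (D ⧸ m)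
    let π : D →ₐ[k] D ⧸ m := Ideal.Quotient.mkₐ k m
    have hxj : π (x j) ≠ 0 := fun h =>
      hmw (m.mul_mem_left _ (Ideal.Quotient.eq_zero_iff_mem.mp h))
    have hunit := hg.isUnit_tmul (fun i => π (x i)) j hxj
    let ψ : E ⊗[k] D →ₐ[k] E ⊗[k] (D ⧸ m) := Algebra.TensorProduct.map (AlgHom.id k E) π
    have hψ : ψ u = 0 := by
      have h := congrArg ψ hu
      rw [map_mul, map_sum, map_zero] at h
      simp only [ψ, Algebra.TensorProduct.map_tmul, AlgHom.id_apply] at h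
      exact (hunit.mul_left_eq_zero).mp h
    have hcomm : ∀ t : E ⊗[k] D, π (TensorProduct.lid k D (l.rTensor D t)) =
        TensorProduct.lid k (D ⧸ m) (l.rTensor (D ⧸ m) (ψ t)) := by
      intro t
      induction t with
      | zero => simp
      | add a b ha hb => simp only [map_add, ha, hb]
      | tmul a b => simp [ψ]
    have : π w = 0 := by rw [hwdef, hcomm, hψ]; simp
    exact hmw (m.mul_mem_right _ (Ideal.Quotient.eq_zero_iff_mem.mp this))
  let b := Module.Free.chooseBasis k D
  let B := b.baseChange E
  have : B.repr u = 0 := by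
    ext i
    have hrepr : ∀ (l : E →ₗ[k] k) (t : E ⊗[k] D),
        b.repr (TensorProduct.lid k D (l.rTensor D t)) i = l (B.repr t i) := by
      intro l t
      induction t with
      | zero => simp
      | add a c ha hc => simp only [map_add, Finsupp.add_apply, ha, hc]
      | tmul a c => simp [B, Module.Basis.baseChange_repr_tmul, mul_comm]
    refine (Module.forall_dual_apply_eq_zero_iff k _).mp fun l => ?_
    rw [← hrepr, hfun]
    simp
  simpa using this

end Mahler

namespace Mahler
open Filter Topology Polynomial

theorem eventuallyEq_nhdsNE_of_isPreconnected {F G : ℂ → ℂ} {U : Set ℂ}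
    (hF : MeromorphicOn F U) (hG : MeromorphicOn G U) (hU : IsPreconnected U) {x y : ℂ}
    (hx : x ∈ U) (h : F =ᶠ[𝓝[≠] x] G) (hy : y ∈ U) : F =ᶠ[𝓝[≠] y] G := by
  have h1 : meromorphicOrderAt (F - G) x = ⊤ :=
    meromorphicOrderAt_eq_top_iff.mpr (h.mono fun z hz => by simp [hz])
  have h2 : meromorphicOrderAt (F - G) y = ⊤ := by
    by_contra h3
    exact (hF.sub hG).meromorphicOrderAt_ne_top_of_isPreconnected hU hy hx h3 h1
  exact (meromorphicOrderAt_eq_top_iff.mp h2).mono fun z hz => sub_eq_zero.mp hz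

/-- A bound for the roots of `P(z, ·)` when `P` is monic. -/
def rootBound (P : ℂ[X][X]) (z : ℂ) : ℝ :=
  1 + ∑ i ∈ Finset.range P.natDegree, ‖(P.coeff i).eval z‖

theorem continuous_rootBound (P : ℂ[X][X]) : Continuous (rootBound P) := by
  unfold rootBound
  fun_prop

theorem norm_le_rootBound {P : ℂ[X][X]} (hP : P.Monic) {z y : ℂ} (h : P.evalEval z y = 0) :
    ‖y‖ ≤ rootBound P z := by
  rw [← map_evalRingHom_eval] at h
  have hm := hP.map (evalRingHom z)
  have h1 := (IsRoot.norm_lt_cauchyBound hm.ne_zero h).le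
  rw [cauchyBound, hm.leadingCoeff, nnnorm_one, div_one] at h1
  have h2 : (Finset.range (P.map (evalRingHom z)).natDegree).sup
      (fun i => ‖(P.map (evalRingHom z)).coeff i‖₊) ≤
      ∑ i ∈ Finset.range P.natDegree, ‖(P.coeff i).eval z‖₊ := by
    refine Finset.sup_le fun i hi => ?_
    rw [hP.natDegree_map] at hi
    simpa using Finset.single_le_sum (f := fun i => ‖(P.coeff i).eval z‖₊)
      (fun _ _ => zero_le) hi
  have h3 : ‖y‖₊ ≤ 1 + ∑ i ∈ Finset.range P.natDegree, ‖(P.coeff i).eval z‖₊ :=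
    h1.trans (by rw [add_comm]; gcongr)
  simpa [rootBound] using NNReal.coe_le_coe.mpr h3

theorem analyticOnNhd_of_monic {U : Set ℂ} {F h : ℂ → ℂ} (hF : MeromorphicOn F U)
    (hh : ContinuousOn h U) (hU : IsOpen U) {P : ℂ[X][X]} (hP : P.Monic)
    (heq : ∀ x ∈ U, ∀ᶠ z in 𝓝[≠] x, P.evalEval (h z) (F z) = 0) :
    AnalyticOnNhd ℂ (toMeromorphicNFOn F U) U := by
  intro x hx
  rw [← (meromorphicNFOn_toMeromorphicNFOn F U hx).meromorphicOrderAt_nonneg_iff_analyticAt,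
    meromorphicOrderAt_toMeromorphicNFOn hF hx]
  by_contra! hlt
  have h1 := tendsto_norm_cobounded_atTop.comp (tendsto_cobounded_of_meromorphicOrderAt_neg hlt)
  have h2 : ∀ᶠ z in 𝓝[≠] x, rootBound P (h z) < rootBound P (h x) + 1 := by
    have : ContinuousAt (fun z => rootBound P (h z)) x :=
      (continuous_rootBound P).continuousAt.comp (hh.continuousAt (hU.mem_nhds hx))
    exact (this.eventually_lt_const (lt_add_one _)).filter_mono nhdsWithin_le_nhds
  have h3 := h1.eventually_ge_atTop (rootBound P (h x) + 1)
  obtain ⟨z, hz1, hz2, hz3⟩ := (h2.and (h3.and (heq x hx))).exists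
  exact absurd (norm_le_rootBound hP hz3) (not_le.mpr (hz1.trans_le hz2))

theorem rootBound_le (P : ℂ[X][X]) : ∃ (C : ℝ) (N : ℕ), ∀ R : ℝ, 1 ≤ R → ∀ z : ℂ, ‖z‖ = R →
    rootBound P z ≤ C * R ^ N := by
  have h1 : ∀ p : ℂ[X], ∃ C : ℝ, 0 ≤ C ∧ ∀ N, p.natDegree ≤ N → ∀ R : ℝ, 1 ≤ R →
      ∀ z : ℂ, ‖z‖ = R → ‖p.eval z‖ ≤ C * R ^ N := by
    intro p
    refine ⟨∑ i ∈ Finset.range (p.natDegree + 1), ‖p.coeff i‖,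
      Finset.sum_nonneg fun _ _ => norm_nonneg _, fun N hN R hR z hz => ?_⟩
    rw [eval_eq_sum_range, Finset.sum_mul]
    refine (norm_sum_le _ _).trans (Finset.sum_le_sum fun i hi => ?_)
    rw [norm_mul, norm_pow, hz]
    gcongr
    exact (Nat.lt_succ_iff.mp (Finset.mem_range.mp hi)).trans hN
  choose C hC0 hC using h1
  refine ⟨1 + ∑ i ∈ Finset.range P.natDegree, C (P.coeff i),
    ∑ i ∈ Finset.range P.natDegree, (P.coeff i).natDegree, fun R hR z hz => ?_⟩
  rw [rootBound, add_mul, one_mul, Finset.sum_mul]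
  gcongr with i hi
  · exact one_le_pow₀ hR
  · exact hC _ _ (Finset.single_le_sum (f := fun i => (P.coeff i).natDegree)
      (fun _ _ => Nat.zero_le _) hi) R hR z hz

/-- An entire function integral over the polynomials is a polynomial. -/
theorem exists_polynomial_of_monic {c : ℂ → ℂ} (hc : Differentiable ℂ c) {P : ℂ[X][X]}
    (hP : P.Monic) (heq : ∀ z, P.evalEval z (c z) = 0) : ∃ p : ℂ[X], ∀ z, c z = p.eval z := by
  obtain ⟨C, N, hCN⟩ := rootBound_le P
  have hz : ∀ n, N < n → iteratedDeriv n c 0 = 0 := by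
    intro n hn
    have h1 : ∀ R : ℝ, 1 ≤ R → ‖iteratedDeriv n c 0‖ ≤ n.factorial * C / R := by
      intro R hR
      have hR0 : 0 < R := by linarith
      have h2 := Complex.norm_iteratedDeriv_le_of_forall_mem_sphere_norm_le n hR0
        (hc.diffContOnCl (s := Metric.ball 0 R)) (C := C * R ^ N) (fun z hz =>
          (norm_le_rootBound hP (heq z)).trans (hCN R hR z (by simpa using hz)))
      have hC : 0 ≤ C := by
        have := (norm_nonneg _).trans
          ((norm_le_rootBound hP (heq 1)).trans (hCN 1 le_rfl 1 (by simp)))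
        simpa using this
      refine h2.trans ?_
      rw [← mul_assoc, div_le_div_iff₀ (by positivity) hR0, mul_assoc, ← pow_succ]
      gcongr
      exact hn
    have h3 : Tendsto (fun R : ℝ => n.factorial * C / R) atTop (𝓝 0) :=
      tendsto_const_nhds.div_atTop tendsto_id
    have := ge_of_tendsto h3 ((eventually_ge_atTop 1).mono h1)
    exact norm_le_zero_iff.mp this
  refine ⟨∑ n ∈ Finset.range (N + 1),
    Polynomial.C ((n.factorial : ℂ)⁻¹ * iteratedDeriv n c 0) * X ^ n, fun z => ?_⟩
  rw [← Complex.taylorSeries_eq_of_entire' 0 z hc, tsum_eq_sum (s := Finset.range (N + 1))]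
  · simp [eval_finsetSum]
  · intro n hn
    rw [hz n (by simpa using hn)]
    simp

end Mahler

namespace Mahler
open Filter Topology Polynomial
open scoped ContDiff

theorem evalEval_eq_sum (P : ℂ[X][X]) (z y : ℂ) :
    P.evalEval z y = ∑ i ∈ Finset.range (P.natDegree + 1), (P.coeff i).eval z * y ^ i := by
  rw [evalEval, eval_eq_sum_range (p := P), eval_finsetSum]
  simp

theorem contDiff_evalEval (P : ℂ[X][X]) :
    ContDiff ℂ ω (fun u : ℂ × ℂ => P.evalEval u.1 u.2) := by
  simp only [evalEval_eq_sum]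
  refine ContDiff.sum fun i _ => ContDiff.mul ?_ (contDiff_snd.pow i)
  have h : ContDiff ℂ ω (fun z : ℂ => (P.coeff i).eval z) := by
    simpa only [coe_aeval_eq_eval] using contDiff_aeval (𝕜 := ℂ) (P.coeff i) ω
  exact h.comp contDiff_fst

theorem continuous_evalEval (P : ℂ[X][X]) :
    Continuous (fun u : ℂ × ℂ => P.evalEval u.1 u.2) := (contDiff_evalEval P).continuous

theorem hasDerivAt_evalEval (P : ℂ[X][X]) (z y : ℂ) :
    HasDerivAt (fun y => P.evalEval z y) (P.derivative.evalEval z y) y := by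
  simp only [← map_evalRingHom_eval, ← derivative_map]
  exact Polynomial.hasDerivAt _ _

theorem exists_implicit {P : ℂ[X][X]} {ζ y : ℂ} (h0 : P.evalEval ζ y = 0)
    (h1 : P.derivative.evalEval ζ y ≠ 0) : ∃ φ : ℂ → ℂ, AnalyticAt ℂ φ ζ ∧
      ∀ᶠ u : ℂ × ℂ in 𝓝 (ζ, y), P.evalEval u.1 u.2 = 0 → φ u.1 = u.2 := by
  have hcd := (contDiff_evalEval P).contDiffAt (x := (ζ, y))
  have hinv : (fderiv ℂ (fun u : ℂ × ℂ => P.evalEval u.1 u.2) (ζ, y) ∘L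
      .inr ℂ ℂ ℂ).IsInvertible := by
    have h2 : HasFDerivAt (fun y => P.evalEval ζ y)
        (fderiv ℂ (fun u : ℂ × ℂ => P.evalEval u.1 u.2) (ζ, y) ∘L .inr ℂ ℂ ℂ) y :=
      (hcd.differentiableAt (by simp)).hasFDerivAt.comp y (hasFDerivAt_prodMk_right ζ y)
    rw [h2.unique (hasDerivAt_evalEval P ζ y).hasFDerivAt]
    refine ⟨ContinuousLinearEquiv.unitsEquivAut ℂ (Units.mk0 _ h1), ?_⟩
    ext
    simp
  refine ⟨hcd.implicitFunction (by simp) hinv,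
    (hcd.contDiffAt_implicitFunction (by simp) hinv).analyticAt, ?_⟩
  filter_upwards [hcd.eventually_apply_eq_iff_implicitFunction (by simp) hinv] with u hu h
  exact hu.mp (by rw [h, h0])

theorem exists_extension_at {c : ℂ → ℂ} (hc : AnalyticOnNhd ℂ c (Metric.ball 0 1))
    {P : ℂ[X][X]} (hP : P.Monic) (heq : ∀ z ∈ Metric.ball (0 : ℂ) 1, P.evalEval z (c z) = 0)
    {ζ : ℂ} (hζ : ‖ζ‖ = 1)
    (hsep : ∀ y, P.evalEval ζ y = 0 → P.derivative.evalEval ζ y ≠ 0) :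
    ∃ ε > 0, ∃ φ : ℂ → ℂ, AnalyticOnNhd ℂ φ (Metric.ball ζ ε) ∧
      ∀ z ∈ Metric.ball ζ ε ∩ Metric.ball 0 1, φ z = c z := by
  let z : ℕ → ℂ := fun j => ((1 - 1 / ((j : ℝ) + 1) : ℝ) : ℂ) * ζ
  have hz1 : ∀ j, z j ∈ Metric.ball (0 : ℂ) 1 := by
    intro j
    have h1 : 0 < 1 / ((j : ℝ) + 1) := by positivity
    have h2 : 1 / ((j : ℝ) + 1) ≤ 1 := by
      rw [div_le_one (by positivity)]
      have : (0 : ℝ) ≤ j := by positivity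
      linarith
    rw [mem_ball_zero_iff, norm_mul, hζ, mul_one, Complex.norm_real, Real.norm_eq_abs,
      abs_of_nonneg (by linarith)]
    linarith
  have hzt : Tendsto z atTop (𝓝 ζ) := by
    have h1 : Tendsto (fun j : ℕ => 1 - 1 / ((j : ℝ) + 1)) atTop (𝓝 1) := by
      simpa using tendsto_one_div_add_atTop_nhds_zero_nat.const_sub (1 : ℝ)
    have h2 := ((Complex.continuous_ofReal.tendsto 1).comp h1).mul_const ζ
    simpa [z] using h2
  obtain ⟨M, hM⟩ := (isCompact_closedBall (0 : ℂ) 1).exists_bound_of_continuousOn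
    (continuous_rootBound P).continuousOn
  have hb : ∀ j, c (z j) ∈ Metric.closedBall (0 : ℂ) M := by
    intro j
    rw [mem_closedBall_zero_iff]
    exact (norm_le_rootBound hP (heq _ (hz1 j))).trans ((le_abs_self _).trans
      (hM _ (Metric.ball_subset_closedBall (hz1 j))))
  obtain ⟨y, -, s, hs, hsy⟩ := (isCompact_closedBall (0 : ℂ) M).tendsto_subseq hb
  have hlim : Tendsto (fun j => (z (s j), c (z (s j)))) atTop (𝓝 (ζ, y)) :=
    (hzt.comp hs.tendsto_atTop).prodMk_nhds hsy
  have hy : P.evalEval ζ y = 0 := by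
    have h1 := ((continuous_evalEval P).tendsto (ζ, y)).comp hlim
    refine tendsto_nhds_unique h1 ?_
    refine tendsto_const_nhds.congr fun j => ?_
    exact (heq _ (hz1 _)).symm
  obtain ⟨φ, hφ, hφu⟩ := exists_implicit hy (hsep y hy)
  obtain ⟨ε, hε, hball⟩ := Metric.eventually_nhds_iff_ball.mp hφ.eventually_analyticAt
  refine ⟨ε, hε, φ, hball, ?_⟩
  obtain ⟨j, hj1, hj2⟩ := ((hlim.eventually hφu.eventually_nhds).and
    ((hzt.comp hs.tendsto_atTop).eventually (Metric.ball_mem_nhds ζ hε))).exists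
  have hmem : z (s j) ∈ Metric.ball ζ ε ∩ Metric.ball 0 1 := ⟨hj2, hz1 _⟩
  have hloc : φ =ᶠ[𝓝 (z (s j))] c := by
    have hcont : ContinuousAt (fun w => (w, c w)) (z (s j)) :=
      continuousAt_id.prodMk (hc _ (hz1 _)).continuousAt
    filter_upwards [hcont.eventually hj1, Metric.isOpen_ball.mem_nhds (hz1 (s j))] with w hw1 hw2
    exact hw1 (heq w hw2)
  have hpre : IsPreconnected (Metric.ball ζ ε ∩ Metric.ball (0 : ℂ) 1) :=
    ((convex_ball ζ ε).inter (convex_ball 0 1)).isPreconnected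
  have hφ' : AnalyticOnNhd ℂ φ (Metric.ball ζ ε ∩ Metric.ball 0 1) := fun w hw => hball w hw.1
  exact hφ'.eqOn_of_preconnected_of_eventuallyEq (hc.mono Set.inter_subset_right) hpre hmem hloc

end Mahler

namespace Mahler
open Filter Topology Polynomial

/-- The minimal polynomial of an element integral over `ℂ[X]` is separable outside finitely many
specialisations. -/
theorem exists_bezout_of_integral {c : MGerm} (hc : IsIntegral ℂ[X] c) :
    ∃ (U V : ℂ[X][X]) (e : ℂ[X]), e ≠ 0 ∧
      U * minpoly ℂ[X] c + V * (minpoly ℂ[X] c).derivative = C e := by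
  set P := minpoly ℂ[X] c with hPdef
  let K := FractionRing ℂ[X]
  let M := nonZeroDivisors ℂ[X]
  have hirr : Irreducible (P.map (algebraMap ℂ[X] K)) :=
    ((minpoly.monic hc).irreducible_iff_irreducible_map_fraction_map).1 (minpoly.irreducible hc)
  obtain ⟨a, b, hab⟩ := hirr.separable
  obtain ⟨s, hs, ha⟩ := IsLocalization.integerNormalization_spec M a
  obtain ⟨t, ht, hb⟩ := IsLocalization.integerNormalization_spec M b
  refine ⟨C t * IsLocalization.integerNormalization M a,
    C s * IsLocalization.integerNormalization M b, s * t,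
    mul_ne_zero (nonZeroDivisors.ne_zero hs) (nonZeroDivisors.ne_zero ht), ?_⟩
  apply Polynomial.map_injective (algebraMap ℂ[X] K) (IsFractionRing.injective ℂ[X] K)
  simp only [Polynomial.map_add, Polynomial.map_mul, map_C, ha, hb, Algebra.smul_def,
    ← derivative_map, map_mul, Polynomial.algebraMap_apply]
  linear_combination (C (algebraMap ℂ[X] K s) * C (algebraMap ℂ[X] K t)) * hab

namespace MGerm

theorem meromorphicAt_evalEval (P : ℂ[X][X]) {h F : ℂ → ℂ} {z : ℂ} (hh : AnalyticAt ℂ h z)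
    (hF : MeromorphicAt F z) : MeromorphicAt (fun w => P.evalEval (h w) (F w)) z := by
  simp only [evalEval_eq_sum]
  refine MeromorphicAt.fun_sum fun i _ => ?_
  exact MeromorphicAt.mul (hh.aeval_polynomial (P.coeff i)).meromorphicAt (hF.pow i)

theorem aeval_mk (P : ℂ[X][X]) {F : ℂ → ℂ} (hF : MeromorphicAt F 0) :
    aeval (mk F hF) P =
      mk (fun z => P.evalEval z (F z)) (meromorphicAt_evalEval P analyticAt_id hF) := by
  induction P using Polynomial.induction_on' with
  | add p r hp hr =>
    rw [map_add, hp, hr, mk_add, mk_eq_mk]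
    filter_upwards with z
    simp
  | monomial n a =>
    rw [aeval_monomial, algebraMap_eq]
    have : (mk F hF) ^ n = mk (F ^ n) (hF.pow n) := rfl
    rw [this, mk_mul, mk_eq_mk]
    filter_upwards with z
    simp [evalEval]

/-- The germs that extend meromorphically to the disc of radius `r`. -/
def extSubfield (r : ℝ) : Subfield MGerm where
  carrier := {φ | ∃ F, MeromorphicOn F (Metric.ball 0 r) ∧ ∃ h, mk F h = φ}
  mul_mem' := by
    rintro _ _ ⟨f, hf, hf0, rfl⟩ ⟨g, hg, hg0, rfl⟩
    exact ⟨f * g, hf.mul hg, hf0.mul hg0, rfl⟩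
  one_mem' := ⟨fun _ => 1, fun z _ => MeromorphicAt.const 1 z, MeromorphicAt.const 1 0, rfl⟩
  add_mem' := by
    rintro _ _ ⟨f, hf, hf0, rfl⟩ ⟨g, hg, hg0, rfl⟩
    exact ⟨f + g, hf.add hg, hf0.add hg0, rfl⟩
  zero_mem' := ⟨fun _ => 0, fun z _ => MeromorphicAt.const 0 z, MeromorphicAt.const 0 0, rfl⟩
  neg_mem' := by
    rintro _ ⟨f, hf, hf0, rfl⟩
    exact ⟨-f, hf.neg, hf0.neg, rfl⟩
  inv_mem' := by
    rintro _ ⟨f, hf, hf0, rfl⟩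
    exact ⟨f⁻¹, hf.inv, hf0.inv, rfl⟩

theorem algebraMap_mem_extSubfield (r : ℝ) (p : ℂ[X]) : algebraMap ℂ[X] MGerm p ∈ extSubfield r :=
  ⟨fun z => p.eval z, fun z _ => meromorphicAt_eval p z, meromorphicAt_eval p 0, rfl⟩

theorem extSubfield_anti {r s : ℝ} (h : s ≤ r) : extSubfield r ≤ extSubfield s := by
  rintro _ ⟨f, hf, hf0, rfl⟩
  exact ⟨f, hf.mono_set (Metric.ball_subset_ball h), hf0, rfl⟩

theorem exists_mem_extSubfield (φ : MGerm) : ∃ r > 0, φ ∈ extSubfield r := by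
  obtain ⟨f, hf, rfl⟩ := φ.exists_rep
  have h : ∀ᶠ z in 𝓝 (0 : ℂ), MeromorphicAt f z := by
    filter_upwards [eventually_nhdsWithin_iff.mp hf.eventually_analyticAt] with z hz
    by_cases h0 : z = 0
    · exact h0 ▸ hf
    · exact (hz h0).meromorphicAt
  obtain ⟨r, hr, hball⟩ := Metric.eventually_nhds_iff_ball.mp h
  exact ⟨r, hr, f, hball, hf, rfl⟩

theorem sigma_mem_extSubfield {q : ℕ} (hq : q ≠ 0) {φ : MGerm} {r s : ℝ} (hs : s ^ q ≤ r)
    (h : φ ∈ extSubfield r) : sigma hq φ ∈ extSubfield s := by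
  obtain ⟨f, hf, hf0, rfl⟩ := h
  refine ⟨fun z => f (z ^ q), fun z hz => ?_, meromorphicAt_comp_pow hq hf0, rfl⟩
  have hz' : ‖z‖ < s := by simpa using hz
  have : MeromorphicAt f (z ^ q) := hf _ (by
    rw [mem_ball_zero_iff, norm_pow]
    exact (pow_lt_pow_left₀ hz' (norm_nonneg z) hq).trans_le hs)
  exact this.comp_analyticAt (g := fun z : ℂ => z ^ q) (analyticAt_id.pow q)

/-- A germ integral over the polynomials and meromorphic on a disc is analytic there. -/
theorem exists_analytic_of_integral {c : MGerm} {P : ℂ[X][X]} (hP : P.Monic)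
    (hPc : aeval c P = 0) {r : ℝ} (hr : 0 < r) (hc : c ∈ extSubfield r) :
    ∃ F : ℂ → ℂ, AnalyticOnNhd ℂ F (Metric.ball 0 r) ∧ (∃ h, mk F h = c) ∧
      ∀ z ∈ Metric.ball (0 : ℂ) r, P.evalEval z (F z) = 0 := by
  obtain ⟨F, hF, hF0, rfl⟩ := hc
  set U := Metric.ball (0 : ℂ) r
  have h0 : (0 : ℂ) ∈ U := Metric.mem_ball_self hr
  have hUc : IsPreconnected U := (convex_ball 0 r).isPreconnected
  rw [aeval_mk, mk_eq_zero] at hPc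
  have heq : ∀ x ∈ U, ∀ᶠ z in 𝓝[≠] x, P.evalEval z (F z) = 0 := fun x hx =>
    eventuallyEq_nhdsNE_of_isPreconnected
      (fun z hz => meromorphicAt_evalEval P analyticAt_id (hF z hz))
      (fun z _ => MeromorphicAt.const 0 z) hUc h0 hPc hx
  have han := analyticOnNhd_of_monic hF continuousOn_id Metric.isOpen_ball hP heq
  refine ⟨toMeromorphicNFOn F U, han, ⟨(han 0 h0).meromorphicAt, ?_⟩, fun z hz => ?_⟩
  · rw [mk_eq_mk]
    exact hF.toMeromorphicNFOn_eq_self_on_nhdsNE h0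
  · have h1 : ∀ᶠ w in 𝓝[≠] z, P.evalEval w (toMeromorphicNFOn F U w) = 0 := by
      filter_upwards [heq z hz, hF.toMeromorphicNFOn_eq_self_on_nhdsNE hz] with w hw hw'
      rw [hw', hw]
    have h2 : ContinuousAt (fun w => P.evalEval w (toMeromorphicNFOn F U w)) z :=
      (continuous_evalEval P).continuousAt.comp (continuousAt_id.prodMk (han z hz).continuousAt)
    exact tendsto_nhds_unique (h2.tendsto.mono_left nhdsWithin_le_nhds)
      (tendsto_const_nhds.congr' (h1.mono fun w hw => hw.symm))

/-- Gluing of the extensions to discs. -/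
theorem exists_analytic_of_forall_mem {c : MGerm} {P : ℂ[X][X]} (hP : P.Monic)
    (hPc : aeval c P = 0) {U : Set ℂ} (hU : IsOpen U) (h0 : (0 : ℂ) ∈ U)
    (h : ∀ z ∈ U, ∃ r > ‖z‖, c ∈ extSubfield r) :
    ∃ F : ℂ → ℂ, AnalyticOnNhd ℂ F U ∧ (∃ h, mk F h = c) ∧
      ∀ z ∈ U, P.evalEval z (F z) = 0 := by
  have h' : ∀ z : ℂ, ∃ (r : ℝ) (F : ℂ → ℂ), z ∈ U → ‖z‖ < r ∧
      AnalyticOnNhd ℂ F (Metric.ball 0 r) ∧ (∃ h, mk F h = c) ∧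
      ∀ z ∈ Metric.ball (0 : ℂ) r, P.evalEval z (F z) = 0 := by
    intro z
    by_cases hz : z ∈ U
    · obtain ⟨r, hr, hcr⟩ := h z hz
      obtain ⟨F, hF⟩ := exists_analytic_of_integral hP hPc ((norm_nonneg z).trans_lt hr) hcr
      exact ⟨r, F, fun _ => ⟨hr, hF⟩⟩
    · exact ⟨0, 0, fun h => absurd h hz⟩
  choose r F hF using h'
  have hloc : ∀ z ∈ U, (fun w => F w w) =ᶠ[𝓝 z] F z := by
    intro z hz
    obtain ⟨hz1, hz2, ⟨hz3, hz4⟩, -⟩ := hF z hz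
    filter_upwards [hU.mem_nhds hz, Metric.isOpen_ball.mem_nhds
      (show z ∈ Metric.ball (0 : ℂ) (r z) by simpa using hz1)] with w hw hwz
    obtain ⟨hw1, hw2, ⟨hw3, hw4⟩, -⟩ := hF w hw
    have hsub1 : Metric.ball (0 : ℂ) (min (r z) (r w)) ⊆ Metric.ball 0 (r z) :=
      Metric.ball_subset_ball (min_le_left _ _)
    have hsub2 : Metric.ball (0 : ℂ) (min (r z) (r w)) ⊆ Metric.ball 0 (r w) :=
      Metric.ball_subset_ball (min_le_right _ _)
    have hmem : w ∈ Metric.ball (0 : ℂ) (min (r z) (r w)) := by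
      simp only [mem_ball_zero_iff, lt_min_iff] at hwz ⊢
      exact ⟨hwz, hw1⟩
    have h00 : (0 : ℂ) ∈ Metric.ball (0 : ℂ) (min (r z) (r w)) :=
      Metric.mem_ball_self ((norm_nonneg w).trans_lt (by simpa using hmem))
    refine (hw2.mono hsub2).eqOn_of_preconnected_of_frequently_eq (hz2.mono hsub1)
      (convex_ball 0 _).isPreconnected h00 ?_ hmem
    exact (mk_eq_mk.mp (hw4.trans hz4.symm)).frequently
  have han : AnalyticOnNhd ℂ (fun w => F w w) U := fun z hz =>
    ((hF z hz).2.1 z (by simpa using (hF z hz).1)).congr (hloc z hz).symm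
  refine ⟨fun w => F w w, han, ⟨(han 0 h0).meromorphicAt, ?_⟩, fun z hz => ?_⟩
  · obtain ⟨-, -, ⟨h3, h4⟩, -⟩ := hF 0 h0
    rw [← h4, mk_eq_mk]
    exact (hloc 0 h0).filter_mono nhdsWithin_le_nhds
  · exact (hF z hz).2.2.2 z (by simpa using (hF z hz).1)

end MGerm
end Mahler

namespace Mahler
open Filter Topology Polynomial

/-- The open square of centre `y * I` and half-side `T`. -/
def box (y T : ℝ) : Set ℂ := {w | |w.re| < T ∧ |w.im - y| < T}

theorem box_eq (y T : ℝ) : box y T = Complex.reLm ⁻¹' Metric.ball 0 T ∩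
    Complex.imLm ⁻¹' Metric.ball y T := by
  ext w
  simp [box, Real.dist_eq]

theorem isOpen_box (y T : ℝ) : IsOpen (box y T) := by
  rw [box_eq]
  exact (Metric.isOpen_ball.preimage Complex.continuous_re).inter
    (Metric.isOpen_ball.preimage Complex.continuous_im)

theorem convex_box (y T : ℝ) : Convex ℝ (box y T) := by
  rw [box_eq]
  exact ((convex_ball _ _).linear_preimage Complex.reLm).inter
    ((convex_ball _ _).linear_preimage Complex.imLm)

theorem tendsto_exp_nhdsNE (w : ℂ) : Tendsto Complex.exp (𝓝[≠] w) (𝓝[≠] (Complex.exp w)) :=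
  (Complex.hasDerivAt_exp w).tendsto_nhdsNE (Complex.exp_ne_zero w)

theorem norm_exp_lt_one {w : ℂ} (hw : w.re < 0) : Complex.exp w ∈ Metric.ball (0 : ℂ) 1 := by
  rw [mem_ball_zero_iff, Complex.norm_exp]
  exact Real.exp_lt_one_iff.mpr hw

section Glue

variable {C G : ℂ → ℂ} {y T : ℝ}

theorem box_wellDefined (hG : AnalyticOnNhd ℂ G (box y T))
    (hCG : ∀ w ∈ box y T, w.re < 0 → G w = C (Complex.exp w)) {w w' : ℂ} (hw : w ∈ box y T)
    (hw' : w' ∈ box y T) (h : Complex.exp w = Complex.exp w') : G w' = G w := by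
  have hT : 0 < T := (abs_nonneg _).trans_lt hw.1
  set d := w' - w with hd
  have hdre : d.re = 0 := by
    have := congrArg norm h
    rw [Complex.norm_exp, Complex.norm_exp, Real.exp_eq_exp] at this
    simp [hd, this]
  have hexp : ∀ u, Complex.exp (u + d) = Complex.exp u := by
    intro u
    rw [hd, Complex.exp_add, Complex.exp_sub, h, div_self (Complex.exp_ne_zero _), mul_one]
  let U := box y T ∩ (fun u => u + d) ⁻¹' box y T
  have hUo : IsOpen U :=
    (isOpen_box y T).inter ((isOpen_box y T).preimage (continuous_id.add continuous_const))
  have hUc : IsPreconnected U :=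
    ((convex_box y T).inter ((convex_box y T).translate_preimage_left d)).isPreconnected
  have hwU : w ∈ U := ⟨hw, by simpa [hd] using hw'⟩
  let u : ℂ := ⟨-T / 2, w.im⟩
  have hur : |-T / 2| < T := by rw [abs_lt]; constructor <;> linarith
  have hu : u ∈ U := by
    refine ⟨⟨hur, hw.2⟩, ?_, ?_⟩
    · simpa [u, hdre] using hur
    · have := hw'.2
      simpa [u, hd] using this
  have h1 : AnalyticOnNhd ℂ (fun v => G (v + d)) U := fun v hv =>
    (hG (v + d) hv.2).comp (f := fun v => v + d) (analyticAt_id.add analyticAt_const)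
  have h2 : AnalyticOnNhd ℂ G U := fun v hv => hG v hv.1
  have h3 : (fun v => G (v + d)) =ᶠ[𝓝 u] G := by
    have hre : ∀ᶠ v : ℂ in 𝓝 u, v.re < 0 :=
      Complex.continuous_re.continuousAt.eventually_lt_const (by simp [u]; linarith)
    filter_upwards [hUo.mem_nhds hu, hre] with v hv hv'
    rw [hCG v hv.1 hv', hCG _ hv.2 (by simpa [hdre] using hv'), hexp]
  have := h1.eqOn_of_preconnected_of_eventuallyEq h2 hUc hu h3 hwU
  simpa [hd] using this

theorem exists_exp_eq (hT : Real.pi < T) {z : ℂ} (h1 : 1 ≤ ‖z‖) (h2 : ‖z‖ < Real.exp T) :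
    ∃ w ∈ box y T, Complex.exp w = z := by
  have hz : z ≠ 0 := fun h => by simp [h] at h1; linarith
  have hn : ‖z * Complex.exp (-(y * Complex.I))‖ = ‖z‖ := by
    rw [norm_mul, Complex.norm_exp]
    simp
  refine ⟨Complex.log (z * Complex.exp (-(y * Complex.I))) + y * Complex.I, ⟨?_, ?_⟩, ?_⟩
  · have h3 : 0 ≤ Real.log ‖z‖ := Real.log_nonneg h1
    have h4 : Real.log ‖z‖ < T := by
      rwa [Real.log_lt_iff_lt_exp (by linarith)]
    rw [Complex.add_re, Complex.log_re, hn]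
    simpa [abs_of_nonneg h3] using h4
  · rw [Complex.add_im, Complex.log_im]
    simpa using (Complex.abs_arg_le_pi _).trans_lt hT
  · rw [Complex.exp_add, Complex.exp_log (mul_ne_zero hz (Complex.exp_ne_zero _)), mul_assoc,
      ← Complex.exp_add]
    simp

theorem exists_glue (hT : Real.pi < T) (hC : AnalyticOnNhd ℂ C (Metric.ball 0 1))
    (hG : AnalyticOnNhd ℂ G (box y T))
    (hCG : ∀ w ∈ box y T, w.re < 0 → G w = C (Complex.exp w)) :
    ∃ H : ℂ → ℂ, AnalyticOnNhd ℂ H (Metric.ball 0 (Real.exp T)) ∧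
      ∀ z ∈ Metric.ball (0 : ℂ) 1, H z = C z := by
  classical
  let H : ℂ → ℂ := fun z => if h : ∃ w ∈ box y T, Complex.exp w = z then G h.choose else C z
  have hH1 : ∀ w ∈ box y T, H (Complex.exp w) = G w := by
    intro w hw
    have h : ∃ w' ∈ box y T, Complex.exp w' = Complex.exp w := ⟨w, hw, rfl⟩
    simp only [H, dif_pos h]
    exact box_wellDefined hG hCG hw h.choose_spec.1 h.choose_spec.2.symm
  have hH2 : ∀ z ∈ Metric.ball (0 : ℂ) 1, H z = C z := by
    intro z hz
    by_cases h : ∃ w ∈ box y T, Complex.exp w = z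
    · obtain ⟨w, hw, rfl⟩ := h
      rw [hH1 w hw]
      refine hCG w hw ?_
      rw [mem_ball_zero_iff, Complex.norm_exp, Real.exp_lt_one_iff] at hz
      exact hz
    · simp only [H, dif_neg h]
  refine ⟨H, fun z hz => ?_, hH2⟩
  by_cases h1 : ‖z‖ < 1
  · have hz1 : z ∈ Metric.ball (0 : ℂ) 1 := by simpa using h1
    exact (hC z hz1).congr ((eventually_of_mem (Metric.isOpen_ball.mem_nhds hz1) hH2).mono
      fun w hw => hw.symm)
  · push Not at h1
    obtain ⟨w, hw, rfl⟩ := exists_exp_eq (y := y) hT h1 (by simpa using hz)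
    have hne := Complex.exp_ne_zero w
    let l : ℂ → ℂ := fun z => w + Complex.log (z / Complex.exp w)
    have hl : AnalyticAt ℂ l (Complex.exp w) := by
      refine analyticAt_const.add (AnalyticAt.clog (analyticAt_id.div analyticAt_const hne) ?_)
      simp
    have hlw : l (Complex.exp w) = w := by simp [l]
    have hGl : AnalyticAt ℂ (fun z => G (l z)) (Complex.exp w) := by
      have : AnalyticAt ℂ G (l (Complex.exp w)) := by rw [hlw]; exact hG w hw
      exact this.comp hl
    refine hGl.congr ?_
    have hev : ∀ᶠ z in 𝓝 (Complex.exp w), l z ∈ box y T :=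
      hl.continuousAt.eventually (by rw [hlw]; exact (isOpen_box y T).mem_nhds hw)
    filter_upwards [hev, isOpen_ne.mem_nhds hne] with z hz hz0
    rw [← hH1 _ hz]
    congr 1
    simp only [l]
    rw [Complex.exp_add, Complex.exp_log (div_ne_zero hz0 hne), mul_div_cancel₀ _ hne]

end Glue

namespace MGerm

/-- The germs that extend meromorphically to the unit disc and, through the exponential
covering, to `D`. -/
def stripSubfield (D : Set ℂ) : Subfield MGerm where
  carrier := {φ | ∃ F, MeromorphicOn F (Metric.ball 0 1) ∧ (∃ h, mk F h = φ) ∧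
    ∃ G, MeromorphicOn G D ∧ ∀ w ∈ D, w.re < 0 → ∀ᶠ u in 𝓝[≠] w, G u = F (Complex.exp u)}
  mul_mem' := by
    rintro _ _ ⟨f, hf, ⟨hf0, rfl⟩, F, hF, hfF⟩ ⟨g, hg, ⟨hg0, rfl⟩, G, hG, hgG⟩
    refine ⟨f * g, hf.mul hg, ⟨hf0.mul hg0, rfl⟩, F * G, hF.mul hG, fun w hw hw' => ?_⟩
    filter_upwards [hfF w hw hw', hgG w hw hw'] with u h1 h2
    simp [h1, h2]
  one_mem' := ⟨fun _ => 1, fun z _ => MeromorphicAt.const 1 z, ⟨MeromorphicAt.const 1 0, rfl⟩,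
    fun _ => 1, fun z _ => MeromorphicAt.const 1 z, by simp⟩
  add_mem' := by
    rintro _ _ ⟨f, hf, ⟨hf0, rfl⟩, F, hF, hfF⟩ ⟨g, hg, ⟨hg0, rfl⟩, G, hG, hgG⟩
    refine ⟨f + g, hf.add hg, ⟨hf0.add hg0, rfl⟩, F + G, hF.add hG, fun w hw hw' => ?_⟩
    filter_upwards [hfF w hw hw', hgG w hw hw'] with u h1 h2
    simp [h1, h2]
  zero_mem' := ⟨fun _ => 0, fun z _ => MeromorphicAt.const 0 z, ⟨MeromorphicAt.const 0 0, rfl⟩,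
    fun _ => 0, fun z _ => MeromorphicAt.const 0 z, by simp⟩
  neg_mem' := by
    rintro _ ⟨f, hf, ⟨hf0, rfl⟩, F, hF, hfF⟩
    refine ⟨-f, hf.neg, ⟨hf0.neg, rfl⟩, -F, hF.neg, fun w hw hw' => ?_⟩
    filter_upwards [hfF w hw hw'] with u h1
    simp [h1]
  inv_mem' := by
    rintro _ ⟨f, hf, ⟨hf0, rfl⟩, F, hF, hfF⟩
    refine ⟨f⁻¹, hf.inv, ⟨hf0.inv, rfl⟩, F⁻¹, hF.inv, fun w hw hw' => ?_⟩
    filter_upwards [hfF w hw hw'] with u h1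
    simp [h1]

theorem algebraMap_mem_stripSubfield (D : Set ℂ) (p : ℂ[X]) :
    algebraMap ℂ[X] MGerm p ∈ stripSubfield D := by
  refine ⟨fun z => p.eval z, fun z _ => meromorphicAt_eval p z, ⟨meromorphicAt_eval p 0, rfl⟩,
    fun w => p.eval (Complex.exp w), fun w _ => ?_, by simp⟩
  exact (meromorphicAt_eval p _).comp_analyticAt (Complex.differentiable_exp.analyticAt w)

theorem mem_stripSubfield_of_sigma {q : ℕ} (hq : q ≠ 0) {φ : MGerm} {y T : ℝ}
    (h1 : φ ∈ extSubfield 1) (h2 : sigma hq φ ∈ stripSubfield (box y T)) :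
    φ ∈ stripSubfield (box (q * y) (q * T)) := by
  obtain ⟨F, hF, hF0, rfl⟩ := h1
  obtain ⟨F', hF', ⟨hF0', h⟩, G, hG, hGF⟩ := h2
  rw [sigma_mk, mk_eq_mk] at h
  have hqpos : (0 : ℝ) < q := by positivity
  have hqC : (q : ℂ) ≠ 0 := by exact_mod_cast hq
  have hbox : ∀ w ∈ box (q * y) (q * T), w / q ∈ box y T := by
    intro w hw
    have e1 : (w / q).re = w.re / q := by simp
    have e2 : (w / q).im - y = (w.im - q * y) / q := by
      simp
      field_simp
    refine ⟨?_, ?_⟩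
    · rw [e1, abs_div, abs_of_pos hqpos, div_lt_iff₀' hqpos]
      exact hw.1
    · rw [e2, abs_div, abs_of_pos hqpos, div_lt_iff₀' hqpos]
      exact hw.2
  refine ⟨F, hF, ⟨hF0, rfl⟩, fun w => G (w / q), fun w hw => ?_, fun w hw hre => ?_⟩
  · exact (hG _ (hbox w hw)).comp_analyticAt (g := fun w : ℂ => w / q)
      (analyticAt_id.div analyticAt_const hqC)
  · have hre' : (w / q).re < 0 := by simpa using div_neg_of_neg_of_pos hre hqpos
    have ht : Tendsto (fun u : ℂ => u / q) (𝓝[≠] w) (𝓝[≠] (w / q)) :=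
      ((hasDerivAt_id w).div_const (q : ℂ)).tendsto_nhdsNE (by simpa using hqC)
    have hpow : MeromorphicOn (fun z => F (z ^ q)) (Metric.ball 0 1) := fun z hz => by
      have : MeromorphicAt F (z ^ q) := hF _ (by
        rw [mem_ball_zero_iff] at hz ⊢
        rw [norm_pow]
        exact pow_lt_one₀ (norm_nonneg z) hz hq)
      exact this.comp_analyticAt (g := fun z : ℂ => z ^ q) (analyticAt_id.pow q)
    have hpt := eventuallyEq_nhdsNE_of_isPreconnected hF' hpow (convex_ball 0 1).isPreconnected
      (Metric.mem_ball_self one_pos) h (norm_exp_lt_one hre')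
    filter_upwards [ht.eventually (hGF _ (hbox w hw) hre'),
      ht.eventually ((tendsto_exp_nhdsNE _).eventually hpt)] with u h3 h4
    rw [h3, h4, ← Complex.exp_nat_mul, mul_div_cancel₀ _ hqC]

theorem mem_extSubfield_exp_of_mem_strip {c : MGerm} {P : ℂ[X][X]} (hP : P.Monic)
    (hPc : aeval c P = 0) {y T : ℝ} (hT : Real.pi < T) (hc : c ∈ stripSubfield (box y T)) :
    c ∈ extSubfield (Real.exp T) := by
  obtain ⟨F, hF, ⟨hF0, rfl⟩, G, hG, hGF⟩ := hc
  obtain ⟨C, hC, ⟨hC0, hCF⟩, hPC⟩ := exists_analytic_of_integral hP hPc one_pos ⟨F, hF, hF0, rfl⟩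
  rw [mk_eq_mk] at hCF
  have hT0 : 0 < T := Real.pi_pos.trans hT
  have hGC : ∀ w ∈ box y T, w.re < 0 → ∀ᶠ u in 𝓝[≠] w, G u = C (Complex.exp u) := by
    intro w hw hre
    have := eventuallyEq_nhdsNE_of_isPreconnected hC.meromorphicOn hF
      (convex_ball 0 1).isPreconnected (Metric.mem_ball_self one_pos) hCF (norm_exp_lt_one hre)
    filter_upwards [hGF w hw hre, (tendsto_exp_nhdsNE _).eventually this] with u h1 h2
    rw [h1, h2]
  let u : ℂ := ⟨-T / 2, y⟩
  have hu : u ∈ box y T := ⟨by simp only [u]; rw [abs_lt]; constructor <;> linarith,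
    by simpa [u] using hT0⟩
  have hure : u.re < 0 := by simp only [u]; linarith
  have heq : ∀ x ∈ box y T, ∀ᶠ w in 𝓝[≠] x, P.evalEval (Complex.exp w) (G w) = 0 := by
    intro x hx
    refine eventuallyEq_nhdsNE_of_isPreconnected (U := box y T)
      (fun w hw => meromorphicAt_evalEval P (Complex.differentiable_exp.analyticAt w) (hG w hw))
      (fun w _ => MeromorphicAt.const 0 w) (convex_box y T).isPreconnected hu ?_ hx
    have hre : ∀ᶠ v : ℂ in 𝓝[≠] u, v.re < 0 :=
      (Complex.continuous_re.continuousAt.eventually_lt_const hure).filter_mono nhdsWithin_le_nhds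
    filter_upwards [hGC u hu hure, hre] with w hw hw'
    rw [hw, hPC _ (norm_exp_lt_one hw')]
  have han := analyticOnNhd_of_monic hG Complex.continuous_exp.continuousOn (isOpen_box y T) hP heq
  obtain ⟨H, hH, hHC⟩ := exists_glue hT hC han (fun w hw hre => by
    have h1 : AnalyticAt ℂ (fun w => C (Complex.exp w)) w :=
      (hC _ (norm_exp_lt_one hre)).comp (Complex.differentiable_exp.analyticAt w)
    have h2 : ∀ᶠ v in 𝓝[≠] w, toMeromorphicNFOn G (box y T) v = C (Complex.exp v) :=
      (hG.toMeromorphicNFOn_eq_self_on_nhdsNE hw).trans (hGC w hw hre)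
    exact tendsto_nhds_unique_of_eventuallyEq
      ((han w hw).continuousAt.tendsto.mono_left nhdsWithin_le_nhds)
      (h1.continuousAt.tendsto.mono_left nhdsWithin_le_nhds) h2)
  refine ⟨H, hH.meromorphicOn, (hH 0 (Metric.mem_ball_self (Real.exp_pos T))).meromorphicAt, ?_⟩
  rw [mk_eq_mk]
  have : H =ᶠ[𝓝[≠] 0] C :=
    (eventually_of_mem (Metric.ball_mem_nhds 0 one_pos) hHC).filter_mono nhdsWithin_le_nhds
  exact this.trans hCF

end MGerm
end Mahler

namespace Mahler
open Filter Topology Polynomial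
namespace MGerm

/-- The field generated by the polynomials and a family of germs. -/
def genField {ι : Type*} (X : ι → MGerm) : Subfield MGerm :=
  Subfield.closure (Set.range (algebraMap ℂ[X] MGerm) ∪ Set.range X)

theorem genField_le {ι : Type*} {X : ι → MGerm} {S : Subfield MGerm}
    (h1 : ∀ p, algebraMap ℂ[X] MGerm p ∈ S) (h2 : ∀ s, X s ∈ S) : genField X ≤ S := by
  rw [genField, Subfield.closure_le]
  rintro _ (⟨p, rfl⟩ | ⟨s, rfl⟩)
  exacts [h1 p, h2 s]

theorem mem_genField {ι : Type*} (X : ι → MGerm) (s : ι) : X s ∈ genField X :=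
  Subfield.subset_closure (Or.inr ⟨s, rfl⟩)

theorem algebraMap_mem_genField {ι : Type*} (X : ι → MGerm) (p : ℂ[X]) :
    algebraMap ℂ[X] MGerm p ∈ genField X :=
  Subfield.subset_closure (Or.inl ⟨p, rfl⟩)

theorem mem_extSubfield_of_lt_one {ι : Type*} [Finite ι] {q : ℕ} (hq : 2 ≤ q) (hq0 : q ≠ 0)
    {X : ι → MGerm}
    (h2 : ∀ s, X s ∈ genField fun t => sigma hq0 (X t)) {ρ : ℝ} (hρ0 : 0 ≤ ρ) (hρ : ρ < 1) (s : ι) :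
    X s ∈ extSubfield ρ := by
  have := Fintype.ofFinite ι
  choose r hr hX using fun s => exists_mem_extSubfield (X s)
  obtain ⟨r0, hr0, hr0X⟩ : ∃ r0 > 0, ∀ s, X s ∈ extSubfield r0 := by
    rcases isEmpty_or_nonempty ι with hι | hι
    · exact ⟨1, one_pos, fun s => hι.elim s⟩
    · obtain ⟨t, ht⟩ := Finite.exists_min r
      exact ⟨r t, hr t, fun s => extSubfield_anti (ht s) (hX s)⟩
  have hind : ∀ n : ℕ, ∀ ρ : ℝ, 0 ≤ ρ → ρ ^ q ^ n ≤ r0 → ∀ s, X s ∈ extSubfield ρ := by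
    intro n
    induction n with
    | zero => intro ρ _ h s; exact extSubfield_anti (by simpa using h) (hr0X s)
    | succ n ih =>
      intro ρ h0 h s
      refine genField_le (algebraMap_mem_extSubfield ρ) (fun t => ?_) (h2 s)
      exact sigma_mem_extSubfield hq0 le_rfl
        (ih (ρ ^ q) (pow_nonneg h0 q) (by rwa [← pow_mul, ← pow_succ']) t)
  have ht : Tendsto (fun n : ℕ => ρ ^ q ^ n) atTop (𝓝 0) :=
    (tendsto_pow_atTop_nhds_zero_of_lt_one hρ0 hρ).comp (tendsto_pow_atTop_atTop_of_one_lt hq)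
  obtain ⟨n, hn⟩ := (ht.eventually_le_const hr0).exists
  exact hind n ρ hρ0 hn s

theorem exists_mem_stripSubfield {ι : Type*} [Finite ι] {c : ι → MGerm}
    (hc : ∀ s, IsIntegral ℂ[X] (c s)) (h : ∀ s, ∀ ρ < 1, 0 ≤ ρ → c s ∈ extSubfield ρ) :
    ∃ y T : ℝ, 0 < T ∧ ∀ s, c s ∈ stripSubfield (box y T) := by
  have := Fintype.ofFinite ι
  choose U V e he hbez using fun s => exists_bezout_of_integral (hc s)
  have hC : ∀ s, ∃ F : ℂ → ℂ, AnalyticOnNhd ℂ F (Metric.ball 0 1) ∧ (∃ h, mk F h = c s) ∧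
      ∀ z ∈ Metric.ball (0 : ℂ) 1, (minpoly ℂ[X] (c s)).evalEval z (F z) = 0 := fun s => by
    refine exists_analytic_of_forall_mem (minpoly.monic (hc s)) (minpoly.aeval _ _)
      Metric.isOpen_ball (Metric.mem_ball_self one_pos) fun z hz => ?_
    rw [mem_ball_zero_iff] at hz
    obtain ⟨ρ, h1, h2⟩ := exists_between hz
    exact ⟨ρ, h1, h s ρ h2 ((norm_nonneg z).trans h1.le)⟩
  choose C hC1 hC2 hC3 using hC
  choose hC0 hC2 using hC2
  obtain ⟨y, hy⟩ : ∃ y : ℝ, ∀ s, (e s).eval (Complex.exp (y * Complex.I)) ≠ 0 := by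
    by_contra! hcon
    have hprod : (∏ s, e s) ≠ 0 := Finset.prod_ne_zero_iff.mpr fun s _ => he s
    refine hprod (Polynomial.eq_zero_of_infinite_isRoot _ (Set.Infinite.mono
      (s := (fun y : ℝ => Complex.exp (y * Complex.I)) '' Set.Ioo 0 1) ?_ ?_))
    · rintro _ ⟨y, -, rfl⟩
      obtain ⟨s, hs⟩ := hcon y
      rw [Set.mem_ofPred_eq, IsRoot.def, eval_prod]
      exact Finset.prod_eq_zero (Finset.mem_univ s) hs
    · refine (Set.Ioo_infinite one_pos).image fun a ha b hb hab => ?_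
      have := Complex.exp_inj_of_neg_pi_lt_of_le_pi (x := a * Complex.I) (y := b * Complex.I)
        (by simp; linarith [Real.pi_pos, ha.1]) (by simp; linarith [Real.pi_gt_three, ha.2])
        (by simp; linarith [Real.pi_pos, hb.1]) (by simp; linarith [Real.pi_gt_three, hb.2]) hab
      simpa using this
  set ζ := Complex.exp (y * Complex.I) with hζ
  have hζ1 : ‖ζ‖ = 1 := Complex.norm_exp_ofReal_mul_I y
  choose ε hε φ hφ hφC using fun s => exists_extension_at (hC1 s) (minpoly.monic (hc s)) (hC3 s) hζ1
    (fun w hw hw' => hy s (by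
      have := congrArg (Polynomial.evalEval ζ w) (hbez s)
      simpa [evalEval_add, evalEval_mul, hw, hw', evalEval_C] using this.symm))
  have hcont : ∀ s, ∃ T > 0, ∀ w ∈ box y T, Complex.exp w ∈ Metric.ball ζ (ε s) := by
    intro s
    obtain ⟨δ, hδ, hd⟩ := Metric.continuousAt_iff.mp
      (Complex.continuous_exp.continuousAt (x := y * Complex.I)) (ε s) (hε s)
    refine ⟨δ / 2, by positivity, fun w hw => hd ?_⟩
    rw [Complex.dist_eq]
    refine (Complex.norm_le_abs_re_add_abs_im _).trans_lt ?_
    have h1 := hw.1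
    have h2 := hw.2
    simp only [Complex.sub_re, Complex.sub_im, Complex.mul_re, Complex.mul_im, Complex.ofReal_re,
      Complex.ofReal_im, Complex.I_re, Complex.I_im, mul_zero, mul_one, sub_zero,
      add_zero]
    linarith
  choose T hT hTb using hcont
  obtain ⟨T0, hT0, hT0T⟩ : ∃ T0 > 0, ∀ s, T0 ≤ T s := by
    rcases isEmpty_or_nonempty ι with hι | hι
    · exact ⟨1, one_pos, fun s => hι.elim s⟩
    · obtain ⟨t, ht⟩ := Finite.exists_min T
      exact ⟨T t, hT t, ht⟩
  have hsub : ∀ s, ∀ w ∈ box y T0, Complex.exp w ∈ Metric.ball ζ (ε s) := fun s w hw =>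
    hTb s w ⟨hw.1.trans_le (hT0T s), hw.2.trans_le (hT0T s)⟩
  refine ⟨y, T0, hT0, fun s => ⟨C s, (hC1 s).meromorphicOn, ⟨hC0 s, hC2 s⟩,
    fun w => φ s (Complex.exp w), fun w hw => ?_, fun w hw hre => ?_⟩⟩
  · exact ((hφ s _ (hsub s w hw)).comp (Complex.differentiable_exp.analyticAt w)).meromorphicAt
  · have h1 : ∀ᶠ u in 𝓝 w, u ∈ box y T0 ∧ u.re < 0 :=
      Filter.Eventually.and ((isOpen_box y T0).mem_nhds hw)
        (Complex.continuous_re.continuousAt.eventually_lt_const hre)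
    filter_upwards [h1.filter_mono nhdsWithin_le_nhds] with u hu
    exact hφC s _ ⟨hsub s u hu.1, norm_exp_lt_one hu.2⟩

/-- A finite family of algebraic germs generating a field stable under the Mahler operator and
its inverse consists of rational functions. -/
theorem exists_polynomial_mul_eq {ι : Type*} [Finite ι] {q : ℕ} (hq : 2 ≤ q) (hq0 : q ≠ 0)
    {X : ι → MGerm} (hX : ∀ s, IsAlgebraic ℂ[X] (X s))
    (h1 : ∀ s, sigma hq0 (X s) ∈ genField X)
    (h2 : ∀ s, X s ∈ genField fun t => sigma hq0 (X t)) (s : ι) :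
    ∃ a p : ℂ[X], a ≠ 0 ∧ algebraMap ℂ[X] MGerm a * X s = algebraMap ℂ[X] MGerm p := by
  have hInt : ∀ s, ∃ a : ℂ[X], a ≠ 0 ∧ IsIntegral ℂ[X] (algebraMap ℂ[X] MGerm a * X s) := by
    intro s
    obtain ⟨a, ha, h⟩ := (hX s).exists_integral_multiple
    exact ⟨a, ha, by rwa [Algebra.smul_def] at h⟩
  choose a ha hc using hInt
  set c : ι → MGerm := fun s => algebraMap ℂ[X] MGerm (a s) * X s with hcdef
  have ha' : ∀ s, algebraMap ℂ[X] MGerm (a s) ≠ 0 := fun s h =>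
    ha s (algebraMap_poly_injective (by rw [h, map_zero]))
  have hXc : ∀ (S : Subfield MGerm), (∀ p, algebraMap ℂ[X] MGerm p ∈ S) →
      ∀ s, c s ∈ S → X s ∈ S := by
    intro S hS s hs
    have : X s = (algebraMap ℂ[X] MGerm (a s))⁻¹ * c s := by
      rw [hcdef]; field_simp [ha' s]
    rw [this]
    exact mul_mem (inv_mem (hS _)) hs
  have hcX : ∀ (S : Subfield MGerm), (∀ p, algebraMap ℂ[X] MGerm p ∈ S) → ∀ s, X s ∈ S → c s ∈ S :=
    fun S hS s hs => mul_mem (hS _) hs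
  have hext : ∀ s, ∀ ρ < 1, 0 ≤ ρ → c s ∈ extSubfield ρ := fun s ρ hρ hρ0 =>
    hcX _ (algebraMap_mem_extSubfield ρ) s (mem_extSubfield_of_lt_one hq hq0 h2 hρ0 hρ s)
  have hext1 : ∀ s, X s ∈ extSubfield 1 := fun s => by
    refine hXc _ (algebraMap_mem_extSubfield 1) s ?_
    obtain ⟨F, hF, ⟨h0, h⟩, -⟩ := exists_analytic_of_forall_mem (minpoly.monic (hc s))
      (minpoly.aeval _ _) Metric.isOpen_ball (Metric.mem_ball_self (x := (0 : ℂ)) one_pos)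
      fun z hz => by
        rw [mem_ball_zero_iff] at hz
        obtain ⟨ρ, h1, h2⟩ := exists_between hz
        exact ⟨ρ, h1, hext s ρ h2 ((norm_nonneg z).trans h1.le)⟩
    exact ⟨F, hF.meromorphicOn, h0, h⟩
  obtain ⟨y, T, hT, hstrip⟩ := exists_mem_stripSubfield hc hext
  have hiter : ∀ n : ℕ, ∀ s, X s ∈ stripSubfield (box (q ^ n * y) (q ^ n * T)) := by
    intro n
    induction n with
    | zero =>
      intro s
      simpa using hXc _ (algebraMap_mem_stripSubfield _) s (hstrip s)
    | succ n ih =>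
      intro s
      have := mem_stripSubfield_of_sigma hq0 (hext1 s)
        (genField_le (algebraMap_mem_stripSubfield _) ih (h1 s))
      rwa [← mul_assoc, ← mul_assoc, ← pow_succ'] at this
  have htop : Tendsto (fun n : ℕ => (q : ℝ) ^ n * T) atTop atTop :=
    (tendsto_pow_atTop_atTop_of_one_lt (by exact_mod_cast hq)).atTop_mul_const hT
  obtain ⟨F, hF, ⟨hF0, hFc⟩, hPF⟩ := exists_analytic_of_forall_mem (minpoly.monic (hc s))
    (minpoly.aeval _ _) isOpen_univ (Set.mem_univ (0 : ℂ)) fun z _ => by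
      obtain ⟨n, hn1, hn2⟩ := ((htop.eventually_gt_atTop Real.pi).and
        (htop.eventually_gt_atTop ‖z‖)).exists
      refine ⟨Real.exp (q ^ n * T), ?_, mem_extSubfield_exp_of_mem_strip (minpoly.monic (hc s))
        (minpoly.aeval _ _) hn1 (hcX _ (algebraMap_mem_stripSubfield _) s (hiter n s))⟩
      linarith [Real.add_one_le_exp ((q : ℝ) ^ n * T)]
  obtain ⟨p, hp⟩ := exists_polynomial_of_monic (fun z => (hF z trivial).differentiableAt)
    (minpoly.monic (hc s)) (fun z => hPF z trivial)
  refine ⟨a s, p, ha s, ?_⟩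
  rw [← hFc, algebraMap_eq, mk_eq_mk]
  exact Eventually.of_forall hp

end MGerm
end Mahler

namespace Mahler
open Polynomial

theorem inv_apply_mem {E κ : Type*} [Field E] [Fintype κ] [DecidableEq κ] (S : Subfield E)
    {A : Matrix κ κ E} (hA : ∀ i j, A i j ∈ S) (i j : κ) : A⁻¹ i j ∈ S := by
  have : A = S.subtype.mapMatrix (Matrix.of fun i j => ⟨A i j, hA i j⟩) := by
    ext i j; rfl
  rw [Matrix.inv_def, Ring.inverse_eq_inv', Matrix.smul_apply, smul_eq_mul, this,
    ← RingHom.map_det, ← RingHom.map_adjugate]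
  exact mul_mem (inv_mem (SetLike.coe_mem _)) (SetLike.coe_mem _)

theorem mul_apply_mem {E l m n : Type*} [Field E] [Fintype m] (S : Subfield E)
    {A : Matrix l m E} {B : Matrix m n E} (hA : ∀ i j, A i j ∈ S) (hB : ∀ i j, B i j ∈ S)
    (i : l) (j : n) : (A * B) i j ∈ S := by
  rw [Matrix.mul_apply]
  exact sum_mem fun k _ => mul_mem (hA _ _) (hB _ _)

namespace MGerm

/-- The field of germs algebraic over the polynomials. -/
def algSubfield : Subfield MGerm :=
  { Subalgebra.algebraicClosure ℂ[X] MGerm with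
    neg_mem' := fun h => IsAlgebraic.neg h
    inv_mem' := fun _ h => IsAlgebraic.inv h }

theorem mem_algSubfield {φ : MGerm} : φ ∈ algSubfield ↔ IsAlgebraic ℂ[X] φ := Iff.rfl

theorem algebraMap_mem_algSubfield (p : ℂ[X]) : algebraMap ℂ[X] MGerm p ∈ algSubfield :=
  isAlgebraic_algebraMap p

theorem sigma_algebraMap {q : ℕ} (hq : q ≠ 0) (p : ℂ[X]) :
    sigma hq (algebraMap ℂ[X] MGerm p) = algebraMap ℂ[X] MGerm (expand ℂ q p) := by
  rw [algebraMap_eq, sigma_mk, algebraMap_eq, mk_eq_mk]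
  exact Filter.Eventually.of_forall fun z => by simp [expand_eval]

theorem sigma_mem_algSubfield {q : ℕ} (hq : q ≠ 0) {φ : MGerm} (h : φ ∈ algSubfield) :
    sigma hq φ ∈ algSubfield := by
  obtain ⟨P, hP, hPφ⟩ := mem_algSubfield.mp h
  refine ⟨P.map (expand ℂ q : ℂ[X] →+* ℂ[X]), ?_, ?_⟩
  · rwa [Ne, Polynomial.map_eq_zero_iff]
    exact expand_injective (Nat.pos_of_ne_zero hq)
  · have hcomp : (algebraMap ℂ[X] MGerm).comp (expand ℂ q : ℂ[X] →+* ℂ[X]) =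
        (sigma hq).comp (algebraMap ℂ[X] MGerm) :=
      RingHom.ext fun p => (sigma_algebraMap hq p).symm
    rw [aeval_def, eval₂_map, hcomp, ← hom_eval₂, ← aeval_def, hPφ, map_zero]

/-- Solutions of a Mahler system that are linearly independent over the rational functions are
linearly independent over the algebraic functions. -/
theorem linearIndependent_algSubfield {ι : Type*} [Fintype ι] [DecidableEq ι] {q : ℕ} (hq : 2 ≤ q)
    (hq0 : q ≠ 0) {Y : ι → MGerm} (hY : LinearIndependent ℂ[X] Y) {b : ℂ[X]} (hb : b ≠ 0)
    {B' : Matrix ι ι ℂ[X]} (hB' : B'.det ≠ 0)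
    (hsys : ∀ i, algebraMap ℂ[X] MGerm b * sigma hq0 (Y i) =
      ∑ j, algebraMap ℂ[X] MGerm (B' i j) * Y j) :
    LinearIndependent algSubfield Y := by
  obtain ⟨κ, a, ha, hspan, hind⟩ := exists_linearIndependent' algSubfield Y
  have : Finite κ := Finite.of_injective a ha
  have := Fintype.ofFinite κ
  classical
  have hb0 : algebraMap ℂ[X] MGerm b ≠ 0 := fun h =>
    hb (algebraMap_poly_injective (by rw [h, map_zero]))
  have hXex : ∀ i, ∃ c : κ → algSubfield, ∑ t, c t • Y (a t) = Y i := fun i => by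
    have h := Submodule.subset_span (R := algSubfield) (Set.mem_range_self (f := Y) i)
    rw [← hspan] at h
    exact (Submodule.mem_span_range_iff_exists_fun _).mp h
  choose x hx using hXex
  have hindE : ∀ u : κ → MGerm, (∀ t, u t ∈ algSubfield) → ∑ t, u t * Y (a t) = 0 → u = 0 := by
    intro u hu h
    have := Fintype.linearIndependent_iff.mp hind (fun t => ⟨u t, hu t⟩) h
    funext t
    exact congrArg Subtype.val (this t)
  have hindE' : ∀ u v : κ → MGerm, (∀ t, u t ∈ algSubfield) → (∀ t, v t ∈ algSubfield) →
      ∑ t, u t * Y (a t) = ∑ t, v t * Y (a t) → u = v := by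
    intro u v hu hv h
    rw [← sub_eq_zero]
    refine hindE _ (fun t => sub_mem (hu t) (hv t)) ?_
    simp only [Pi.sub_apply, sub_mul, Finset.sum_sub_distrib, h, sub_self]
  set X : Matrix ι κ MGerm := Matrix.of fun i t => (x i t : MGerm) with hXdef
  have hXmem : ∀ i t, X i t ∈ algSubfield := fun i t => (x i t).2
  have hXY : ∀ i, ∑ t, X i t * Y (a t) = Y i := hx
  have hXa : X.submatrix a id = 1 := by
    ext s t
    refine congrFun (hindE' (fun t => X (a s) t) (fun t => (1 : Matrix κ κ MGerm) s t)
      (fun t => hXmem _ _) (fun t => ?_) ?_) t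
    · rw [Matrix.one_apply]; split_ifs
      exacts [one_mem _, zero_mem _]
    · rw [hXY]; simp [Matrix.one_apply]
  set B : Matrix ι ι MGerm :=
    Matrix.of fun i j => algebraMap ℂ[X] MGerm (B' i j) / algebraMap ℂ[X] MGerm b with hBdef
  have hBmem : ∀ S : Subfield MGerm, (∀ p, algebraMap ℂ[X] MGerm p ∈ S) → ∀ i j, B i j ∈ S :=
    fun S hS i j => div_mem (hS _) (hS _)
  have hBY : ∀ i, sigma hq0 (Y i) = ∑ j, B i j * Y j := fun i => by
    have : sigma hq0 (Y i) = (algebraMap ℂ[X] MGerm b)⁻¹ *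
        (algebraMap ℂ[X] MGerm b * sigma hq0 (Y i)) := by field_simp
    rw [this, hsys, Finset.mul_sum]
    refine Finset.sum_congr rfl fun j _ => ?_
    simp only [hBdef, Matrix.of_apply]; ring
  have hBdet : B.det ≠ 0 := by
    have : B = (algebraMap ℂ[X] MGerm b)⁻¹ • (algebraMap ℂ[X] MGerm).mapMatrix B' := by
      ext i j; simp [hBdef, div_eq_inv_mul]
    rw [this, Matrix.det_smul, ← RingHom.map_det]
    refine mul_ne_zero (pow_ne_zero _ (inv_ne_zero hb0)) fun h => hB' ?_
    exact algebraMap_poly_injective (by rw [h, map_zero])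
  have hBunit : IsUnit B.det := hBdet.isUnit
  set G : Matrix κ κ MGerm := (B * X).submatrix a id with hGdef
  set σX : Matrix ι κ MGerm := X.map (sigma hq0) with hσX
  have hBXalg : ∀ i t, (B * X) i t ∈ algSubfield :=
    mul_apply_mem _ (hBmem _ algebraMap_mem_algSubfield) hXmem
  have hBXY : ∀ i, ∑ t, (B * X) i t * Y (a t) = sigma hq0 (Y i) := fun i => by
    rw [hBY]
    simp_rw [Matrix.mul_apply, Finset.sum_mul]
    rw [Finset.sum_comm]
    refine Finset.sum_congr rfl fun j _ => ?_
    rw [← hXY j, Finset.mul_sum]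
    exact Finset.sum_congr rfl fun t _ => by ring
  have hσXalg : ∀ i t, σX i t ∈ algSubfield := fun i t => sigma_mem_algSubfield hq0 (hXmem i t)
  have hkey : σX * G = B * X := by
    ext i t
    refine congrFun (hindE' (fun t => (σX * G) i t) (fun t => (B * X) i t)
      (fun t => mul_apply_mem _ hσXalg (fun s t => hBXalg _ _) i t) (fun t => hBXalg _ _) ?_) t
    rw [hBXY, ← hXY i, map_sum]
    simp_rw [Matrix.mul_apply, Finset.sum_mul]
    rw [Finset.sum_comm]
    refine Finset.sum_congr rfl fun s _ => ?_
    rw [map_mul, ← hBXY, Finset.mul_sum]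
    exact Finset.sum_congr rfl fun t _ => by simp [hGdef, hσX]; ring
  have hGdet : IsUnit G.det := by
    rw [isUnit_iff_ne_zero]
    intro h0
    obtain ⟨u, hu, hGu⟩ := Matrix.exists_mulVec_eq_zero_iff.mpr h0
    have h1 : B.mulVec (X.mulVec u) = 0 := by
      rw [Matrix.mulVec_mulVec, ← hkey, ← Matrix.mulVec_mulVec, hGu, Matrix.mulVec_zero]
    have h2 : X.mulVec u = 0 := by
      by_contra h
      exact hBdet (Matrix.exists_mulVec_eq_zero_iff.mp ⟨_, h, h1⟩)
    refine hu ?_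
    have h3 : (X.submatrix a id).mulVec u = 0 := by
      funext s
      exact congrFun h2 (a s)
    rwa [hXa, Matrix.one_mulVec] at h3
  let Z : ι × κ → MGerm := fun s => X s.1 s.2
  have hσmem : ∀ s, sigma hq0 (Z s) ∈ genField Z := by
    intro s
    have h1 : σX = B * X * G⁻¹ := by rw [← hkey, Matrix.mul_nonsing_inv_cancel_right _ _ hGdet]
    have hBX : ∀ i t, (B * X) i t ∈ genField Z :=
      mul_apply_mem _ (hBmem _ (algebraMap_mem_genField Z)) fun i t => mem_genField Z (i, t)
    have h2 := mul_apply_mem (genField Z) hBX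
      (inv_apply_mem (A := G) _ fun i j => hBX _ _) s.1 s.2
    rwa [← h1] at h2
  have hmemσ : ∀ s, Z s ∈ genField fun t => sigma hq0 (Z t) := by
    intro s
    set S := genField fun t => sigma hq0 (Z t)
    have h1 : B⁻¹ * σX * G = X := by
      rw [Matrix.mul_assoc, hkey, Matrix.nonsing_inv_mul_cancel_left _ _ hBunit]
    have hM : ∀ i t, (B⁻¹ * σX) i t ∈ S :=
      mul_apply_mem _ (inv_apply_mem _ (hBmem _ (algebraMap_mem_genField _)))
        fun i t => mem_genField (fun t => sigma hq0 (Z t)) (i, t)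
    have h2 : (B⁻¹ * σX).submatrix a id * G = 1 := by
      rw [← hXa]
      conv_rhs => rw [← h1]
      rfl
    have h3 : G = ((B⁻¹ * σX).submatrix a id)⁻¹ := (Matrix.inv_eq_right_inv h2).symm
    have hG : ∀ i j, G i j ∈ S := by
      rw [h3]
      exact inv_apply_mem _ fun i j => hM _ _
    have h4 := mul_apply_mem _ hM hG s.1 s.2
    rwa [h1] at h4
  have hrat := exists_polynomial_mul_eq hq hq0 (X := Z) (fun s => hXmem s.1 s.2) hσmem hmemσ
  have hsurj : Function.Surjective a := by
    intro i
    by_contra hi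
    choose c p hc hcp using fun t => hrat (i, t)
    have hD : (∏ t, c t) ≠ 0 := Finset.prod_ne_zero_iff.mpr fun t _ => hc t
    refine hD (hY.eq_zero_of_smul_mem_span i _ ?_)
    rw [← hXY i, Finset.smul_sum]
    refine sum_mem fun t _ => ?_
    have : (∏ t, c t) • (X i t * Y (a t)) = ((∏ s ∈ Finset.univ.erase t, c s) * p t) • Y (a t) := by
      rw [← Finset.mul_prod_erase _ _ (Finset.mem_univ t), Algebra.smul_def, Algebra.smul_def,
        map_mul, map_mul, ← hcp t]
      simp only [Z]; ring
    rw [this]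
    exact Submodule.smul_mem _ _ (Submodule.subset_span ⟨a t, ⟨trivial, fun h => hi ⟨t, h⟩⟩, rfl⟩)
  exact (linearIndependent_equiv (Equiv.ofBijective a ⟨ha, hsurj⟩)).mp hind

end MGerm
end Mahler

namespace Mahler
open Filter Topology PowerSeries

section Conv

variable {L : Type*} [Field L] [Algebra L ℂ]

/-- The sum of a power series over a subfield of `ℂ`. -/
def ev (f : L⟦X⟧) (z : ℂ) : ℂ := ∑' n, algebraMap L ℂ (coeff n f) * z ^ n

/-- Summability of a power series at a point. -/
def SummableAt (f : L⟦X⟧) (z : ℂ) : Prop := Summable fun n => algebraMap L ℂ (coeff n f) * z ^ n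

/-- Convergence of a power series near the origin. -/
def Conv (f : L⟦X⟧) : Prop := ∀ᶠ z in 𝓝 (0 : ℂ), SummableAt f z

theorem hasSum_coe (p : Polynomial L) (z : ℂ) :
    HasSum (fun n => algebraMap L ℂ (coeff n (p : L⟦X⟧)) * z ^ n) (p.aeval z) := by
  rw [Polynomial.aeval_eq_sum_range]
  simp_rw [Algebra.smul_def, Polynomial.coeff_coe]
  refine hasSum_sum_of_ne_finset_zero fun n hn => ?_
  rw [Polynomial.coeff_eq_zero_of_natDegree_lt (by simpa using hn), map_zero, zero_mul]

theorem summableAt_coe (p : Polynomial L) (z : ℂ) : SummableAt (p : L⟦X⟧) z :=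
  (hasSum_coe p z).summable

theorem ev_coe (p : Polynomial L) (z : ℂ) : ev (p : L⟦X⟧) z = p.aeval z := (hasSum_coe p z).tsum_eq

theorem hasSum_add {f g : L⟦X⟧} {z : ℂ} (hf : SummableAt f z) (hg : SummableAt g z) :
    HasSum (fun n => algebraMap L ℂ (coeff n (f + g)) * z ^ n) (ev f z + ev g z) := by
  simpa only [map_add, add_mul, ev] using hf.hasSum.add hg.hasSum

theorem hasSum_neg {f : L⟦X⟧} {z : ℂ} (hf : SummableAt f z) :
    HasSum (fun n => algebraMap L ℂ (coeff n (-f)) * z ^ n) (-ev f z) := by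
  simpa only [map_neg, neg_mul, ev] using hf.hasSum.neg

theorem hasSum_mul {f g : L⟦X⟧} {z : ℂ} (hf : SummableAt f z) (hg : SummableAt g z) :
    HasSum (fun n => algebraMap L ℂ (coeff n (f * g)) * z ^ n) (ev f z * ev g z) := by
  have hterm : ∀ n, algebraMap L ℂ (coeff n (f * g)) * z ^ n =
      ∑ kl ∈ Finset.HasAntidiagonal.antidiagonal n, (algebraMap L ℂ (coeff kl.1 f) * z ^ kl.1) *
        (algebraMap L ℂ (coeff kl.2 g) * z ^ kl.2) := by
    intro n
    rw [coeff_mul, map_sum, Finset.sum_mul]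
    refine Finset.sum_congr rfl fun kl hkl => ?_
    rw [← Finset.HasAntidiagonal.mem_antidiagonal.mp hkl, map_mul, pow_add]
    ring
  simp_rw [hterm]
  have h1 := summable_norm_sum_mul_antidiagonal_of_summable_norm hf.norm hg.norm
  have h2 := tsum_mul_tsum_eq_tsum_sum_antidiagonal_of_summable_norm hf.norm hg.norm
  rw [ev, ev, h2]
  exact h1.of_norm.hasSum

variable (L) in
/-- The ring of convergent power series. -/
def convSubring : Subring L⟦X⟧ where
  carrier := {f | Conv f}
  mul_mem' hf hg := by
    filter_upwards [hf, hg] with z h1 h2 using (hasSum_mul h1 h2).summable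
  one_mem' := Eventually.of_forall fun z => by simpa using summableAt_coe (1 : Polynomial L) z
  add_mem' hf hg := by
    filter_upwards [hf, hg] with z h1 h2 using (hasSum_add h1 h2).summable
  zero_mem' := Eventually.of_forall fun z => by simpa using summableAt_coe (0 : Polynomial L) z
  neg_mem' hf := by filter_upwards [hf] with z h1 using (hasSum_neg h1).summable

theorem hasFPowerSeriesAt_ev {f : L⟦X⟧} (hf : Conv f) :
    HasFPowerSeriesAt (ev f)
      (FormalMultilinearSeries.ofScalars ℂ fun n => algebraMap L ℂ (coeff n f)) 0 := by
  rw [hasFPowerSeriesAt_iff]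
  filter_upwards [hf] with z hz
  simp only [FormalMultilinearSeries.coeff_ofScalars, smul_eq_mul, zero_add]
  simpa only [mul_comm, ev] using Summable.hasSum hz

theorem analyticAt_ev {f : L⟦X⟧} (hf : Conv f) : AnalyticAt ℂ (ev f) 0 :=
  (hasFPowerSeriesAt_ev hf).analyticAt

theorem eq_zero_of_ev_eq_zero {f : L⟦X⟧} (hf : Conv f) (h : ev f =ᶠ[𝓝[≠] 0] 0) : f = 0 := by
  have h0 : ev f =ᶠ[𝓝 0] 0 :=
    (analyticAt_ev hf).eventually_eq_zero_or_eventually_ne_zero.resolve_right fun hne => by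
      obtain ⟨z, hz1, hz2⟩ := (h.and hne).exists
      exact hz2 hz1
  have h1 := HasFPowerSeriesAt.eq_zero ((hasFPowerSeriesAt_ev hf).congr h0)
  ext n
  have h2 := congrArg (fun p => p.coeff n) h1
  rw [FormalMultilinearSeries.coeff_ofScalars] at h2
  rw [map_zero]
  exact (algebraMap L ℂ).injective (by simpa [FormalMultilinearSeries.coeff] using h2)

variable (L) in
/-- The germ of the sum of a convergent power series. -/
def toGerm : convSubring L →+* MGerm where
  toFun f := MGerm.mk (ev (f : L⟦X⟧)) (analyticAt_ev f.2).meromorphicAt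
  map_one' := by
    rw [← MGerm.mk_one, MGerm.mk_eq_mk]
    exact Eventually.of_forall fun z => by simpa using ev_coe (1 : Polynomial L) z
  map_mul' f g := by
    rw [MGerm.mk_mul, MGerm.mk_eq_mk]
    refine Filter.Eventually.filter_mono nhdsWithin_le_nhds ?_
    have hf : Conv (f : L⟦X⟧) := f.2
    have hg : Conv (g : L⟦X⟧) := g.2
    filter_upwards [hf, hg] with z h1 h2 using (hasSum_mul h1 h2).tsum_eq
  map_zero' := by
    rw [← MGerm.mk_zero, MGerm.mk_eq_mk]
    exact Eventually.of_forall fun z => by simpa using ev_coe (0 : Polynomial L) z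
  map_add' f g := by
    rw [MGerm.mk_add, MGerm.mk_eq_mk]
    refine Filter.Eventually.filter_mono nhdsWithin_le_nhds ?_
    have hf : Conv (f : L⟦X⟧) := f.2
    have hg : Conv (g : L⟦X⟧) := g.2
    filter_upwards [hf, hg] with z h1 h2 using (hasSum_add h1 h2).tsum_eq

theorem toGerm_apply (f : convSubring L) :
    toGerm L f = MGerm.mk (ev (f : L⟦X⟧)) (analyticAt_ev f.2).meromorphicAt := rfl

theorem toGerm_injective : Function.Injective (toGerm L) := by
  rw [injective_iff_map_eq_zero]
  intro f hf
  rw [toGerm_apply, MGerm.mk_eq_zero] at hf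
  exact Subtype.ext (eq_zero_of_ev_eq_zero f.2 hf)

variable (L) in
/-- Polynomials as convergent power series. -/
def polyConv : Polynomial L →+* convSubring L :=
  Polynomial.coeToPowerSeries.ringHom.codRestrict (convSubring L)
    fun p => Eventually.of_forall fun z => summableAt_coe p z

theorem coe_polyConv (p : Polynomial L) : (polyConv L p : L⟦X⟧) = p := rfl

theorem exists_factor {f h : L⟦X⟧} {N : ℕ} (hf : Conv f) (hfh : f = X ^ N * h) :
    Conv h ∧ ∀ᶠ z in 𝓝 (0 : ℂ), ev f z = z ^ N * ev h z := by
  have hsh : ∀ z : ℂ, z ≠ 0 → SummableAt f z → SummableAt h z := by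
    intro z hz hs
    have h1 := (summable_nat_add_iff N).mpr hs
    have h2 := h1.mul_right (z ^ N)⁻¹
    refine h2.congr fun n => ?_
    rw [hfh, coeff_X_pow_mul, pow_add]
    field_simp
  have hconv : Conv h := by
    filter_upwards [hf] with z hz
    by_cases h0 : z = 0
    · subst h0
      refine summable_of_ne_finset_zero (s := {0}) fun n hn => ?_
      rw [zero_pow (by simpa using hn), mul_zero]
    · exact hsh z h0 hz
  refine ⟨hconv, ?_⟩
  filter_upwards [hconv] with z hz
  have hX : (X ^ N : L⟦X⟧) = ((Polynomial.X ^ N : Polynomial L) : L⟦X⟧) := by simp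
  have h1 := (hasSum_mul (summableAt_coe (Polynomial.X ^ N : Polynomial L) z) hz).tsum_eq
  rw [ev_coe, ← hX, ← hfh] at h1
  simpa [ev] using h1

theorem norm_ev_le {f : L⟦X⟧} (hf : Conv f) {N : ℕ} (h : X ^ N ∣ f) :
    ∃ C : ℝ, 0 ≤ C ∧ ∀ᶠ z in 𝓝 (0 : ℂ), ‖ev f z‖ ≤ C * ‖z‖ ^ N := by
  obtain ⟨g, hg⟩ := h
  obtain ⟨hg1, hg2⟩ := exists_factor hf hg
  refine ⟨‖ev g 0‖ + 1, by positivity, ?_⟩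
  filter_upwards [hg2, (analyticAt_ev hg1).continuousAt.norm.eventually_le_const
    (lt_add_one ‖ev g 0‖)] with z h1 h2
  rw [h1, norm_mul, norm_pow, mul_comm]
  gcongr

theorem ev_zero (f : L⟦X⟧) : ev f 0 = algebraMap L ℂ (coeff 0 f) := by
  rw [ev, tsum_eq_single 0 fun n hn => by rw [zero_pow hn, mul_zero]]
  simp

theorem le_norm_ev {f : L⟦X⟧} (hf : Conv f) (h0 : f ≠ 0) :
    ∃ (c : ℝ) (ν : ℕ), 0 < c ∧ ∀ᶠ z in 𝓝 (0 : ℂ), c * ‖z‖ ^ ν ≤ ‖ev f z‖ := by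
  obtain ⟨g, hg⟩ := X_pow_order_dvd (φ := f)
  obtain ⟨hg1, hg2⟩ := exists_factor hf hg
  have hg0 : ev g 0 ≠ 0 := by
    rw [ev_zero]
    refine (map_ne_zero _).mpr ?_
    have := coeff_order h0
    have h3 : coeff (f.order.toNat) f = coeff 0 g := by
      refine (congrArg (coeff f.order.toNat) hg).trans ?_
      rw [coeff_X_pow_mul', if_pos le_rfl, Nat.sub_self]
    rwa [h3] at this
  have hpos : 0 < ‖ev g 0‖ := norm_pos_iff.mpr hg0
  refine ⟨‖ev g 0‖ / 2, f.order.toNat, by positivity, ?_⟩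
  filter_upwards [hg2, (analyticAt_ev hg1).continuousAt.norm.eventually_const_le
    (half_lt_self hpos)] with z h1 h2
  rw [h1, norm_mul, norm_pow, mul_comm]
  gcongr

end Conv

/-- The ultrapower of `ℂ`. -/
abbrev UltraC : Type := Germ (hyperfilter ℕ : Filter ℕ) ℂ

/-- Evaluation of meromorphic germs along a sequence tending to the origin. -/
def seqHom {β : ℕ → ℂ} (hβ : Tendsto β atTop (𝓝[≠] 0)) : MGerm →+* UltraC where
  toFun φ := φ.1.compTendsto β (hβ.mono_left Nat.hyperfilter_le_atTop)
  map_one' := rfl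
  map_mul' φ ψ := by
    obtain ⟨f, hf, rfl⟩ := φ.exists_rep
    obtain ⟨g, hg, rfl⟩ := ψ.exists_rep
    rfl
  map_zero' := rfl
  map_add' φ ψ := by
    obtain ⟨f, hf, rfl⟩ := φ.exists_rep
    obtain ⟨g, hg, rfl⟩ := ψ.exists_rep
    rfl

end Mahler

namespace Mahler

theorem one_le_norm_mul_pow_of_isIntegral {L : Type*} [Field L] [NumberField L] [Algebra L ℂ]
    {y : L} (hy : IsIntegral ℤ y) (hy0 : y ≠ 0) {H : ℝ} (hH : ∀ τ : L →+* ℂ, ‖τ y‖ ≤ H) :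
    1 ≤ ‖algebraMap L ℂ y‖ * H ^ (Module.finrank ℚ L - 1) := by
  classical
  have hprod := Algebra.norm_eq_prod_embeddings ℚ ℂ y
  obtain ⟨z, hz⟩ := IsIntegrallyClosed.isIntegral_iff.mp (Algebra.isIntegral_norm ℚ hy)
  have hz0 : z ≠ 0 := by
    rintro rfl
    rw [map_zero] at hz
    exact hy0 (Algebra.norm_eq_zero_iff.mp hz.symm)
  have h1 : (1 : ℝ) ≤ ‖algebraMap ℚ ℂ (Algebra.norm ℚ y)‖ := by
    rw [← hz]
    simp only [eq_intCast, map_intCast, Complex.norm_intCast]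
    exact_mod_cast Int.one_le_abs hz0
  let σ : L →ₐ[ℚ] ℂ := (algebraMap L ℂ).toRatAlgHom
  rw [hprod, norm_prod, ← Finset.mul_prod_erase _ _ (Finset.mem_univ σ)] at h1
  refine h1.trans (mul_le_mul_of_nonneg_left ?_ (norm_nonneg _))
  refine (Finset.prod_le_prod (fun τ _ => norm_nonneg _)
    fun (τ : L →ₐ[ℚ] ℂ) _ => hH τ.toRingHom).trans_eq ?_
  rw [Finset.prod_const, Finset.card_erase_of_mem (Finset.mem_univ σ), Finset.card_univ,
    AlgHom.card]

end Mahler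

namespace Mahler
open Filter Topology TensorProduct

theorem eq_zero_of_sum_tmul_eq_zero {k E D κ : Type*} [Field k] [AddCommGroup E] [Module k E]
    [AddCommGroup D] [Module k D] [Fintype κ] {d : κ → D} (hd : LinearIndependent k d) {c : κ → E}
    (h : ∑ i, c i ⊗ₜ[k] d i = 0) : c = 0 := by
  classical
  obtain ⟨G, hG⟩ := LinearMap.exists_leftInverse_of_injective (Finsupp.linearCombination k d)
    (LinearMap.ker_eq_bot.mpr hd)
  have hGd : ∀ i, G (d i) = Finsupp.single i 1 := fun i => by
    have := LinearMap.congr_fun hG (Finsupp.single i 1)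
    simpa using this
  funext j
  have h1 := congrArg ((TensorProduct.rid k E).toLinearMap ∘ₗ
    LinearMap.lTensor E (Finsupp.lapply j ∘ₗ G)) h
  simpa [hGd, Finsupp.single_apply] using h1

theorem exists_small_increment {h : ℕ → ℕ} (h0 : 1 ≤ h 0) {n : ℕ}
    (hn : ∀ a, h a ≤ (a + 1) ^ n) {M : ℕ} (hM : 1 ≤ M) :
    ∃ a, M * h (a + 1) ≤ M * h a + h (a + 1) := by
  by_contra! hcon
  have hM2 : 2 ≤ M := by
    by_contra hlt
    have : M = 1 := by omega
    subst this
    have := hcon 0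
    omega
  have hM1 : (0 : ℝ) < M - 1 := by
    have : (2 : ℝ) ≤ M := by exact_mod_cast hM2
    linarith
  set t : ℝ := M / (M - 1) with ht
  have ht1 : 1 < t := by rw [ht, one_lt_div hM1]; linarith
  have hgrow : ∀ a, t ^ a ≤ h a := by
    intro a
    induction a with
    | zero => simpa using h0
    | succ a ih =>
      have h1 : (M : ℝ) * h a + h (a + 1) < M * h (a + 1) := by exact_mod_cast hcon a
      rw [pow_succ']
      calc t * t ^ a ≤ t * h a := by gcongr
        _ ≤ h (a + 1) := by
          rw [ht, div_mul_eq_mul_div, div_le_iff₀ hM1]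
          linarith
  have hlim := tendsto_pow_const_div_const_pow_of_one_lt n ht1
  have hlim' : Tendsto (fun a : ℕ => ((a + 1 : ℕ) : ℝ) ^ n / t ^ (a + 1)) atTop (𝓝 0) :=
    hlim.comp (tendsto_add_atTop_nat 1)
  have ht0 : 0 < t := one_pos.trans ht1
  obtain ⟨a, ha⟩ := (hlim'.eventually_lt_const (show (0 : ℝ) < t⁻¹ by positivity)).exists
  have h2 : (h a : ℝ) ≤ ((a + 1 : ℕ) : ℝ) ^ n := by exact_mod_cast hn a
  rw [div_lt_iff₀ (by positivity), pow_succ', inv_mul_cancel_left₀ ht0.ne'] at ha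
  linarith [hgrow a]

section Monomials

variable {k F ι : Type*} [Field k] [Field F] [Algebra k F] [Fintype ι]

/-- The monomials in `x` with all exponents at most `a`. -/
def boxMonomial (x : ι → F) (a : ℕ) (m : ι → Fin (a + 1)) : F := ∏ j, x j ^ (m j : ℕ)

/-- The span of the monomials in `x` with all exponents at most `a`. -/
def boxSpan (k : Type*) [Field k] [Algebra k F] (x : ι → F) (a : ℕ) : Submodule k F :=
  Submodule.span k (Set.range (boxMonomial x a))

theorem mem_boxSpan (x : ι → F) {a : ℕ} {m : ι → ℕ} (hm : ∀ j, m j ≤ a) :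
    ∏ j, x j ^ m j ∈ boxSpan k x a :=
  Submodule.subset_span ⟨fun j => ⟨m j, Nat.lt_succ_of_le (hm j)⟩, rfl⟩

instance (x : ι → F) (a : ℕ) : FiniteDimensional k (boxSpan k x a) :=
  FiniteDimensional.span_of_finite k (Set.finite_range _)

theorem exists_boxSpan_basis (x : ι → F) (a : ℕ) :
    ∃ (κ : Type) (_ : Fintype κ) (m : κ → ι → ℕ), (∀ l j, m l j ≤ a) ∧
      LinearIndependent k (fun l => ∏ j, x j ^ m l j) ∧
      Submodule.span k (Set.range fun l => ∏ j, x j ^ m l j) = boxSpan k x a ∧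
      Fintype.card κ = Module.finrank k (boxSpan k x a) := by
  obtain ⟨κ, b, hb, hspan, hind⟩ := exists_linearIndependent' k (boxMonomial x a)
  have : Finite κ := Finite.of_injective b hb
  obtain ⟨N, ⟨e⟩⟩ := Finite.exists_equiv_fin κ
  have hind' : LinearIndependent k ((boxMonomial x a ∘ b) ∘ e.symm) := hind.comp _ e.symm.injective
  have hspan' : Submodule.span k (Set.range ((boxMonomial x a ∘ b) ∘ e.symm)) = boxSpan k x a := by
    rw [e.symm.surjective.range_comp, hspan, boxSpan]
  refine ⟨Fin N, inferInstance, fun l j => b (e.symm l) j,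
    fun l j => Nat.lt_succ_iff.mp (b (e.symm l) j).2, hind', hspan', ?_⟩
  rw [← hspan', finrank_span_eq_card hind']

end Monomials

theorem exists_relationMatrix {k E F ι : Type*} [Field k] [CharZero k] [Field E] [Algebra k E]
    [Field F] [Algebra k F] [Fintype ι] {g : ι → E} (hg : AlgIndepCoeff k g) {x : ι → F}
    (hx : x ≠ 0) {M : ℕ} (hM : 1 ≤ M) :
    ∃ (κ κ' : Type) (_ : Fintype κ) (_ : Fintype κ') (m : κ → ι → ℕ) (d' : κ' → F) (a : ℕ)
      (T : κ' → ι → κ → k),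
      Nonempty κ ∧ M * Fintype.card κ ≤ M * Fintype.card κ' + Fintype.card κ ∧ (∀ l j, m l j ≤ a) ∧
      LinearIndependent k (fun l => ∏ j, x j ^ m l j) ∧
      (∀ i j, x j * d' i = ∑ l, T i j l • ∏ j, x j ^ m l j) ∧
      ∀ c : κ' → E, (∀ l, ∑ i, c i * ∑ j, T i j l • g j = 0) → c = 0 := by
  classical
  obtain ⟨a, ha⟩ := exists_small_increment (h := fun a => Module.finrank k (boxSpan k x a))
    (n := Fintype.card ι) (by
      rw [Nat.one_le_iff_ne_zero, Ne, Submodule.finrank_eq_zero]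
      intro h
      have h1 : (∏ j, x j ^ (0 : ι → ℕ) j) ∈ boxSpan k x 0 := mem_boxSpan x fun j => le_rfl
      rw [h] at h1
      simp at h1)
    (fun a => by
      refine (finrank_range_le_card (R := k) (boxMonomial x a)).trans ?_
      simp) hM
  obtain ⟨κ', _, m', hm', hind', hspan', hcard'⟩ := exists_boxSpan_basis (k := k) x a
  obtain ⟨κ, _, m, hm, hind, hspan, hcard⟩ := exists_boxSpan_basis (k := k) x (a + 1)
  have hT : ∀ (i : κ') (j : ι), ∃ c : κ → k, ∑ l, c l • ∏ j, x j ^ m l j =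
      x j * ∏ s, x s ^ m' i s := by
    intro i j
    refine (Submodule.mem_span_range_iff_exists_fun k).mp ?_
    rw [hspan]
    have : x j * ∏ s, x s ^ m' i s = ∏ s, x s ^ (m' i s + if s = j then 1 else 0) := by
      simp_rw [pow_add, Finset.prod_mul_distrib, pow_ite, pow_one, pow_zero]
      rw [mul_comm]
      simp
    rw [this]
    refine mem_boxSpan x fun s => ?_
    have := hm' i s
    split_ifs <;> omega
  choose T hT using hT
  refine ⟨κ, κ', inferInstance, inferInstance, m, fun i => ∏ s, x s ^ m' i s, a + 1, T, ?_, ?_, hm,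
    hind, fun i j => (hT i j).symm, fun c hc => ?_⟩
  · by_contra hκ
    have h1 : (∏ j, x j ^ (0 : ι → ℕ) j) ∈ boxSpan k x (a + 1) :=
      mem_boxSpan x fun j => Nat.zero_le _
    rw [not_nonempty_iff] at hκ
    rw [← hspan, Set.range_eq_empty, Submodule.span_empty] at h1
    simp at h1
  · rw [hcard, hcard']; exact ha
  let D : Subalgebra k F := Algebra.adjoin k (Set.range x)
  have hft : Algebra.FiniteType k D :=
    Subalgebra.fg_iff_finiteType _ |>.mp ⟨Finset.univ.image x, by simp [D]⟩
  let y : ι → D := fun j => ⟨x j, Algebra.subset_adjoin ⟨j, rfl⟩⟩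
  have hval : ∀ (m : ι → ℕ), D.val (∏ s, y s ^ m s) = ∏ s, x s ^ m s := fun m => by
    simp [y]
  have hd' : LinearIndependent k (fun i => ∏ s, y s ^ m' i s) := by
    refine LinearIndependent.of_comp D.val.toLinearMap ?_
    convert hind' using 1
    funext i
    exact hval _
  obtain ⟨j0, hj0⟩ := Function.ne_iff.mp hx
  refine eq_zero_of_sum_tmul_eq_zero hd' (hg.eq_zero_of_mul_eq_zero y j0
    (fun h => hj0 (congrArg Subtype.val h)) _ ?_)
  have hTy : ∀ i j, y j * ∏ s, y s ^ m' i s = ∑ l, T i j l • ∏ s, y s ^ m l s := fun i j => by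
    refine Subtype.val_injective ?_
    rw [← D.coe_val]
    rw [map_mul, map_sum, hval]
    simp_rw [map_smul, hval, hT]
    rfl
  have h1 : (∑ i, c i ⊗ₜ[k] ∏ s, y s ^ m' i s) * ∑ j, g j ⊗ₜ[k] y j =
      ∑ l, (∑ i, c i * ∑ j, T i j l • g j) ⊗ₜ[k] ∏ s, y s ^ m l s := by
    rw [Finset.sum_mul_sum]
    simp_rw [Algebra.TensorProduct.tmul_mul_tmul, mul_comm _ (y _), hTy, tmul_sum, Finset.mul_sum,
      sum_tmul]
    have : ∀ f : κ' → ι → κ → E ⊗[k] D, ∑ i, ∑ j, ∑ l, f i j l = ∑ l, ∑ i, ∑ j, f i j l := by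
      intro f
      rw [Finset.sum_comm]
      refine Eq.trans ?_ (Finset.sum_congr rfl fun l _ => Finset.sum_comm)
      refine Eq.trans (Finset.sum_congr rfl fun j _ => Finset.sum_comm) ?_
      exact Finset.sum_comm
    rw [this]
    refine Finset.sum_congr rfl fun l _ => Finset.sum_congr rfl fun i _ =>
      Finset.sum_congr rfl fun j _ => ?_
    rw [mul_smul_comm, smul_tmul]
  rw [h1]
  exact Finset.sum_eq_zero fun l _ => by rw [hc, zero_tmul]

end Mahler

namespace Mahler
open Polynomial

theorem exists_matrix_denominator {R m n : Type*} [CommRing R] [IsDomain R] [Finite m] [Finite n]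
    {K : Type*} [Field K] [Algebra R K] [IsFractionRing R K] (A : Matrix m n K) :
    ∃ (b : R) (A₀ : Matrix m n R), b ≠ 0 ∧
      A₀.map (algebraMap R K) = algebraMap R K b • A := by
  obtain ⟨b, hb⟩ := IsLocalization.exist_integer_multiples_of_finite (nonZeroDivisors R)
    (fun s : m × n => A s.1 s.2)
  choose A₀ hA₀ using hb
  refine ⟨b, Matrix.of fun i j => A₀ (i, j), nonZeroDivisors.ne_zero b.2, ?_⟩
  ext i j
  simp [hA₀, Algebra.smul_def]

/-- Splitting of a matrix with independent rows, up to a denominator. -/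
theorem exists_splitting {R κ κ' : Type*} [CommRing R] [IsDomain R] [Fintype κ] [Fintype κ']
    [DecidableEq κ] (K : Type*) [Field K] [Algebra R K] [IsFractionRing R K]
    (Φ : Matrix κ' κ R) (hΦ : ∀ c : κ' → R, Matrix.vecMul c Φ = 0 → c = 0) :
    ∃ (r : ℕ) (Δ : R) (U : Matrix κ (Fin r) R) (V : Matrix (Fin r) κ R) (C : Matrix κ κ' R),
      Fintype.card κ' + r = Fintype.card κ ∧ Δ ≠ 0 ∧
      Δ • (1 : Matrix κ κ R) = U * V + C * Φ := by
  classical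
  set φ := algebraMap R K with hφ
  have hinj : Function.Injective φ := IsFractionRing.injective R K
  set ΦK := Φ.map φ with hΦK
  have hrow : LinearIndependent K ΦK.row := by
    rw [← Matrix.vecMul_injective_iff, ← Matrix.coe_vecMulLinear, injective_iff_map_eq_zero]
    intro c hc
    rw [Matrix.vecMulLinear_apply] at hc
    obtain ⟨b, hb⟩ := IsLocalization.exist_integer_multiples_of_finite (nonZeroDivisors R) c
    choose c₀ hc₀ using hb
    have hb0 : φ b ≠ 0 := (map_ne_zero_iff φ hinj).mpr (nonZeroDivisors.ne_zero b.2)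
    have h0 : c₀ = 0 := hΦ c₀ (by
      funext l
      refine hinj ?_
      have h1 := congrArg (φ b * ·) (congrFun hc l)
      simp only [Matrix.vecMul, dotProduct, hΦK, Matrix.map_apply, Pi.zero_apply, mul_zero,
        Finset.mul_sum] at h1
      simp only [Matrix.vecMul, dotProduct, map_sum, map_mul, Pi.zero_apply, map_zero]
      rw [← h1]
      refine Finset.sum_congr rfl fun i _ => ?_
      rw [hφ, hc₀, Algebra.smul_def, mul_assoc])
    funext i
    have h2 := hc₀ i
    rw [h0, Pi.zero_apply, map_zero, Algebra.smul_def] at h2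
    exact (mul_eq_zero.mp h2.symm).resolve_left hb0
  have hrank : Module.finrank K (LinearMap.range ΦK.mulVecLin) = Fintype.card κ' := hrow.rank_matrix
  have hsurj : Function.Surjective ΦK.mulVec := by
    rw [← Matrix.coe_mulVecLin, ← LinearMap.range_eq_top]
    exact Submodule.eq_top_of_finrank_eq (by rw [hrank, Module.finrank_fintype_fun_eq_card])
  obtain ⟨CK, hCK⟩ := Matrix.mulVec_surjective_iff_exists_right_inverse.mp hsurj
  have hker := LinearMap.finrank_range_add_finrank_ker ΦK.mulVecLin
  rw [hrank, Module.finrank_fintype_fun_eq_card] at hker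
  set N := LinearMap.ker ΦK.mulVecLin
  let bN := Module.finBasis K N
  let UK : Matrix κ (Fin (Module.finrank K N)) K := Matrix.of fun l t => (bN t : κ → K) l
  set A : Matrix κ κ K := 1 - CK * ΦK with hA
  have hAN : ∀ l, A.mulVec (Pi.single l 1) ∈ N := fun l => by
    rw [LinearMap.mem_ker, Matrix.mulVecLin_apply, Matrix.mulVec_mulVec, hA, Matrix.mul_sub,
      Matrix.mul_one, ← Matrix.mul_assoc, hCK, Matrix.one_mul, sub_self, Matrix.zero_mulVec]
  let VK : Matrix (Fin (Module.finrank K N)) κ K := Matrix.of fun t l => bN.repr ⟨_, hAN l⟩ t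
  have hUV : UK * VK = A := by
    ext l' l
    have h1 := congrArg (fun v : N => (v : κ → K) l') (bN.sum_repr ⟨_, hAN l⟩)
    have h2 : A.mulVec (Pi.single l 1) l' = A l' l := by simp
    simp only [Submodule.coe_sum, Finset.sum_apply, Submodule.coe_smul, Pi.smul_apply,
      smul_eq_mul] at h1
    rw [← h2, ← h1, Matrix.mul_apply]
    refine Finset.sum_congr rfl fun t _ => ?_
    rw [mul_comm]
    rfl
  obtain ⟨u, U, hu, hU⟩ := exists_matrix_denominator (R := R) UK
  obtain ⟨v, V, hv, hV⟩ := exists_matrix_denominator (R := R) VK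
  obtain ⟨c, C, hc, hC⟩ := exists_matrix_denominator (R := R) CK
  refine ⟨_, u * v * c, c • U, V, (u * v) • C, hker, mul_ne_zero (mul_ne_zero hu hv) hc, ?_⟩
  refine Matrix.map_injective hinj ?_
  simp only
  have e1 : (c • U).map φ = (φ c * φ u) • UK := by
    rw [mul_smul, ← hU]; ext; simp [hφ]
  have e2 : ((u * v) • C).map φ = (φ u * φ v * φ c) • CK := by
    rw [mul_smul (φ u * φ v), ← hC]; ext; simp [hφ]
  have e3 : ((u * v * c) • (1 : Matrix κ κ R)).map φ = (φ u * φ v * φ c) • 1 := by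
    ext i j; by_cases h : i = j <;> simp [h]
  rw [e3, Matrix.map_add _ (map_add φ), Matrix.map_mul, Matrix.map_mul, e1, e2, hV]
  have : (1 : Matrix κ κ K) = UK * VK + CK * ΦK := by rw [hUV, hA, sub_add_cancel]
  rw [this, smul_add, Matrix.smul_mul, Matrix.smul_mul, Matrix.mul_smul, smul_smul]
  congr 2
  ring

/-- Simultaneous Padé approximation. -/
theorem exists_pade {L κ : Type*} [Field L] [Fintype κ] {r N δ : ℕ}
    (U : κ → Fin r → PowerSeries L) (h : r * N < Fintype.card κ * (δ + 1)) :
    ∃ p : κ → L[X], p ≠ 0 ∧ (∀ l, (p l).natDegree ≤ δ) ∧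
      ∀ t, (PowerSeries.X : PowerSeries L) ^ N ∣ ∑ l, (p l : PowerSeries L) * U l t := by
  let Λ : (κ → degreeLT L (δ + 1)) →ₗ[L] (Fin r → Fin N → L) :=
    LinearMap.pi fun t => LinearMap.pi fun i => ∑ l,
      PowerSeries.coeff (R := L) i ∘ₗ LinearMap.mulRight L (U l t) ∘ₗ
        (coeToPowerSeries.algHom L).toLinearMap ∘ₗ (degreeLT L (δ + 1)).subtype ∘ₗ LinearMap.proj l
  have hfin : Module.finrank L (degreeLT L (δ + 1)) = δ + 1 := by
    rw [(degreeLTEquiv L (δ + 1)).finrank_eq, Module.finrank_fin_fun]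
  have hfinsum : ∑ _l : κ, Module.finrank L (degreeLT L (δ + 1)) = Fintype.card κ * (δ + 1) := by
    simp [hfin]
  have : FiniteDimensional L (degreeLT L (δ + 1)) :=
    Module.Finite.equiv (degreeLTEquiv L (δ + 1)).symm
  have hlt : Module.finrank L (Fin r → Fin N → L) < Module.finrank L (κ → degreeLT L (δ + 1)) := by
    rw [Module.finrank_pi_fintype L (M := fun _ : κ => degreeLT L (δ + 1)), hfinsum,
      Module.finrank_pi_fintype L (M := fun _ : Fin r => Fin N → L)]
    simpa using h
  obtain ⟨p, hp, hp0⟩ := (Submodule.ne_bot_iff _).mp (LinearMap.ker_ne_bot_of_finrank_lt hlt)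
  refine ⟨fun l => p l, fun h0 => hp0 ?_, fun l => ?_, fun t => ?_⟩
  · funext l
    exact Subtype.ext (congrFun h0 l)
  · have := mem_degreeLT.mp (p l).2
    by_cases h0 : (p l : L[X]) = 0
    · simp [h0]
    · exact Nat.lt_succ_iff.mp ((natDegree_lt_iff_degree_lt h0).mpr this)
  · rw [PowerSeries.X_pow_dvd_iff]
    intro i hi
    have h1 := congrFun (congrFun (LinearMap.mem_ker.mp hp) t) ⟨i, hi⟩
    have h2 : Λ p t ⟨i, hi⟩ =
        ∑ l, PowerSeries.coeff i (((p l : L[X]) : PowerSeries L) * U l t) := by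
      simp [Λ, coeToPowerSeries.algHom_apply, LinearMap.sum_apply]
    rw [map_sum, ← h2]
    exact h1

end Mahler

namespace Mahler
open Filter Topology Polynomial

section

variable {L : Type*} [Field L] [Algebra L ℂ]

theorem toGerm_polyConv (p : L[X]) :
    toGerm L (polyConv L p) = algebraMap ℂ[X] MGerm (p.map (algebraMap L ℂ)) := by
  rw [toGerm_apply, MGerm.algebraMap_eq, MGerm.mk_eq_mk]
  exact Eventually.of_forall fun z => by simp [coe_polyConv, ev_coe, aeval_def, eval_map]

theorem polyConv_injective : Function.Injective (polyConv L) := fun _ _ h =>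
  Polynomial.coe_injective L (congrArg Subtype.val h)

variable (L) in
/-- Rational functions over `L` as meromorphic germs. -/
def ratGerm : FractionRing L[X] →+* MGerm :=
  IsFractionRing.lift (g := (toGerm L).comp (polyConv L))
    (toGerm_injective.comp polyConv_injective)

theorem ratGerm_algebraMap (p : L[X]) :
    ratGerm L (algebraMap L[X] (FractionRing L[X]) p) = toGerm L (polyConv L p) :=
  IsFractionRing.lift_algebraMap _ p

variable (L) in
/-- The algebra structure given by `ratGerm`. -/
abbrev ratGermAlgebra : Algebra (FractionRing L[X]) MGerm := (ratGerm L).toAlgebra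

theorem algIndepCoeff_of_linearIndependent {ι : Type*} [Fintype ι] {Y : ι → MGerm}
    (hY : LinearIndependent MGerm.algSubfield Y) :
    letI := ratGermAlgebra L
    AlgIndepCoeff (FractionRing L[X]) Y := by
  let _ := ratGermAlgebra L
  intro y hy hsum
  let _ : Algebra L[X] ℂ[X] := (mapRingHom (algebraMap L ℂ)).toAlgebra
  let _ : Algebra L[X] MGerm := ((toGerm L).comp (polyConv L)).toAlgebra
  have : IsScalarTower L[X] (FractionRing L[X]) MGerm :=
    IsScalarTower.of_algebraMap_eq fun p => (ratGerm_algebraMap p).symm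
  have : IsScalarTower L[X] ℂ[X] MGerm :=
    IsScalarTower.of_algebraMap_eq fun p => toGerm_polyConv p
  have hy' : ∀ j, y j ∈ MGerm.algSubfield := fun j => by
    rw [MGerm.mem_algSubfield]
    exact ((IsFractionRing.isAlgebraic_iff L[X] (FractionRing L[X]) MGerm).mpr (hy j)).extendScalars
      (map_injective _ (algebraMap L ℂ).injective)
  have := Fintype.linearIndependent_iff.mp hY (fun j => ⟨y j, hy' j⟩) (by
    simpa [Subfield.smul_def, mul_comm] using hsum)
  exact fun j => congrArg Subtype.val (this j)

instance : CharZero (FractionRing L[X]) :=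
  haveI : CharZero L := (algebraMap L ℂ).charZero
  inferInstance

/-- Existence of auxiliary polynomial expressions in `x` that vanish to high order. -/
theorem exists_auxiliary {ι : Type*} [Fintype ι] {g : ι → convSubring L}
    (hg : LinearIndependent MGerm.algSubfield fun j => toGerm L (g j))
    {β : ℕ → ℂ} (hβ : Tendsto β atTop (𝓝[≠] 0)) {x : ι → UltraC} (hx : x ≠ 0)
    (hgx : ∑ j, seqHom hβ (toGerm L (g j)) * x j = 0) {M : ℕ} (hM : 1 ≤ M) :
    ∃ (κ : Type) (_ : Fintype κ) (m : κ → ι → ℕ) (a r : ℕ) (Δ : convSubring L)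
      (V : Fin r → κ → convSubring L), (∀ l j, m l j ≤ a) ∧ Δ ≠ 0 ∧
      ∀ δ : ℕ, ∃ (p : κ → L[X]) (W : Fin r → convSubring L), (∀ l, (p l).natDegree ≤ δ) ∧
        (∀ t, (PowerSeries.X : PowerSeries L) ^ (M * δ) ∣ (W t : PowerSeries L)) ∧
        ∑ l, seqHom hβ (toGerm L (polyConv L (p l))) * ∏ j, x j ^ m l j ≠ 0 ∧
        seqHom hβ (toGerm L Δ) *
            ∑ l, seqHom hβ (toGerm L (polyConv L (p l))) * ∏ j, x j ^ m l j =
          ∑ t, seqHom hβ (toGerm L (W t)) *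
            ∑ l, seqHom hβ (toGerm L (V t l)) * ∏ j, x j ^ m l j := by
  classical
  let _ := ratGermAlgebra L
  let _ : Algebra (FractionRing L[X]) UltraC := ((seqHom hβ).comp (ratGerm L)).toAlgebra
  obtain ⟨κ, κ', _, _, m, d', a, T, hκ, hcard, hm, hli, hT, hc⟩ :=
    exists_relationMatrix (algIndepCoeff_of_linearIndependent (L := L) hg) hx hM
  obtain ⟨⟨Q, hQ⟩, hQT⟩ := IsLocalization.exist_integer_multiples_of_finite (nonZeroDivisors L[X])
    (fun s : κ' × ι × κ => T s.1 s.2.1 s.2.2)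
  choose T₀ hT₀ using hQT
  have hQ0 : Q ≠ 0 := nonZeroDivisors.ne_zero hQ
  set s : convSubring L →+* UltraC := (seqHom hβ).comp (toGerm L) with hs
  set d : κ → UltraC := fun l => ∏ j, x j ^ m l j with hd
  let Φ : Matrix κ' κ (convSubring L) := Matrix.of fun i l => ∑ j, polyConv L (T₀ (i, j, l)) * g j
  have hpoly : ∀ i j l, toGerm L (polyConv L (T₀ (i, j, l))) =
      toGerm L (polyConv L Q) * ratGerm L (T i j l) := fun i j l => by
    rw [← ratGerm_algebraMap, ← ratGerm_algebraMap, ← map_mul, hT₀, Algebra.smul_def]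
  have hΦ : ∀ i l, toGerm L (Φ i l) =
      toGerm L (polyConv L Q) * ∑ j, T i j l • toGerm L (g j) := fun i l => by
    simp only [Φ, Matrix.of_apply, map_sum, map_mul, hpoly, Finset.mul_sum, Algebra.smul_def]
    exact Finset.sum_congr rfl fun j _ => mul_assoc _ _ _
  have hQ' : toGerm L (polyConv L Q) ≠ 0 := fun h =>
    hQ0 ((toGerm_injective.comp polyConv_injective) (by simpa using h))
  have hrow : ∀ c : κ' → convSubring L, Matrix.vecMul c Φ = 0 → c = 0 := by
    intro c hc0
    have h1 := hc (fun i => toGerm L (c i)) fun l => by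
      have h2 := congrArg (toGerm L) (congrFun hc0 l)
      simp only [Matrix.vecMul, dotProduct, map_sum, map_mul, hΦ, Pi.zero_apply, map_zero] at h2
      refine (mul_eq_zero.mp (Eq.trans ?_ h2)).resolve_left hQ'
      rw [Finset.mul_sum]
      exact Finset.sum_congr rfl fun i _ => mul_left_comm _ _ _
    funext i
    exact toGerm_injective ((congrFun h1 i).trans (map_zero _).symm)
  have hker : ∀ i, ∑ l, s (Φ i l) * d l = 0 := by
    intro i
    have h1 : ∀ l, s (Φ i l) * d l =
        s (polyConv L Q) * ∑ j, s (g j) * (T i j l • d l) := fun l => by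
      rw [hs, RingHom.comp_apply, hΦ, map_mul, map_sum, mul_assoc, Finset.sum_mul]
      congr 1
      refine Finset.sum_congr rfl fun j _ => ?_
      rw [Algebra.smul_def, Algebra.smul_def, map_mul]
      change seqHom hβ (ratGerm L (T i j l)) * _ * _ = _ * (seqHom hβ (ratGerm L (T i j l)) * _)
      simp only [RingHom.comp_apply]
      ring
    simp_rw [h1]
    rw [← Finset.mul_sum, Finset.sum_comm]
    simp_rw [← Finset.mul_sum]
    have h2 : ∀ j, s (g j) * ∑ l, T i j l • d l = s (g j) * x j * d' i := fun j => by
      rw [← hT, mul_assoc]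
    simp_rw [h2]
    rw [← Finset.sum_mul]
    have : ∑ j, s (g j) * x j = 0 := hgx
    rw [this, zero_mul, mul_zero]
  obtain ⟨r, Δ, U, V, C, hr, hΔ, hsplit⟩ :=
    exists_splitting (FractionRing (convSubring L)) Φ hrow
  refine ⟨κ, inferInstance, m, a, r, Δ, V, hm, hΔ, fun δ => ?_⟩
  have hcount : r * (M * δ) < Fintype.card κ * (δ + 1) := by
    have h1 : 0 < Fintype.card κ := Fintype.card_pos
    have h2 : M * r ≤ Fintype.card κ := by
      have : M * Fintype.card κ = M * Fintype.card κ' + M * r := by rw [← hr]; ring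
      omega
    calc r * (M * δ) = M * r * δ := by ring
      _ ≤ Fintype.card κ * δ := Nat.mul_le_mul_right _ h2
      _ < Fintype.card κ * (δ + 1) := Nat.mul_lt_mul_of_pos_left (Nat.lt_succ_self δ) h1
  obtain ⟨p, hp0, hpδ, hpU⟩ := exists_pade (fun l t => (U l t : PowerSeries L)) hcount
  refine ⟨p, fun t => ∑ l, polyConv L (p l) * U l t, hpδ, fun t => ?_, fun h0 => hp0 ?_, ?_⟩
  · have : ((∑ l, polyConv L (p l) * U l t : convSubring L) : PowerSeries L) =
        ∑ l, (p l : PowerSeries L) * (U l t : PowerSeries L) := by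
      simp [coe_polyConv]
    rw [this]
    exact hpU t
  · have h1 := Fintype.linearIndependent_iff.mp hli
      (fun l => algebraMap L[X] (FractionRing L[X]) (p l)) (by
        rw [← h0]
        refine Finset.sum_congr rfl fun l _ => ?_
        rw [← ratGerm_algebraMap, Algebra.smul_def]
        rfl)
    funext l
    exact IsFractionRing.injective L[X] (FractionRing L[X]) ((h1 l).trans (map_zero _).symm)
  · have hentry : ∀ l l', (if l = l' then Δ else 0) =
        ∑ t, U l t * V t l' + ∑ i, C l i * Φ i l' := by
      intro l l'
      have := congrFun (congrFun hsplit l) l'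
      rw [Matrix.add_apply, Matrix.mul_apply, Matrix.mul_apply, Matrix.smul_apply, Matrix.one_apply,
        smul_eq_mul, mul_ite, mul_one, mul_zero] at this
      exact this
    have hcol : ∀ l, s Δ * d l = ∑ t, s (U l t) * ∑ l', s (V t l') * d l' := by
      intro l
      have h1 : s Δ * d l = ∑ l', s (if l = l' then Δ else 0) * d l' := by
        rw [Finset.sum_eq_single l (fun l' _ h => by rw [if_neg h.symm, map_zero, zero_mul])
          (fun h => absurd (Finset.mem_univ l) h), if_pos rfl]
      rw [h1]
      simp_rw [hentry, map_add, map_sum, map_mul, add_mul, Finset.sum_add_distrib, Finset.sum_mul]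
      rw [Finset.sum_comm, Finset.sum_comm (f := fun l' i => s (C l i) * s (Φ i l') * d l')]
      simp_rw [mul_assoc, ← Finset.mul_sum, hker]
      simp
    change s Δ * ∑ l, s (polyConv L (p l)) * d l =
      ∑ t, s (∑ l, polyConv L (p l) * U l t) * ∑ l, s (V t l) * d l
    have h1 : ∀ l, s Δ * (s (polyConv L (p l)) * d l) =
        ∑ t, s (polyConv L (p l) * U l t) * ∑ l', s (V t l') * d l' := fun l => by
      rw [mul_left_comm, hcol, Finset.mul_sum]
      exact Finset.sum_congr rfl fun t _ => by rw [map_mul, mul_assoc]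
    rw [Finset.mul_sum]
    simp_rw [h1]
    rw [Finset.sum_comm]
    simp_rw [map_sum, Finset.sum_mul]

end

end Mahler

namespace Mahler
open Filter Topology Polynomial

section

variable {L : Type*} [Field L] [NumberField L]

/-- Clearing denominators in the values of polynomials at the powers of an algebraic number. -/
theorem exists_integral_values (α : L) : ∃ (d : ℤ) (A : ℝ), d ≠ 0 ∧ 1 ≤ A ∧ |(d : ℝ)| ≤ A ∧
    ∀ {κ : Type} [Fintype κ] (p : κ → L[X]) (δ : ℕ), (∀ l, (p l).natDegree ≤ δ) →
      ∃ (e : ℤ) (c : ℝ), e ≠ 0 ∧ 0 ≤ c ∧ ∀ (l : κ) (s : ℕ),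
        IsIntegral ℤ (e * d ^ (δ * s) * (p l).eval (α ^ s)) ∧
        ∀ τ : L →+* ℂ, ‖τ (e * d ^ (δ * s) * (p l).eval (α ^ s))‖ ≤ c * A ^ (δ * s) := by
  classical
  obtain ⟨d, hd0, hd⟩ := exists_integral_multiples ℤ ℚ ({α} : Finset L)
  replace hd := hd α (Finset.mem_singleton_self α)
  rw [zsmul_eq_mul] at hd
  refine ⟨d, 1 + |(d : ℝ)| + ∑ τ : L →+* ℂ, ‖τ (d * α)‖, hd0, ?_, ?_, ?_⟩
  · have := abs_nonneg (d : ℝ)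
    have : 0 ≤ ∑ τ : L →+* ℂ, ‖τ (d * α)‖ := by positivity
    linarith
  · have : 0 ≤ ∑ τ : L →+* ℂ, ‖τ (d * α)‖ := by positivity
    linarith
  set A := 1 + |(d : ℝ)| + ∑ τ : L →+* ℂ, ‖τ (d * α)‖ with hA
  have hA1 : |(d : ℝ)| ≤ A := by
    have : 0 ≤ ∑ τ : L →+* ℂ, ‖τ (d * α)‖ := by positivity
    linarith
  have hA2 : ∀ τ : L →+* ℂ, ‖τ (d * α)‖ ≤ A := fun τ => by
    have := Finset.single_le_sum (f := fun τ : L →+* ℂ => ‖τ (d * α)‖)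
      (fun τ _ => norm_nonneg _) (Finset.mem_univ τ)
    have := abs_nonneg (d : ℝ)
    linarith
  intro κ _ p δ hp
  obtain ⟨e, he0, he⟩ := exists_integral_multiples ℤ ℚ
    (Finset.univ.image fun li : κ × Fin (δ + 1) => (p li.1).coeff li.2)
  have he' : ∀ l i, i ∈ Finset.range (δ + 1) → IsIntegral ℤ (e * (p l).coeff i) := fun l i hi => by
    rw [← zsmul_eq_mul]
    exact he _ (Finset.mem_image.mpr ⟨(l, ⟨i, Finset.mem_range.mp hi⟩), Finset.mem_univ _, rfl⟩)
  have hval : ∀ l s, (e : L) * d ^ (δ * s) * (p l).eval (α ^ s) =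
      ∑ i ∈ Finset.range (δ + 1), e * (p l).coeff i * (d ^ ((δ - i) * s) * (d * α) ^ (i * s)) := by
    intro l s
    rw [eval_eq_sum_range' (Nat.lt_succ_of_le (hp l)), Finset.mul_sum]
    refine Finset.sum_congr rfl fun i hi => ?_
    obtain ⟨t, rfl⟩ := Nat.exists_eq_add_of_le (Nat.lt_succ_iff.mp (Finset.mem_range.mp hi))
    rw [Nat.add_sub_cancel_left, mul_pow, ← pow_mul]
    ring
  refine ⟨e, ∑ l, ∑ i ∈ Finset.range (δ + 1), ∑ τ : L →+* ℂ, ‖τ (e * (p l).coeff i)‖, he0,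
    by positivity, fun l s => ⟨?_, fun τ => ?_⟩⟩
  · rw [hval]
    refine IsIntegral.sum _ fun i hi => (he' l i hi).mul (IsIntegral.mul ?_ (hd.pow _))
    exact (isIntegral_algebraMap (R := ℤ) (x := d)).pow _
  · rw [hval, map_sum]
    have h1 : ∀ i ∈ Finset.range (δ + 1),
        ‖τ (e * (p l).coeff i * (d ^ ((δ - i) * s) * (d * α) ^ (i * s)))‖ ≤
        (∑ τ : L →+* ℂ, ‖τ (e * (p l).coeff i)‖) * A ^ (δ * s) := by
      intro i hi
      obtain ⟨t, ht⟩ := Nat.exists_eq_add_of_le (Nat.lt_succ_iff.mp (Finset.mem_range.mp hi))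
      rw [map_mul, norm_mul]
      refine mul_le_mul (Finset.single_le_sum (f := fun τ : L →+* ℂ => ‖τ (e * (p l).coeff i)‖)
        (fun τ _ => norm_nonneg _) (Finset.mem_univ τ)) ?_ (norm_nonneg _) (by positivity)
      rw [map_mul, norm_mul, map_pow, map_pow, norm_pow, norm_pow, map_intCast,
        Complex.norm_intCast, ht, Nat.add_sub_cancel_left, add_mul, add_comm, pow_add]
      exact mul_le_mul (pow_le_pow_left₀ (abs_nonneg _) hA1 _)
        (pow_le_pow_left₀ (norm_nonneg _) (hA2 τ) _) (by positivity) (by positivity)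
    refine (norm_sum_le _ _).trans ((Finset.sum_le_sum h1).trans ?_)
    rw [← Finset.sum_mul]
    refine mul_le_mul_of_nonneg_right ?_ (by positivity)
    exact Finset.single_le_sum (f := fun l => ∑ i ∈ Finset.range (δ + 1),
      ∑ τ : L →+* ℂ, ‖τ (e * (p l).coeff i)‖) (fun l _ => by positivity) (Finset.mem_univ l)

end

end Mahler

namespace Mahler
open Filter Topology Polynomial

section

variable {L : Type*} [Field L] [Algebra L ℂ]

theorem seqHom_toGerm {β : ℕ → ℂ} (hβ : Tendsto β atTop (𝓝[≠] 0)) (f : convSubring L) :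
    seqHom hβ (toGerm L f) =
      Germ.coeRingHom (hyperfilter ℕ : Filter ℕ) (fun k => ev (f : PowerSeries L) (β k)) := rfl

theorem tendsto_pow_pow_nhdsNE {α : ℂ} (h0 : 0 < ‖α‖) (h1 : ‖α‖ < 1) {q : ℕ} (hq : 2 ≤ q) :
    Tendsto (fun k : ℕ => α ^ q ^ k) atTop (𝓝[≠] 0) := by
  rw [tendsto_nhdsWithin_iff]
  refine ⟨(tendsto_pow_atTop_nhds_zero_of_norm_lt_one h1).comp
    (tendsto_pow_atTop_atTop_of_one_lt (by omega)), Eventually.of_forall fun k => ?_⟩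
  exact pow_ne_zero _ (norm_pos_iff.mp h0)

theorem coeRingHom_eq_iff {u v : ℕ → ℂ} :
    Germ.coeRingHom (hyperfilter ℕ : Filter ℕ) u = Germ.coeRingHom (hyperfilter ℕ : Filter ℕ) v ↔
      ∀ᶠ k in (hyperfilter ℕ : Filter ℕ), u k = v k := Germ.coe_eq

/-- The analytic estimate for the auxiliary expressions. -/
theorem norm_auxiliary_le {κ : Type} [Fintype κ] {r N : ℕ} {Δ : convSubring L}
    {c : ℝ} {ν : ℕ} (hc : 0 < c)
    (hΔ : ∀ᶠ z in 𝓝 (0 : ℂ), c * ‖z‖ ^ ν ≤ ‖ev (Δ : PowerSeries L) z‖)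
    (V : Fin r → κ → convSubring L) (W : Fin r → convSubring L)
    (hW : ∀ t, (PowerSeries.X : PowerSeries L) ^ N ∣ (W t : PowerSeries L)) :
    ∃ C : ℝ, 0 ≤ C ∧ ∀ᶠ z in 𝓝 (0 : ℂ), ∀ (P : ℂ) (d : κ → ℂ) (H : ℝ), 0 ≤ H →
      (∀ l, ‖d l‖ ≤ H) →
      ev (Δ : PowerSeries L) z * P =
        ∑ t, ev (W t : PowerSeries L) z * ∑ l, ev (V t l : PowerSeries L) z * d l →
      ‖P‖ * ‖z‖ ^ ν ≤ C * ‖z‖ ^ N * H := by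
  choose CW hCW0 hCW using fun t => norm_ev_le (W t).2 (hW t)
  choose CV hCV0 hCV using fun tl : Fin r × κ =>
    norm_ev_le (N := 0) (V tl.1 tl.2).2 (by rw [pow_zero]; exact one_dvd _)
  refine ⟨c⁻¹ * ∑ t, CW t * ∑ l, CV (t, l), 
    mul_nonneg (by positivity) (Finset.sum_nonneg fun t _ => mul_nonneg (hCW0 t)
      (Finset.sum_nonneg fun l _ => hCV0 _)), ?_⟩
  filter_upwards [hΔ, eventually_all.mpr hCW, eventually_all.mpr hCV] with
    z h1 h2 h3 P d H hH hd heq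
  have hb : ‖ev (Δ : PowerSeries L) z * P‖ ≤ (∑ t, CW t * ∑ l, CV (t, l)) * ‖z‖ ^ N * H := by
    rw [heq, Finset.sum_mul, Finset.sum_mul]
    refine norm_sum_le_of_le _ fun t _ => ?_
    rw [norm_mul]
    have h4 : ‖∑ l, ev (V t l : PowerSeries L) z * d l‖ ≤ (∑ l, CV (t, l)) * H := by
      rw [Finset.sum_mul]
      refine norm_sum_le_of_le _ fun l _ => ?_
      rw [norm_mul]
      have := h3 (t, l)
      rw [pow_zero, mul_one] at this
      exact mul_le_mul this (hd l) (norm_nonneg _) (hCV0 _)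
    refine (mul_le_mul (h2 t) h4 (norm_nonneg _)
      (mul_nonneg (hCW0 t) (by positivity))).trans_eq (by ring)
  rw [norm_mul] at hb
  have h5 : c * (‖P‖ * ‖z‖ ^ ν) ≤ (∑ t, CW t * ∑ l, CV (t, l)) * ‖z‖ ^ N * H := by
    refine le_trans ?_ hb
    calc c * (‖P‖ * ‖z‖ ^ ν) = c * ‖z‖ ^ ν * ‖P‖ := by ring
      _ ≤ _ := mul_le_mul_of_nonneg_right h1 (norm_nonneg _)
  rw [mul_assoc, mul_assoc, ← mul_assoc _ (‖z‖ ^ N), inv_mul_eq_div, le_div_iff₀' hc]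
  exact h5

/-- A sequence of small integral vectors cannot annihilate the values of functions that are
independent over the algebraic functions. -/
theorem false_of_integral_relations [NumberField L] {ι : Type} [Fintype ι]
    {g : ι → convSubring L} (hg : LinearIndependent MGerm.algSubfield fun j => toGerm L (g j))
    {q : ℕ} (hq : 2 ≤ q) {α : L} (hα0 : 0 < ‖algebraMap L ℂ α‖) (hα1 : ‖algebraMap L ℂ α‖ < 1)
    {x : ℕ → ι → L} (hInt : ∀ k j, IsIntegral ℤ (x k j)) {C : ℝ} (hC : 1 ≤ C)
    (hbd : ∀ k j (τ : L →+* ℂ), ‖τ (x k j)‖ ≤ C ^ q ^ k) (hx0 : ∀ k, x k ≠ 0)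
    (hrel : ∀ k, ∑ j, ev (g j : PowerSeries L) (algebraMap L ℂ α ^ q ^ k) *
      algebraMap L ℂ (x k j) = 0) : False := by
  classical
  set ρ := ‖algebraMap L ℂ α‖ with hρ
  set n := Fintype.card ι with hn
  set D := Module.finrank ℚ L with hD
  have hD1 : D = (D - 1) + 1 := (Nat.sub_add_cancel Module.finrank_pos).symm
  have hβ := tendsto_pow_pow_nhdsNE hα0 hα1 hq
  obtain ⟨d, A, hd0, hA1, hdA, hval⟩ := exists_integral_values α
  let x' : ι → UltraC := fun j => Germ.coeRingHom (hyperfilter ℕ : Filter ℕ)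
    (fun k => algebraMap L ℂ (x k j))
  have hx' : x' ≠ 0 := by
    intro h
    have h1 : ∀ j, ∀ᶠ k in (hyperfilter ℕ : Filter ℕ), x k j = 0 := fun j => by
      have h2 : x' j = Germ.coeRingHom _ 0 := (congrFun h j).trans (map_zero _).symm
      filter_upwards [coeRingHom_eq_iff.mp h2] with k hk
      exact (map_eq_zero _).mp hk
    obtain ⟨k, hk⟩ := (eventually_all.mpr h1).exists
    exact hx0 k (funext hk)
  have hgx : ∑ j, seqHom hβ (toGerm L (g j)) * x' j = 0 := by
    simp only [seqHom_toGerm, x', ← map_mul, ← map_sum]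
    rw [← map_zero (Germ.coeRingHom _), coeRingHom_eq_iff]
    exact Eventually.of_forall fun k => by simpa using hrel k
  obtain ⟨M, hM1, hM⟩ : ∃ M : ℕ, 1 ≤ M ∧ A ^ D * ρ ^ M ≤ 1 / 2 := by
    have h1 : Tendsto (fun M : ℕ => A ^ D * ρ ^ M) atTop (𝓝 (A ^ D * 0)) :=
      (tendsto_pow_atTop_nhds_zero_of_lt_one hα0.le hα1).const_mul _
    rw [mul_zero] at h1
    obtain ⟨M, h2, h3⟩ := ((h1.eventually_le_const (by norm_num : (0 : ℝ) < 1 / 2)).and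
      (eventually_ge_atTop 1)).exists
    exact ⟨M, h3, h2⟩
  obtain ⟨κ, _, m, a, r, Δ, V, hm, hΔ0, haux⟩ := exists_auxiliary hg hβ hx' hgx hM1
  obtain ⟨c, ν, hc, hΔ⟩ := le_norm_ev Δ.2 fun h => hΔ0 (Subtype.ext h)
  obtain ⟨δ, hδ⟩ : ∃ δ : ℕ, (1 / 2 : ℝ) ^ δ * (C ^ (a * n)) ^ D ≤ 1 / 2 * ρ ^ ν := by
    have h1 : Tendsto (fun δ : ℕ => (1 / 2 : ℝ) ^ δ * (C ^ (a * n)) ^ D) atTop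
        (𝓝 (0 * (C ^ (a * n)) ^ D)) :=
      (tendsto_pow_atTop_nhds_zero_of_lt_one (by norm_num) (by norm_num)).mul_const _
    rw [zero_mul] at h1
    exact (h1.eventually_le_const (by positivity)).exists
  obtain ⟨p, W, hpδ, hW, hP0, hP⟩ := haux δ
  obtain ⟨e, c', he0, hc', hev⟩ := hval p δ hpδ
  obtain ⟨C₂, hC₂, hest⟩ := norm_auxiliary_le hc hΔ V W hW
  simp only [seqHom_toGerm, x', ← map_mul, ← map_sum, ← map_prod, ← map_pow] at hP0 hP
  rw [← map_zero (Germ.coeRingHom _), Ne, coeRingHom_eq_iff, ← Ultrafilter.eventually_not] at hP0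
  rw [coeRingHom_eq_iff] at hP
  have hlim : Tendsto (fun k : ℕ => |(e : ℝ)| * C₂ * (Fintype.card κ * c') ^ (D - 1) *
      (1 / 2 : ℝ) ^ q ^ k) atTop
      (𝓝 (|(e : ℝ)| * C₂ * (Fintype.card κ * c') ^ (D - 1) * 0)) :=
    ((tendsto_pow_atTop_nhds_zero_of_lt_one (by norm_num) (by norm_num)).comp
      (tendsto_pow_atTop_atTop_of_one_lt (by omega))).const_mul _
  rw [mul_zero] at hlim
  have hsmall := hlim.eventually_lt_const (zero_lt_one)
  have hest' := (hβ.mono_right nhdsWithin_le_nhds).eventually hest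
  obtain ⟨k, hk1, hk2, hk3, hk4⟩ := (hP0.and (hP.and
    ((hsmall.and hest').filter_mono Nat.hyperfilter_le_atTop))).exists
  refine absurd hk3 (not_lt.mpr ?_)
  set s := q ^ k with hs
  have hmon : ∀ (τ : L →+* ℂ) l, ‖τ (∏ j, x k j ^ m l j)‖ ≤ (C ^ (a * n)) ^ s := by
    intro τ l
    rw [map_prod, norm_prod]
    calc ∏ j, ‖τ (x k j ^ m l j)‖ ≤ ∏ _j : ι, (C ^ s) ^ a := by
          refine Finset.prod_le_prod (fun j _ => norm_nonneg _) fun j _ => ?_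
          rw [map_pow, norm_pow]
          exact (pow_le_pow_left₀ (norm_nonneg _) (hbd k j τ) _).trans
            (pow_le_pow_right₀ (one_le_pow₀ hC) (hm l j))
      _ = (C ^ (a * n)) ^ s := by
          rw [Finset.prod_const, Finset.card_univ, ← pow_mul, ← pow_mul, ← pow_mul]
          congr 1; ring
  set y : L := ∑ l, e * d ^ (δ * s) * (p l).eval (α ^ s) * ∏ j, x k j ^ m l j with hy
  set P : ℂ := ∑ l, (p l).aeval (algebraMap L ℂ α ^ s) *
    ∏ j, algebraMap L ℂ (x k j) ^ m l j with hPdef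
  have hyP : algebraMap L ℂ y = e * d ^ (δ * s) * P := by
    rw [hy, hPdef, map_sum, Finset.mul_sum]
    refine Finset.sum_congr rfl fun l _ => ?_
    rw [← map_pow, aeval_algebraMap_apply]
    simp [mul_assoc]
  have hk1' : P ≠ 0 := by
    simpa [hPdef, coe_polyConv, ev_coe] using hk1
  have hy0 : y ≠ 0 := by
    intro h
    rw [h, map_zero, eq_comm, mul_eq_zero, mul_eq_zero] at hyP
    rcases hyP with (h | h) | h
    · exact he0 (by exact_mod_cast h)
    · exact hd0 (by exact_mod_cast eq_zero_of_pow_eq_zero h)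
    · exact hk1' h
  have hyint : IsIntegral ℤ y := IsIntegral.sum _ fun l _ =>
    (hev l s).1.mul (IsIntegral.prod _ fun j _ => (hInt k j).pow _)
  have hyH : ∀ τ : L →+* ℂ, ‖τ y‖ ≤ Fintype.card κ * c' * (A ^ (δ * s) * (C ^ (a * n)) ^ s) := by
    intro τ
    rw [hy, map_sum]
    refine (norm_sum_le_of_le _ (n := fun _ => c' * A ^ (δ * s) * (C ^ (a * n)) ^ s)
      fun l _ => ?_).trans_eq ?_
    · rw [map_mul, norm_mul]
      exact mul_le_mul ((hev l s).2 τ) (hmon τ l) (norm_nonneg _) (by positivity)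
    · rw [Finset.sum_const, Finset.card_univ, nsmul_eq_mul]; ring
  have hliou := one_le_norm_mul_pow_of_isIntegral hyint hy0 hyH
  have hPle := hk4 P (fun l => algebraMap L ℂ (∏ j, x k j ^ m l j)) ((C ^ (a * n)) ^ s)
    (by positivity) (hmon _) (by simpa [hPdef, coe_polyConv, ev_coe] using hk2)
  have hynorm : ‖algebraMap L ℂ y‖ ≤ |(e : ℝ)| * A ^ (δ * s) * ‖P‖ := by
    rw [hyP, norm_mul, norm_mul, norm_pow, Complex.norm_intCast, Complex.norm_intCast]
    gcongr
  rw [norm_pow, ← hρ] at hPle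
  have hρs : 0 < (ρ ^ s) ^ ν := by positivity
  have hfin : (ρ ^ s) ^ ν * 1 ≤ (ρ ^ s) ^ ν *
      (|(e : ℝ)| * C₂ * (Fintype.card κ * c') ^ (D - 1) * (1 / 2) ^ s) := by
    calc (ρ ^ s) ^ ν * 1 ≤ (ρ ^ s) ^ ν * (|(e : ℝ)| * A ^ (δ * s) * ‖P‖ *
          (Fintype.card κ * c' * (A ^ (δ * s) * (C ^ (a * n)) ^ s)) ^ (D - 1)) := by
          gcongr
          exact hliou.trans (by gcongr)
      _ = |(e : ℝ)| * A ^ (δ * s) * (‖P‖ * (ρ ^ s) ^ ν) *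
          (Fintype.card κ * c' * (A ^ (δ * s) * (C ^ (a * n)) ^ s)) ^ (D - 1) := by ring
      _ ≤ |(e : ℝ)| * A ^ (δ * s) * (C₂ * (ρ ^ s) ^ (M * δ) * (C ^ (a * n)) ^ s) *
          (Fintype.card κ * c' * (A ^ (δ * s) * (C ^ (a * n)) ^ s)) ^ (D - 1) := by gcongr
      _ = |(e : ℝ)| * C₂ * (Fintype.card κ * c') ^ (D - 1) *
          ((ρ ^ s) ^ (M * δ) * (A ^ (δ * s) * (C ^ (a * n)) ^ s) ^ ((D - 1) + 1)) := by
          rw [mul_pow _ (A ^ (δ * s) * (C ^ (a * n)) ^ s), pow_succ]; ring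
      _ = |(e : ℝ)| * C₂ * (Fintype.card κ * c') ^ (D - 1) *
          ((A ^ D * ρ ^ M) ^ δ * (C ^ (a * n)) ^ D) ^ s := by
          rw [← hD1]; simp only [mul_pow, ← pow_mul]; ring_nf
      _ ≤ |(e : ℝ)| * C₂ * (Fintype.card κ * c') ^ (D - 1) *
          ((1 / 2) ^ δ * (C ^ (a * n)) ^ D) ^ s := by gcongr
      _ ≤ |(e : ℝ)| * C₂ * (Fintype.card κ * c') ^ (D - 1) * (1 / 2 * ρ ^ ν) ^ s := by gcongr
      _ = _ := by rw [mul_pow _ (ρ ^ ν)]; simp only [← pow_mul]; rw [mul_comm ν]; ring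
  exact le_of_mul_le_mul_left hfin hρs

end

end Mahler

namespace Mahler
open Filter Topology Polynomial Matrix

section

variable {L : Type*} [Field L] [NumberField L] [Algebra L ℂ]

/-- The values at a regular point of a solution of a Mahler system that is independent over the
algebraic functions are linearly independent over the number field. -/
theorem eq_zero_of_value_relation {ι : Type} [Fintype ι] [DecidableEq ι]
    {g : ι → convSubring L} (hg : LinearIndependent MGerm.algSubfield fun j => toGerm L (g j))
    {q : ℕ} (hq : 2 ≤ q) {α : L} (hα0 : 0 < ‖algebraMap L ℂ α‖) (hα1 : ‖algebraMap L ℂ α‖ < 1)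
    {b : L[X]} {B : Matrix ι ι L[X]} (hb : ∀ k, b.eval (α ^ q ^ k) ≠ 0)
    (hB : ∀ k, B.det.eval (α ^ q ^ k) ≠ 0)
    (hsys : ∀ k j, algebraMap L ℂ (b.eval (α ^ q ^ k)) *
        ev (g j : PowerSeries L) (algebraMap L ℂ α ^ q ^ (k + 1)) =
      ∑ i, algebraMap L ℂ ((B j i).eval (α ^ q ^ k)) *
        ev (g i : PowerSeries L) (algebraMap L ℂ α ^ q ^ k))
    {c : ι → L} (hc : ∑ j, ev (g j : PowerSeries L) (algebraMap L ℂ α) * algebraMap L ℂ (c j) = 0) :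
    c = 0 := by
  classical
  by_contra hc0
  obtain ⟨d, A, hd0, hA1, -, hval⟩ := exists_integral_values α
  obtain ⟨e, c₁, he0, hc₁, hev⟩ := hval (fun ij : ι × ι => B.adjugate ij.1 ij.2)
    (∑ ij : ι × ι, (B.adjugate ij.1 ij.2).natDegree) fun ij =>
      Finset.single_le_sum (f := fun ij : ι × ι => (B.adjugate ij.1 ij.2).natDegree)
        (fun _ _ => Nat.zero_le _) (Finset.mem_univ ij)
  set δ := ∑ ij : ι × ι, (B.adjugate ij.1 ij.2).natDegree with hδ
  obtain ⟨e₀, he₀, hInt₀⟩ := exists_integral_multiples ℤ ℚ (Finset.univ.image c)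
  let Bk : ℕ → Matrix ι ι L := fun k => B.map (eval (α ^ q ^ k))
  let N : ℕ → Matrix ι ι L := fun k => ((e : L) * d ^ (δ * q ^ k)) • (Bk k).adjugate
  have hadj : ∀ k, (Bk k).adjugate = B.adjugate.map (eval (α ^ q ^ k)) := fun k =>
    (RingHom.map_adjugate (evalRingHom (α ^ q ^ k)) B).symm
  have hdet : ∀ k, (Bk k).det ≠ 0 := fun k => by
    have : (Bk k).det = B.det.eval (α ^ q ^ k) := (RingHom.map_det (evalRingHom (α ^ q ^ k)) B).symm
    rw [this]
    exact hB k
  have hN : ∀ k i j, N k i j = e * d ^ (δ * q ^ k) * (B.adjugate i j).eval (α ^ q ^ k) :=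
    fun k i j => by simp [N, hadj]
  let x : ℕ → ι → L := fun k => Nat.rec (fun j => e₀ * c j) (fun k y => y ᵥ* N k) k
  have hx0 : x 0 = fun j => e₀ * c j := rfl
  have hxs : ∀ k, x (k + 1) = x k ᵥ* N k := fun k => rfl
  have hed : ∀ k, (e : L) * d ^ (δ * q ^ k) ≠ 0 := fun k =>
    mul_ne_zero (by exact_mod_cast he0) (pow_ne_zero _ (by exact_mod_cast hd0))
  have hxB : ∀ k, x (k + 1) ᵥ* Bk k = (e * d ^ (δ * q ^ k) * (Bk k).det) • x k := fun k => by
    have h1 : N k * Bk k = (e * d ^ (δ * q ^ k) * (Bk k).det) • (1 : Matrix ι ι L) := by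
      rw [Matrix.smul_mul, adjugate_mul, smul_smul]
    rw [hxs, vecMul_vecMul, h1, vecMul_smul, vecMul_one]
  set n := Fintype.card ι with hn
  set C : ℝ := max 1 (∑ j, ∑ τ : L →+* ℂ, ‖τ (x 0 j)‖) * (max 1 (n * c₁) * A ^ δ) with hC
  have hC2 : 1 ≤ max 1 (n * c₁) * A ^ δ :=
    one_le_mul_of_one_le_of_one_le (le_max_left _ _) (one_le_pow₀ hA1)
  have hC1 : 1 ≤ C := one_le_mul_of_one_le_of_one_le (le_max_left _ _) hC2
  refine false_of_integral_relations hg hq hα0 hα1 (x := x) ?_ hC1 ?_ ?_ ?_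
  · intro k
    induction k with
    | zero =>
      intro j
      change IsIntegral ℤ (e₀ * c j)
      rw [← zsmul_eq_mul]
      exact hInt₀ _ (Finset.mem_image_of_mem _ (Finset.mem_univ j))
    | succ k ih =>
      intro j
      rw [hxs, vecMul, dotProduct]
      refine IsIntegral.sum _ fun i _ => (ih i).mul ?_
      rw [hN]
      exact (hev (i, j) (q ^ k)).1
  · intro k
    induction k with
    | zero =>
      intro j τ
      rw [pow_zero, pow_one]
      calc ‖τ (x 0 j)‖ ≤ ∑ τ : L →+* ℂ, ‖τ (x 0 j)‖ :=
            Finset.single_le_sum (f := fun τ : L →+* ℂ => ‖τ (x 0 j)‖)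
              (fun _ _ => norm_nonneg _) (Finset.mem_univ τ)
        _ ≤ ∑ j, ∑ τ : L →+* ℂ, ‖τ (x 0 j)‖ :=
            Finset.single_le_sum (f := fun j => ∑ τ : L →+* ℂ, ‖τ (x 0 j)‖)
              (fun _ _ => by positivity) (Finset.mem_univ j)
        _ ≤ _ := le_max_right _ _
        _ ≤ C := le_mul_of_one_le_right (by positivity) hC2
    | succ k ih =>
      intro j τ
      rw [hxs, vecMul, dotProduct, map_sum]
      calc ‖∑ i, τ (x k i * N k i j)‖ ≤ ∑ _i : ι, C ^ q ^ k * (c₁ * A ^ (δ * q ^ k)) := by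
            refine norm_sum_le_of_le _ fun i _ => ?_
            rw [map_mul, norm_mul, hN]
            exact mul_le_mul (ih i τ) ((hev (i, j) (q ^ k)).2 τ) (norm_nonneg _) (by positivity)
        _ = C ^ q ^ k * (n * c₁ * (A ^ δ) ^ q ^ k) := by
            rw [Finset.sum_const, Finset.card_univ, nsmul_eq_mul, pow_mul]; ring
        _ ≤ C ^ q ^ k * C ^ q ^ k := by
            refine mul_le_mul_of_nonneg_left ?_ (by positivity)
            calc n * c₁ * (A ^ δ) ^ q ^ k ≤ max 1 (n * c₁) ^ q ^ k * (A ^ δ) ^ q ^ k := by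
                  refine mul_le_mul_of_nonneg_right ((le_max_right 1 _).trans ?_) (by positivity)
                  exact le_self_pow₀ (le_max_left _ _) (pow_ne_zero _ (by omega))
              _ = (max 1 (n * c₁) * A ^ δ) ^ q ^ k := (mul_pow _ _ _).symm
              _ ≤ C ^ q ^ k := pow_le_pow_left₀ (by positivity)
                  (le_mul_of_one_le_left (by positivity) (le_max_left _ _)) _
        _ = C ^ (q ^ k * 2) := by rw [pow_mul, sq]
        _ ≤ C ^ q ^ (k + 1) := pow_le_pow_right₀ hC1 (by rw [pow_succ]; gcongr)
  · intro k
    induction k with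
    | zero =>
      intro h
      refine hc0 (funext fun j => ?_)
      have := congrFun h j
      rw [hx0] at this
      exact (mul_eq_zero.mp this).resolve_left (by exact_mod_cast he₀)
    | succ k ih =>
      intro h
      apply ih
      have h1 := hxB k
      rw [h, zero_vecMul, eq_comm] at h1
      exact (smul_eq_zero.mp h1).resolve_left (mul_ne_zero (hed k) (hdet k))
  · intro k
    induction k with
    | zero =>
      have h1 : ∀ j, ev (g j : PowerSeries L) (algebraMap L ℂ α ^ q ^ 0) *
          algebraMap L ℂ (x 0 j) = e₀ * (ev (g j : PowerSeries L) (algebraMap L ℂ α) *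
            algebraMap L ℂ (c j)) := fun j => by
        rw [hx0, pow_zero, pow_one, map_mul, map_intCast]; ring
      simp_rw [h1]
      rw [← Finset.mul_sum, hc, mul_zero]
    | succ k ih =>
      have hb' : algebraMap L ℂ (b.eval (α ^ q ^ k)) ≠ 0 := (_root_.map_ne_zero _).mpr (hb k)
      refine (mul_eq_zero.mp ?_).resolve_left hb'
      set G : ι → ℂ := fun i => ev (g i : PowerSeries L) (algebraMap L ℂ α ^ q ^ k) with hG
      set ψ := algebraMap L ℂ with hψ
      have h1 : ∀ j, ψ (b.eval (α ^ q ^ k)) *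
          (ev (g j : PowerSeries L) (ψ α ^ q ^ (k + 1)) * ψ (x (k + 1) j)) =
          (ψ ∘ x (k + 1)) j * ((Bk k).map ψ *ᵥ G) j := fun j => by
        rw [← mul_assoc, hsys, mul_comm]
        rfl
      rw [Finset.mul_sum]
      simp_rw [h1]
      change (ψ ∘ x (k + 1)) ⬝ᵥ ((Bk k).map ψ *ᵥ G) = 0
      rw [dotProduct_mulVec]
      have h2 : (ψ ∘ x (k + 1)) ᵥ* (Bk k).map ψ =
          ψ (e * d ^ (δ * q ^ k) * (Bk k).det) • (ψ ∘ x k) := by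
        funext j
        have h4 := congrArg ψ (congrFun (hxB k) j)
        rw [RingHom.map_vecMul] at h4
        rw [h4, Pi.smul_apply, Pi.smul_apply, smul_eq_mul, smul_eq_mul, map_mul]
        rfl
      rw [h2, smul_dotProduct, dotProduct_comm]
      have : G ⬝ᵥ (ψ ∘ x k) = 0 := ih
      rw [this, smul_zero]

end

end Mahler

namespace Mahler
open Polynomial

section Saturation

variable {R M : Type*} [CommRing R] [IsDomain R] [AddCommGroup M] [Module R M]

/-- The elements having a nonzero multiple in a given submodule. -/
def saturation (S : Submodule R M) : Submodule R M where
  carrier := {y | ∃ a : R, a ≠ 0 ∧ a • y ∈ S}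
  add_mem' := by
    rintro x y ⟨a, ha, hx⟩ ⟨b, hb, hy⟩
    refine ⟨a * b, mul_ne_zero ha hb, ?_⟩
    rw [smul_add]
    refine S.add_mem ?_ ?_
    · rw [mul_comm, mul_smul]; exact S.smul_mem _ hx
    · rw [mul_smul]; exact S.smul_mem _ hy
  zero_mem' := ⟨1, one_ne_zero, by rw [smul_zero]; exact S.zero_mem⟩
  smul_mem' := by
    rintro c x ⟨a, ha, hx⟩
    exact ⟨a, ha, by rw [smul_comm]; exact S.smul_mem _ hx⟩

theorem le_saturation (S : Submodule R M) : S ≤ saturation S := fun y hy =>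
  ⟨1, one_ne_zero, by rwa [one_smul]⟩

theorem mem_saturation_of_smul {S : Submodule R M} {y : M} {c : R} (hc : c ≠ 0)
    (h : c • y ∈ saturation S) : y ∈ saturation S := by
  obtain ⟨a, ha, h⟩ := h
  exact ⟨a * c, mul_ne_zero ha hc, by rwa [mul_smul]⟩

theorem exists_common_multiple {S : Submodule R M} {ι : Type*} [Fintype ι] {y : ι → M}
    (h : ∀ i, y i ∈ saturation S) : ∃ a : R, a ≠ 0 ∧ ∀ i, a • y i ∈ S := by
  classical
  choose a ha hy using h
  refine ⟨∏ i, a i, Finset.prod_ne_zero_iff.mpr fun i _ => ha i, fun i => ?_⟩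
  rw [← Finset.prod_erase_mul _ _ (Finset.mem_univ i), mul_smul]
  exact S.smul_mem _ (hy i)

theorem exists_linearIndepOn_saturation (w : ℕ → M) (h0 : ∀ r : R, r • w 0 = 0 → r = 0) (N : ℕ) :
    ∃ s : Finset ℕ, 0 ∈ s ∧ LinearIndepOn R w s ∧ (∀ i ∈ s, i ≤ N) ∧
      ∀ i ≤ N, w i ∈ saturation (Submodule.span R (w '' s)) := by
  classical
  induction N with
  | zero =>
    refine ⟨{0}, by simp, ?_, by simp, fun i hi => ?_⟩
    · have := LinearIndepOn.insert' (linearIndepOn_empty R w) (i := 0)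
        (fun r hr => h0 r (by simpa using hr))
      simpa using this
    · obtain rfl : i = 0 := by omega
      exact le_saturation _ (Submodule.subset_span (by simp))
  | succ N ih =>
    obtain ⟨s, hs0, hs, hsN, hsat⟩ := ih
    by_cases h : w (N + 1) ∈ saturation (Submodule.span R (w '' s))
    · refine ⟨s, hs0, hs, fun i hi => (hsN i hi).trans (Nat.le_succ N), fun i hi => ?_⟩
      rcases Nat.lt_or_eq_of_le hi with h1 | rfl
      · exact hsat i (by omega)
      · exact h
    · refine ⟨insert (N + 1) s, by simp [hs0], ?_, ?_, fun i hi => ?_⟩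
      · rw [Finset.coe_insert]
        refine hs.insert' fun r hr => ?_
        by_contra hr0
        exact h ⟨r, hr0, hr⟩
      · intro i hi
        rcases Finset.mem_insert.mp hi with rfl | hi
        · exact le_rfl
        · exact (hsN i hi).trans (Nat.le_succ N)
      · rcases Nat.lt_or_eq_of_le hi with h1 | rfl
        · obtain ⟨a, ha, h2⟩ := hsat i (by omega)
          refine ⟨a, ha, Submodule.span_mono (Set.image_mono ?_) h2⟩
          simp
        · exact le_saturation _ (Submodule.subset_span ⟨N + 1, by simp, rfl⟩)

end Saturation

section Formal

variable {L : Type*} [Field L]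

theorem poly_smul (p : L[X]) (f : PowerSeries L) : p • f = (p : PowerSeries L) * f := by
  rw [Algebra.smul_def, PowerSeries.algebraMap_apply']
  simp

/-- The generators `1, f, σ f, σ² f, …` of the Mahler module of `f`. -/
def mahlerGen (E : PowerSeries L → PowerSeries L) (f : PowerSeries L) : ℕ → PowerSeries L
  | 0 => 1
  | i + 1 => E^[i] f

theorem exists_formal_system {E : PowerSeries L → PowerSeries L} (hE : E 1 = 1)
    {f : PowerSeries L} {m : ℕ} {p : ℕ → L[X]} (hp : ∃ i ≤ m, p i ≠ 0)
    (hrel : ∑ i ∈ Finset.range (m + 1), (p i : PowerSeries L) * E^[i] f = 0) :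
    ∃ s : Finset ℕ, 0 ∈ s ∧
      (∀ u : s → L[X], ∑ j, (u j : PowerSeries L) * mahlerGen E f j = 0 → u = 0) ∧
      (∃ (b : L[X]) (B : Matrix s s L[X]), b ≠ 0 ∧ ∀ i : s,
        (b : PowerSeries L) * E (mahlerGen E f i) =
          ∑ j, (B i j : PowerSeries L) * mahlerGen E f j) ∧
      ∃ (d : L[X]) (n : s → L[X]), d ≠ 0 ∧
        (d : PowerSeries L) * f = ∑ j, (n j : PowerSeries L) * mahlerGen E f j := by
  classical
  have hex : ∃ m, (∃ i ≤ m, p i ≠ 0) ∧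
      ∑ i ∈ Finset.range (m + 1), (p i : PowerSeries L) * E^[i] f = 0 := ⟨m, hp, hrel⟩
  obtain ⟨m, hm, hmin⟩ : ∃ m, ((∃ i ≤ m, p i ≠ 0) ∧
      ∑ i ∈ Finset.range (m + 1), (p i : PowerSeries L) * E^[i] f = 0) ∧ ∀ m' < m,
      ¬((∃ i ≤ m', p i ≠ 0) ∧
      ∑ i ∈ Finset.range (m' + 1), (p i : PowerSeries L) * E^[i] f = 0) :=
    ⟨Nat.find hex, Nat.find_spec hex, fun m' h => Nat.find_min hex h⟩
  obtain ⟨⟨i₀, hi₀, hpi₀⟩, hrel⟩ := hm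
  have hpm : p m ≠ 0 := by
    intro h
    have hi₀m : i₀ ≠ m := fun h' => hpi₀ (h' ▸ h)
    refine hmin (m - 1) (by omega) ⟨⟨i₀, by omega, hpi₀⟩, ?_⟩
    rw [Finset.sum_range_succ, h, Polynomial.coe_zero, zero_mul, add_zero] at hrel
    rwa [show m - 1 + 1 = m by omega]
  set w := mahlerGen E f with hw
  obtain ⟨s, hs0, hs, hsm, hsat⟩ := exists_linearIndepOn_saturation (R := L[X]) w (fun r hr => by
    change r • (1 : PowerSeries L) = 0 at hr
    rw [poly_smul, mul_one] at hr
    exact Polynomial.coe_eq_zero_iff.mp hr) m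
  have hsat' : ∀ i ≤ m + 1, w i ∈ saturation (Submodule.span L[X] (w '' s)) := by
    intro i hi
    rcases Nat.lt_or_eq_of_le hi with h1 | rfl
    · exact hsat i (by omega)
    · refine mem_saturation_of_smul hpm ?_
      rw [Finset.sum_range_succ] at hrel
      have h1 : p m • w (m + 1) = - ∑ i ∈ Finset.range m, p i • w (i + 1) := by
        simp_rw [poly_smul]
        exact eq_neg_of_add_eq_zero_right hrel
      rw [h1]
      exact Submodule.neg_mem _ (Submodule.sum_mem _ fun i hi =>
        Submodule.smul_mem _ _ (hsat _ (Finset.mem_range.mp hi)))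
  have hrange : (w '' (s : Set ℕ)) = Set.range fun j : s => w j := by
    rw [Set.image_eq_range]; rfl
  have hspan : ∀ y ∈ Submodule.span L[X] (w '' (s : Set ℕ)),
      ∃ c : s → L[X], ∑ j, (c j : PowerSeries L) * w j = y := by
    intro y hy
    rw [hrange] at hy
    obtain ⟨c, hc⟩ := (Submodule.mem_span_range_iff_exists_fun L[X]).mp hy
    exact ⟨c, by simpa only [poly_smul] using hc⟩
  refine ⟨s, hs0, fun u hu => ?_, ?_, ?_⟩
  · have h1 : LinearIndependent L[X] (fun j : s => w j) := hs
    refine funext (Fintype.linearIndependent_iff.mp h1 u ?_)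
    simpa only [poly_smul] using hu
  · obtain ⟨b, hb, hbs⟩ := exists_common_multiple (S := Submodule.span L[X] (w '' s))
      (y := fun i : s => E (w i)) (fun i => by
        obtain ⟨i, hi⟩ := i
        change E (w i) ∈ _
        rcases i with _ | i
        · have : E (w 0) = w 0 := hE
          rw [this]
          exact hsat' 0 (Nat.zero_le _)
        · have : E (w (i + 1)) = w (i + 2) := (Function.iterate_succ_apply' E i f).symm
          rw [this]
          have := hsm _ hi
          exact hsat' _ (by omega))
    choose B hB using fun i => hspan _ (hbs i)
    exact ⟨b, Matrix.of B, hb, fun i => by rw [← poly_smul]; exact (hB i).symm⟩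
  · obtain ⟨d, hd, hds⟩ := hsat' 1 (by omega)
    obtain ⟨n, hn⟩ := hspan _ hds
    exact ⟨d, n, hd, by rw [hn, poly_smul]; rfl⟩

end Formal

end Mahler

namespace Mahler
open Polynomial

section CoeffMap

variable {R S : Type*} [Field R] [Field S] [Algebra R S]

/-- A linear form applied to the coefficients of a polynomial. -/
def coeffMap (ℓ : S →ₗ[R] R) (c : S[X]) : R[X] :=
  ∑ i ∈ Finset.range (c.natDegree + 1), monomial i (ℓ (c.coeff i))

theorem coeff_coeffMap (ℓ : S →ₗ[R] R) (c : S[X]) (n : ℕ) :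
    (coeffMap ℓ c).coeff n = ℓ (c.coeff n) := by
  simp only [coeffMap, finsetSum_coeff, coeff_monomial, Finset.sum_ite_eq', Finset.mem_range]
  split_ifs with h
  · rfl
  · rw [coeff_eq_zero_of_natDegree_lt (by omega), map_zero]

theorem coeff_coeffMap_mul (ℓ : S →ₗ[R] R) (c : S[X]) (g : PowerSeries R) (n : ℕ) :
    PowerSeries.coeff n ((coeffMap ℓ c : PowerSeries R) * g) =
      ℓ (PowerSeries.coeff n ((c : PowerSeries S) * g.map (algebraMap R S))) := by
  rw [PowerSeries.coeff_mul, PowerSeries.coeff_mul, map_sum]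
  refine Finset.sum_congr rfl fun x _ => ?_
  rw [coeff_coe, coeff_coe, coeff_coeffMap, PowerSeries.coeff_map, mul_comm (c.coeff _),
    ← Algebra.smul_def, map_smul, smul_eq_mul, mul_comm]

theorem eval_coeffMap (ℓ : S →ₗ[R] R) (c : S[X]) (a : R) :
    (coeffMap ℓ c).eval a = ℓ (c.eval (algebraMap R S a)) := by
  rw [coeffMap, eval_finsetSum, eval_eq_sum_range, map_sum]
  refine Finset.sum_congr rfl fun i _ => ?_
  rw [eval_monomial, ← map_pow, mul_comm (c.coeff i), ← Algebra.smul_def, map_smul, smul_eq_mul,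
    mul_comm]

theorem sum_coeffMap_mul {ι : Type*} [Fintype ι] (ℓ : S →ₗ[R] R) {f : PowerSeries R}
    {g : ι → PowerSeries R} {d : S[X]} {n : ι → S[X]}
    (h : (d : PowerSeries S) * f.map (algebraMap R S) =
      ∑ j, (n j : PowerSeries S) * (g j).map (algebraMap R S)) :
    (coeffMap ℓ d : PowerSeries R) * f = ∑ j, (coeffMap ℓ (n j) : PowerSeries R) * g j := by
  ext k
  rw [map_sum, coeff_coeffMap_mul, h, map_sum, map_sum]
  exact Finset.sum_congr rfl fun j _ => (coeff_coeffMap_mul ℓ (n j) (g j) k).symm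

/-- Linear independence of power series over polynomials is stable under extension of scalars. -/
theorem eq_zero_of_sum_mul_map {ι : Type*} [Fintype ι] {g : ι → PowerSeries R}
    (hg : ∀ u : ι → R[X], ∑ j, (u j : PowerSeries R) * g j = 0 → u = 0) {u : ι → S[X]}
    (hu : ∑ j, (u j : PowerSeries S) * (g j).map (algebraMap R S) = 0) : u = 0 := by
  have h : ∀ ℓ : S →ₗ[R] R, (fun j => coeffMap ℓ (u j)) = 0 := fun ℓ => hg _ <| by
    have := sum_coeffMap_mul (f := 0) (d := 0) (g := g) (n := u) ℓ (by rw [hu]; simp)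
    rw [← this, mul_zero]
  ext j n
  rw [Pi.zero_apply, coeff_zero, ← Module.forall_dual_apply_eq_zero_iff R]
  intro ℓ
  rw [← coeff_coeffMap, congrFun (h ℓ) j, Pi.zero_apply, coeff_zero]

end CoeffMap

section Sections

variable {R : Type*} [Field R] {q : ℕ}

/-- The polynomial formed by the coefficients whose index is `r` modulo `q`. -/
def polySection (q r : ℕ) (c : R[X]) : R[X] :=
  ∑ i ∈ Finset.range (c.natDegree + 1), monomial i (c.coeff (q * i + r))

theorem coeff_polySection (hq : q ≠ 0) (r : ℕ) (c : R[X]) (n : ℕ) :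
    (polySection q r c).coeff n = c.coeff (q * n + r) := by
  simp only [polySection, finsetSum_coeff, coeff_monomial, Finset.sum_ite_eq', Finset.mem_range]
  split_ifs with h
  · rfl
  · rw [coeff_eq_zero_of_natDegree_lt]
    have := Nat.le_mul_of_pos_left n (Nat.pos_of_ne_zero hq)
    omega

theorem coeff_polySection_mul (hq : q ≠ 0) {r : ℕ} (hr : r < q) (c : R[X]) (g : PowerSeries R)
    (n : ℕ) : PowerSeries.coeff n ((polySection q r c : PowerSeries R) * g) =
      PowerSeries.coeff (q * n + r) ((c : PowerSeries R) * PowerSeries.expand q hq g) := by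
  rw [PowerSeries.coeff_mul, PowerSeries.coeff_mul]
  refine Finset.sum_of_injOn (fun x => (q * x.1 + r, q * x.2)) ?_ ?_ ?_ ?_
  · rintro ⟨a, b⟩ - ⟨a', b'⟩ - h
    simp only [Prod.mk.injEq, Nat.add_right_cancel_iff, Nat.mul_right_inj hq] at h
    rw [h.1, h.2]
  · rintro ⟨a, b⟩ h
    simp only [Finset.mem_coe, Finset.HasAntidiagonal.mem_antidiagonal] at h ⊢
    rw [← h]; ring
  · rintro ⟨a, b⟩ h hn
    rw [Finset.HasAntidiagonal.mem_antidiagonal] at h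
    by_cases hb : q ∣ b
    · exfalso
      obtain ⟨b, rfl⟩ := hb
      refine hn ⟨(n - b, b), ?_, ?_⟩
      all_goals
        have hle : b ≤ n := by
          by_contra hlt
          have : q * (n + 1) ≤ q * b := Nat.mul_le_mul_left _ (by omega)
          rw [mul_add] at this
          simp only at h
          omega
      · simpa using Nat.sub_add_cancel hle
      · have : q * (n - b) + q * b = q * n := by rw [← mul_add, Nat.sub_add_cancel hle]
        simp only [Prod.mk.injEq, and_true]
        simp only at h
        omega
    · rw [PowerSeries.coeff_expand_of_not_dvd q hq g hb, mul_zero]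
  · rintro ⟨a, b⟩ _
    rw [coeff_coe, coeff_coe, coeff_polySection hq, PowerSeries.coeff_expand_mul]

theorem eq_zero_of_sum_mul_expand {ι : Type*} [Fintype ι] (hq : q ≠ 0) {g : ι → PowerSeries R}
    (hg : ∀ u : ι → R[X], ∑ j, (u j : PowerSeries R) * g j = 0 → u = 0) {u : ι → R[X]}
    (hu : ∑ j, (u j : PowerSeries R) * PowerSeries.expand q hq (g j) = 0) : u = 0 := by
  have h : ∀ r < q, (fun j => polySection q r (u j)) = 0 := fun r hr => hg _ <| by
    ext n
    rw [map_sum, Finset.sum_congr rfl fun j _ => coeff_polySection_mul hq hr (u j) (g j) n,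
      ← map_sum, hu, map_zero, map_zero]
  ext j n
  have := congrArg (fun p => coeff p (n / q)) (congrFun (h (n % q) (Nat.mod_lt _ (by omega))) j)
  simpa only [coeff_polySection hq, Nat.div_add_mod, Pi.zero_apply, coeff_zero] using this

theorem det_ne_zero_of_expand_system {ι : Type*} [Fintype ι] [DecidableEq ι] (hq : q ≠ 0)
    {g : ι → PowerSeries R}
    (hg : ∀ u : ι → R[X], ∑ j, (u j : PowerSeries R) * g j = 0 → u = 0) {b : R[X]}
    (hb : b ≠ 0) {B : Matrix ι ι R[X]}
    (hsys : ∀ i, (b : PowerSeries R) * PowerSeries.expand q hq (g i) =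
      ∑ j, (B i j : PowerSeries R) * g j) : B.det ≠ 0 := by
  intro h0
  obtain ⟨u, hu, huB⟩ := Matrix.exists_vecMul_eq_zero_iff.mpr h0
  refine hu (eq_zero_of_sum_mul_expand hq hg ?_)
  have hb' : (b : PowerSeries R) ≠ 0 := by simpa using hb
  refine (mul_eq_zero.mp (?_ : (b : PowerSeries R) * _ = 0)).resolve_left hb'
  calc (b : PowerSeries R) * ∑ j, (u j : PowerSeries R) * PowerSeries.expand q hq (g j)
      = ∑ j, (u j : PowerSeries R) * ∑ i, (B j i : PowerSeries R) * g i := by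
        rw [Finset.mul_sum]
        exact Finset.sum_congr rfl fun j _ => by rw [← hsys]; ring
    _ = ∑ i, ((Matrix.vecMul u B i : R[X]) : PowerSeries R) * g i := by
        simp_rw [Finset.mul_sum, Matrix.vecMul, dotProduct]
        rw [Finset.sum_comm]
        refine Finset.sum_congr rfl fun i _ => ?_
        rw [← Polynomial.coeToPowerSeries.ringHom_apply, map_sum, Finset.sum_mul]
        exact Finset.sum_congr rfl fun j _ => by simp [mul_assoc]
    _ = 0 := by simp [huB]

end Sections

end Mahler

namespace Mahler
open Filter Topology Polynomial

section

variable {L : Type*} [Field L] [Algebra L ℂ] {q : ℕ}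

theorem hasSum_expand (hq : q ≠ 0) {g : PowerSeries L} {z : ℂ} (hg : SummableAt g (z ^ q)) :
    HasSum (fun n => algebraMap L ℂ (PowerSeries.coeff n (PowerSeries.expand q hq g)) * z ^ n)
      (ev g (z ^ q)) := by
  refine (Function.Injective.hasSum_iff (g := fun n => q * n)
    (fun a b h => Nat.eq_of_mul_eq_mul_left (Nat.pos_of_ne_zero hq) h) fun n hn => ?_).mp ?_
  · rw [PowerSeries.coeff_expand_of_not_dvd, map_zero, zero_mul]
    rintro ⟨m, rfl⟩
    exact hn ⟨m, rfl⟩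
  · simpa only [Function.comp_def, PowerSeries.coeff_expand_mul, pow_mul, ev] using hg.hasSum

theorem tendsto_pow_nhds_zero (hq : q ≠ 0) : Tendsto (fun z : ℂ => z ^ q) (𝓝 0) (𝓝 0) := by
  simpa [hq] using (continuous_pow q).tendsto (0 : ℂ)

theorem Conv.expand (hq : q ≠ 0) {g : PowerSeries L} (hg : Conv g) :
    Conv (PowerSeries.expand q hq g) :=
  ((tendsto_pow_nhds_zero hq).eventually hg).mono fun _ hz => (hasSum_expand hq hz).summable

theorem eventually_ev_expand (hq : q ≠ 0) {g : PowerSeries L} (hg : Conv g) :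
    ∀ᶠ z in 𝓝 (0 : ℂ), ev (PowerSeries.expand q hq g) z = ev g (z ^ q) :=
  ((tendsto_pow_nhds_zero hq).eventually hg).mono fun _ hz => (hasSum_expand hq hz).tsum_eq

theorem sigma_toGerm (hq : q ≠ 0) (g : convSubring L) :
    MGerm.sigma hq (toGerm L g) = toGerm L ⟨PowerSeries.expand q hq g, Conv.expand hq g.2⟩ := by
  rw [toGerm_apply, toGerm_apply, MGerm.sigma_mk, MGerm.mk_eq_mk]
  exact ((eventually_ev_expand hq g.2).filter_mono nhdsWithin_le_nhds).mono fun z hz => hz.symm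

theorem Conv.mapC {g : PowerSeries L} (hg : Conv g) : Conv (g.map (algebraMap L ℂ)) := hg

theorem toGerm_map (g : convSubring L) :
    toGerm ℂ ⟨(g : PowerSeries L).map (algebraMap L ℂ), Conv.mapC g.2⟩ = toGerm L g := by
  rw [toGerm_apply, toGerm_apply, MGerm.mk_eq_mk]
  exact Eventually.of_forall fun z => rfl

theorem linearIndependent_toGerm {ι : Type*} [Fintype ι] {g : ι → convSubring L}
    (hg : ∀ u : ι → L[X], ∑ j, (u j : PowerSeries L) * (g j : PowerSeries L) = 0 → u = 0) :
    LinearIndependent ℂ[X] fun j => toGerm L (g j) := by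
  rw [Fintype.linearIndependent_iff]
  intro u hu
  refine congrFun (eq_zero_of_sum_mul_map hg (S := ℂ) (u := u) ?_)
  have hu' : toGerm ℂ (∑ j, polyConv ℂ (u j) *
      ⟨(g j : PowerSeries L).map (algebraMap L ℂ), Conv.mapC (g j).2⟩) = 0 := by
    rw [← hu, map_sum]
    refine Finset.sum_congr rfl fun j _ => ?_
    rw [map_mul, toGerm_map, toGerm_polyConv, Algebra.smul_def]
    simp
  rw [map_eq_zero_iff _ toGerm_injective] at hu'
  simpa [coe_polyConv] using congrArg Subtype.val hu'

theorem linearIndependent_algSubfield_toGerm {ι : Type*} [Fintype ι] [DecidableEq ι]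
    {g : ι → convSubring L}
    (hg : ∀ u : ι → L[X], ∑ j, (u j : PowerSeries L) * (g j : PowerSeries L) = 0 → u = 0)
    (hq : 2 ≤ q) (hq0 : q ≠ 0) {b : L[X]} (hb : b ≠ 0) {B : Matrix ι ι L[X]}
    (hsys : ∀ i, (b : PowerSeries L) * PowerSeries.expand q hq0 (g i : PowerSeries L) =
      ∑ j, (B i j : PowerSeries L) * (g j : PowerSeries L)) :
    LinearIndependent MGerm.algSubfield fun j => toGerm L (g j) := by
  refine MGerm.linearIndependent_algSubfield hq hq0 (linearIndependent_toGerm hg)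
    (b := b.map (algebraMap L ℂ)) ((Polynomial.map_ne_zero_iff (algebraMap L ℂ).injective).mpr hb)
    (B' := B.map (Polynomial.map (algebraMap L ℂ))) ?_ fun i => ?_
  · have h := RingHom.map_det (mapRingHom (algebraMap L ℂ)) B
    have h2 : (mapRingHom (algebraMap L ℂ)).mapMatrix B =
      B.map (Polynomial.map (algebraMap L ℂ)) := rfl
    rw [← h2, ← h, coe_mapRingHom]
    exact (Polynomial.map_ne_zero_iff (algebraMap L ℂ).injective).mpr
      (det_ne_zero_of_expand_system hq0 hg hb hsys)
  · simp only [Matrix.map_apply, ← toGerm_polyConv, sigma_toGerm, ← map_mul, ← map_sum]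
    congr 1
    refine Subtype.ext ?_
    simpa [coe_polyConv] using hsys i

end

end Mahler

namespace Mahler
open Filter Topology Polynomial

section

variable {L : Type*} [Field L] {q : ℕ}

theorem expand_coe (hq : q ≠ 0) (p : L[X]) :
    PowerSeries.expand q hq (p : PowerSeries L) = (Polynomial.expand L q p : L[X]) := by
  ext n
  rw [PowerSeries.coeff_expand, coeff_coe, coeff_coe,
    Polynomial.coeff_expand (Nat.pos_of_ne_zero hq)]

theorem det_mul_eq_sum_expand {ι : Type*} [Fintype ι] [DecidableEq ι] (hq : q ≠ 0)
    {g : ι → PowerSeries L} {b : L[X]} {B : Matrix ι ι L[X]}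
    (hsys : ∀ i, (b : PowerSeries L) * PowerSeries.expand q hq (g i) =
      ∑ j, (B i j : PowerSeries L) * g j) (i : ι) :
    (B.det : PowerSeries L) * g i =
      ∑ j, ((B.adjugate i j * b : L[X]) : PowerSeries L) * PowerSeries.expand q hq (g j) := by
  symm
  calc ∑ j, ((B.adjugate i j * b : L[X]) : PowerSeries L) * PowerSeries.expand q hq (g j)
      = ∑ j, (B.adjugate i j : PowerSeries L) * ∑ l, (B j l : PowerSeries L) * g l := by
        refine Finset.sum_congr rfl fun j _ => ?_
        rw [← hsys, coe_mul, mul_assoc]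
    _ = ∑ l, (((B.adjugate * B) i l : L[X]) : PowerSeries L) * g l := by
        simp_rw [Finset.mul_sum, Matrix.mul_apply]
        rw [Finset.sum_comm]
        refine Finset.sum_congr rfl fun l _ => ?_
        rw [← Polynomial.coeToPowerSeries.ringHom_apply, map_sum, Finset.sum_mul]
        exact Finset.sum_congr rfl fun j _ => by simp [mul_assoc]
    _ = (B.det : PowerSeries L) * g i := by
        rw [Matrix.adjugate_mul, Finset.sum_eq_single i]
        · simp
        · intro l _ hl
          simp [Matrix.one_apply_ne hl.symm]
        · simp

theorem exists_relation_expand_pow {ι : Type*} [Fintype ι] [DecidableEq ι] (hq : q ≠ 0)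
    {f : PowerSeries L} {g : ι → PowerSeries L} {b : L[X]} {B : Matrix ι ι L[X]}
    (hB : B.det ≠ 0)
    (hsys : ∀ i, (b : PowerSeries L) * PowerSeries.expand q hq (g i) =
      ∑ j, (B i j : PowerSeries L) * g j)
    (hf : ∃ (d : L[X]) (n : ι → L[X]), d ≠ 0 ∧
      (d : PowerSeries L) * f = ∑ j, (n j : PowerSeries L) * g j) (k : ℕ) :
    ∃ (d : L[X]) (n : ι → L[X]), d ≠ 0 ∧ (d : PowerSeries L) * f =
      ∑ j, (n j : PowerSeries L) * PowerSeries.expand (q ^ k) (pow_ne_zero k hq) (g j) := by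
  induction k with
  | zero => simpa using hf
  | succ k ih =>
    obtain ⟨d, n, hd, h⟩ := ih
    have hexp : ∀ g : PowerSeries L, PowerSeries.expand (q ^ (k + 1)) (pow_ne_zero (k + 1) hq) g =
        PowerSeries.expand (q ^ k) (pow_ne_zero k hq) (PowerSeries.expand q hq g) :=
      fun g => PowerSeries.expand_mul (q ^ k) (pow_ne_zero k hq) q hq g
    refine ⟨d * Polynomial.expand L (q ^ k) B.det,
      fun j => ∑ i, n i * Polynomial.expand L (q ^ k) (B.adjugate i j * b),
      mul_ne_zero hd ((Polynomial.expand_ne_zero (by positivity)).mpr hB), ?_⟩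
    have hsys' := fun i => congrArg (PowerSeries.expand (q ^ k) (pow_ne_zero k hq))
      (det_mul_eq_sum_expand hq hsys i)
    simp only [map_mul (PowerSeries.expand (q ^ k) _), map_sum (PowerSeries.expand (q ^ k) _),
      expand_coe, ← hexp] at hsys'
    rw [coe_mul, mul_right_comm, h, Finset.sum_mul]
    calc _ = ∑ i, (n i : PowerSeries L) * ∑ j,
          ((Polynomial.expand L (q ^ k) (B.adjugate i j * b) : L[X]) : PowerSeries L) *
          PowerSeries.expand (q ^ (k + 1)) (pow_ne_zero (k + 1) hq) (g j) := by
          refine Finset.sum_congr rfl fun i _ => ?_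
          rw [← hsys']; ring
      _ = _ := by
          simp_rw [Finset.mul_sum]
          rw [Finset.sum_comm]
          refine Finset.sum_congr rfl fun j _ => ?_
          rw [← Polynomial.coeToPowerSeries.ringHom_apply, map_sum, Finset.sum_mul]
          exact Finset.sum_congr rfl fun i _ => by
            rw [coeToPowerSeries.ringHom_apply, coe_mul, mul_assoc]

theorem exists_relation_nonvanishing {ι : Type*} [Fintype ι] (α : L) {f : PowerSeries L}
    {g : ι → PowerSeries L} {d : L[X]} (hd : d ≠ 0) {n : ι → L[X]}
    (h : (d : PowerSeries L) * f = ∑ j, (n j : PowerSeries L) * g j) :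
    ∃ (d : L[X]) (n : ι → L[X]), (d : PowerSeries L) * f = ∑ j, (n j : PowerSeries L) * g j ∧
      (d.eval α ≠ 0 ∨ ∃ j, (n j).eval α ≠ 0) := by
  induction hN : d.natDegree using Nat.strong_induction_on generalizing d n with
  | _ N ih =>
    subst hN
    by_cases h0 : d.eval α ≠ 0 ∨ ∃ j, (n j).eval α ≠ 0
    · exact ⟨d, n, h, h0⟩
    push Not at h0
    obtain ⟨d', rfl⟩ := dvd_iff_isRoot.mpr h0.1
    choose n' hn' using fun j => dvd_iff_isRoot.mpr (h0.2 j)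
    have hd' : d' ≠ 0 := right_ne_zero_of_mul hd
    refine ih d'.natDegree ?_ hd' (n := n') ?_ rfl
    · rw [natDegree_mul (X_sub_C_ne_zero α) hd', natDegree_X_sub_C]
      omega
    · have hX : ((X - C α : L[X]) : PowerSeries L) ≠ 0 := by
        rw [Ne, coe_eq_zero_iff]; exact X_sub_C_ne_zero α
      refine mul_left_cancel₀ hX ?_
      rw [← mul_assoc, ← coe_mul, h, Finset.mul_sum]
      exact Finset.sum_congr rfl fun j _ => by rw [hn' j, coe_mul, mul_assoc]

end

end Mahler

namespace Mahler
open Filter Topology Polynomial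

section

variable {L : Type*} [Field L] [Algebra L ℂ]

theorem ev_sum {ι : Type*} (s : Finset ι) {h : ι → PowerSeries L} {z : ℂ}
    (hz : ∀ j ∈ s, SummableAt (h j) z) : ev (∑ j ∈ s, h j) z = ∑ j ∈ s, ev (h j) z := by
  have := hasSum_sum fun j hj => (hz j hj).hasSum
  simp only [← Finset.sum_mul, ← map_sum] at this
  exact this.tsum_eq

/-- A relation between power series in `z` and `z ^ Q` persists for the values of the meromorphic
continuation. -/
theorem eval_mul_value_eq {ι : Type*} [Fintype ι] {Q : ℕ} (hQ : Q ≠ 0) {f : PowerSeries L}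
    {g : ι → PowerSeries L} (hf : Conv f) (hg : ∀ j, Conv (g j)) {d : L[X]} {n : ι → L[X]}
    (hrel : (d : PowerSeries L) * f = ∑ j, (n j : PowerSeries L) * PowerSeries.expand Q hQ (g j))
    {F : ℂ → ℂ} (hF : MeromorphicOn F (Metric.ball 0 1)) (hFf : F =ᶠ[𝓝 0] ev f) {a : ℂ}
    (ha : ‖a‖ < 1) (hFa : AnalyticAt ℂ F a) {R : ℝ} (haR : ‖a‖ ^ Q < R)
    (hgR : ∀ j, AnalyticOnNhd ℂ (ev (g j)) (Metric.ball 0 R)) :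
    d.aeval a * F a = ∑ j, (n j).aeval a * ev (g j) (a ^ Q) := by
  obtain ⟨r, ⟨hr1, hrR⟩, har⟩ : ∃ r : ℝ, (r < 1 ∧ r ^ Q < R) ∧ ‖a‖ < r := by
    have h1 : ∀ᶠ r in 𝓝 ‖a‖, r < 1 ∧ r ^ Q < R :=
      (eventually_lt_nhds ha).and
        ((continuous_pow Q).continuousAt.eventually (eventually_lt_nhds haR))
    exact ((h1.filter_mono nhdsWithin_le_nhds).and
      (self_mem_nhdsWithin : Set.Ioi ‖a‖ ∈ 𝓝[>] ‖a‖)).exists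
  have hr0 : 0 < r := (norm_nonneg a).trans_lt har
  have hgan : ∀ j, ∀ z ∈ Metric.ball (0 : ℂ) r, AnalyticAt ℂ (fun z => ev (g j) (z ^ Q)) z := by
    intro j z hz
    refine AnalyticAt.fun_comp (hgR j _ ?_) (analyticAt_id.pow Q)
    rw [mem_ball_zero_iff] at hz ⊢
    rw [norm_pow]
    exact (pow_le_pow_left₀ (norm_nonneg z) hz.le Q).trans_lt hrR
  have hpan : ∀ (p : L[X]) (z : ℂ), AnalyticAt ℂ (fun z => p.aeval z) z := fun p z =>
    analyticAt_id.aeval_polynomial p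
  have hsum : ∀ z ∈ Metric.ball (0 : ℂ) r,
      AnalyticAt ℂ (fun z => ∑ j, (n j).aeval z * ev (g j) (z ^ Q)) z := fun z hz =>
    Finset.analyticAt_fun_sum _ fun j _ => (hpan (n j) z).mul (hgan j z hz)
  have hsub : Metric.ball (0 : ℂ) r ⊆ Metric.ball 0 1 := Metric.ball_subset_ball hr1.le
  have hnear : ∀ᶠ z in 𝓝 (0 : ℂ), d.aeval z * F z = ∑ j, (n j).aeval z * ev (g j) (z ^ Q) := by
    have hgc : ∀ᶠ z in 𝓝 (0 : ℂ), ∀ j, SummableAt (g j) (z ^ Q) :=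
      (tendsto_pow_nhds_zero hQ).eventually (eventually_all.mpr hg)
    filter_upwards [hf, hFf, hgc] with z h1 h2 h3
    rw [h2, ← ev_coe, ← (hasSum_mul (summableAt_coe d z) h1).tsum_eq]
    change ev _ z = _
    rw [hrel, ev_sum _ fun j _ =>
      (hasSum_mul (summableAt_coe (n j) z) (hasSum_expand hQ (h3 j)).summable).summable]
    refine Finset.sum_congr rfl fun j _ => ?_
    rw [ev, (hasSum_mul (summableAt_coe (n j) z) (hasSum_expand hQ (h3 j)).summable).tsum_eq,
      ev_coe, ev, (hasSum_expand hQ (h3 j)).tsum_eq]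
  have hev := eventuallyEq_nhdsNE_of_isPreconnected
    (F := fun z => d.aeval z * F z) (G := fun z => ∑ j, (n j).aeval z * ev (g j) (z ^ Q))
    (U := Metric.ball 0 r) (fun z hz => (hpan d z).meromorphicAt.mul (hF z (hsub hz)))
    (fun z hz => (hsum z hz).meromorphicAt) (convex_ball 0 r).isPreconnected
    (Metric.mem_ball_self hr0) (hnear.filter_mono nhdsWithin_le_nhds)
    (mem_ball_zero_iff.mpr har)
  have h1 : ContinuousAt (fun z => d.aeval z * F z) a := ((hpan d a).mul hFa).continuousAt
  have h2 := (hsum a (mem_ball_zero_iff.mpr har)).continuousAt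
  exact tendsto_nhds_unique (h1.tendsto.mono_left nhdsWithin_le_nhds)
    ((h2.tendsto.mono_left nhdsWithin_le_nhds).congr' hev.symm)

end

end Mahler

namespace Mahler
open Filter Topology Polynomial

section

variable {L : Type*} [Field L] [Algebra L ℂ] {q : ℕ}

/-- All sufficiently deep iterates of a point are regular for a Mahler system. -/
theorem exists_regular_iterate {ι : Type*} [Fintype ι] [DecidableEq ι] (hq : 2 ≤ q) (hq0 : q ≠ 0)
    {g : ι → PowerSeries L} (hg : ∀ j, Conv (g j)) {b : L[X]} (hb : b ≠ 0) {B : Matrix ι ι L[X]}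
    (hB : B.det ≠ 0)
    (hsys : ∀ i, (b : PowerSeries L) * PowerSeries.expand q hq0 (g i) =
      ∑ j, (B i j : PowerSeries L) * g j)
    {α : L} (hα0 : 0 < ‖algebraMap L ℂ α‖) (hα1 : ‖algebraMap L ℂ α‖ < 1) {R : ℝ} (hR : 0 < R) :
    ∃ k₀ : ℕ, ‖algebraMap L ℂ α‖ ^ q ^ k₀ < R ∧ ∀ k, k₀ ≤ k → b.eval (α ^ q ^ k) ≠ 0 ∧
      B.det.eval (α ^ q ^ k) ≠ 0 ∧ ∀ j, algebraMap L ℂ (b.eval (α ^ q ^ k)) *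
        ev (g j) (algebraMap L ℂ α ^ q ^ (k + 1)) =
          ∑ i, algebraMap L ℂ ((B j i).eval (α ^ q ^ k)) * ev (g i) (algebraMap L ℂ α ^ q ^ k) := by
  have hpoly : ∀ p : L[X], p ≠ 0 → ∀ᶠ z in 𝓝[≠] (0 : ℂ), p.aeval z ≠ 0 := by
    intro p hp
    have hp' : p.map (algebraMap L ℂ) ≠ 0 :=
      (Polynomial.map_ne_zero_iff (algebraMap L ℂ).injective).mpr hp
    have hfin := (p.map (algebraMap L ℂ)).rootSet_finite ℂ
    have : ∀ᶠ z in 𝓝[≠] (0 : ℂ), z ∉ ((p.map (algebraMap L ℂ)).rootSet ℂ \ {0}) :=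
      nhdsWithin_le_nhds ((hfin.subset Set.sdiff_subset).isClosed.compl_mem_nhds (by simp))
    filter_upwards [this, self_mem_nhdsWithin] with z hz hz0 h0
    refine hz ⟨?_, hz0⟩
    rw [mem_rootSet_of_ne hp']
    simpa [aeval_def, eval_map] using h0
  have hsysz : ∀ᶠ z in 𝓝 (0 : ℂ), ∀ j, b.aeval z * ev (g j) (z ^ q) =
      ∑ i, (B j i).aeval z * ev (g i) z := by
    filter_upwards [(tendsto_pow_nhds_zero hq0).eventually (eventually_all.mpr hg),
      eventually_all.mpr hg] with z h1 h2 j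
    have h3 := hasSum_mul (summableAt_coe b z) (hasSum_expand hq0 (h1 j)).summable
    have h4 := fun i => hasSum_mul (summableAt_coe (B j i) z) (h2 i)
    have h5 := congrArg (fun h => ev h z) (hsys j)
    simp only [ev_sum Finset.univ fun i _ => (h4 i).summable] at h5
    rw [ev, h3.tsum_eq, ev_coe, ev, (hasSum_expand hq0 (h1 j)).tsum_eq] at h5
    rw [h5]
    exact Finset.sum_congr rfl fun i _ => by rw [ev, (h4 i).tsum_eq, ev_coe]
  have hall : ∀ᶠ z in 𝓝[≠] (0 : ℂ), ‖z‖ < R ∧ b.aeval z ≠ 0 ∧ B.det.aeval z ≠ 0 ∧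
      ∀ j, b.aeval z * ev (g j) (z ^ q) = ∑ i, (B j i).aeval z * ev (g i) z := by
    have hball : ∀ᶠ z in 𝓝 (0 : ℂ), ‖z‖ < R := by
      filter_upwards [Metric.ball_mem_nhds (0 : ℂ) hR] with z hz using mem_ball_zero_iff.mp hz
    exact (hball.filter_mono nhdsWithin_le_nhds).and ((hpoly b hb).and
      ((hpoly _ hB).and (hsysz.filter_mono nhdsWithin_le_nhds)))
  obtain ⟨k₀, hk₀⟩ := eventually_atTop.mp ((tendsto_pow_pow_nhdsNE hα0 hα1 hq).eventually hall)
  have hev : ∀ (p : L[X]) k, p.aeval (algebraMap L ℂ α ^ q ^ k) =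
      algebraMap L ℂ (p.eval (α ^ q ^ k)) := fun p k => by
    rw [← map_pow, aeval_algebraMap_apply, coe_aeval_eq_eval]
  refine ⟨k₀, by simpa using (hk₀ k₀ le_rfl).1, fun k hk => ?_⟩
  obtain ⟨-, h1, h2, h3⟩ := hk₀ k hk
  simp only [hev, ← pow_mul, ← pow_succ] at h1 h2 h3
  exact ⟨fun h => h1 (by rw [h, map_zero]), fun h => h2 (by rw [h, map_zero]), h3⟩

end

end Mahler

namespace Mahler
open Filter Topology Polynomial

theorem map_mahlerGen {K L : Type*} [Field K] [Field L] [Algebra K L] {q : ℕ}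
    (hq : q ≠ 0) (f : PowerSeries K) (j : ℕ) :
    (mahlerGen (PowerSeries.expand q hq) f j).map (algebraMap K L) =
      mahlerGen (PowerSeries.expand q hq) (f.map (algebraMap K L)) j := by
  cases j with
  | zero => simp [mahlerGen]
  | succ i =>
    simp only [mahlerGen]
    induction i with
    | zero => rfl
    | succ i ih => rw [Function.iterate_succ_apply', Function.iterate_succ_apply',
        PowerSeries.map_expand, ih]

section

variable {K L : Type*} [Field K] [Field L] [Algebra K L] [Algebra K ℂ] [Algebra L ℂ]
  [IsScalarTower K L ℂ]

theorem ev_map (g : PowerSeries K) : ev (g.map (algebraMap K L)) = ev g := by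
  funext z
  simp only [ev, PowerSeries.coeff_map, ← IsScalarTower.algebraMap_apply]

theorem conv_map_iff {g : PowerSeries K} : Conv (g.map (algebraMap K L)) ↔ Conv g := by
  simp only [Conv, SummableAt, PowerSeries.coeff_map, ← IsScalarTower.algebraMap_apply]

theorem conv_mahlerGen {q : ℕ} (hq : q ≠ 0) {f : PowerSeries L} (hf : Conv f) (j : ℕ) :
    Conv (mahlerGen (PowerSeries.expand q hq) f j) := by
  cases j with
  | zero => exact (convSubring L).one_mem
  | succ i =>
    simp only [mahlerGen]
    induction i with
    | zero => exact hf
    | succ i ih =>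
      rw [Function.iterate_succ_apply']
      exact ih.expand hq

theorem ev_one (z : ℂ) : ev (1 : PowerSeries L) z = 1 := by
  simpa using ev_coe (1 : L[X]) z

/-- An algebraic value of a Mahler function lies in the field generated by the coefficients and
the point. -/
theorem exists_algebraMap_eq_value [NumberField L] {q : ℕ} (hq : 2 ≤ q) (hq0 : q ≠ 0)
    {f : PowerSeries K} (hf : Conv f) {m : ℕ} {p : ℕ → L[X]} (hp : ∃ i ≤ m, p i ≠ 0)
    (hrel : ∑ i ∈ Finset.range (m + 1), (p i : PowerSeries L) *
      (PowerSeries.expand q hq0)^[i] (f.map (algebraMap K L)) = 0)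
    {F : ℂ → ℂ} (hF : MeromorphicOn F (Metric.ball 0 1)) (hFf : F =ᶠ[𝓝 0] ev f) {α : K}
    (hα0 : 0 < ‖algebraMap K ℂ α‖) (hα1 : ‖algebraMap K ℂ α‖ < 1)
    (hFα : AnalyticAt ℂ F (algebraMap K ℂ α)) {v : L}
    (hv : algebraMap L ℂ v = F (algebraMap K ℂ α)) :
    ∃ w : K, algebraMap K ℂ w = F (algebraMap K ℂ α) := by
  obtain ⟨s, hs0, hind, ⟨b, B, hb, hsys⟩, hfrel⟩ :=
    exists_formal_system (map_one (PowerSeries.expand q hq0)) hp hrel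
  set fL := f.map (algebraMap K L) with hfL
  have hfLc : Conv fL := conv_map_iff.mpr hf
  let G : s → PowerSeries L := fun j => mahlerGen (PowerSeries.expand q hq0) fL j
  let GK : s → PowerSeries K := fun j => mahlerGen (PowerSeries.expand q hq0) f j
  have hG : ∀ j, Conv (G j) := fun j => conv_mahlerGen hq0 hfLc j
  have hGK : ∀ j, Conv (GK j) := fun j => conv_mahlerGen hq0 hf j
  have hmap : ∀ j, (GK j).map (algebraMap K L) = G j := fun j => map_mahlerGen hq0 f j
  let g : s → convSubring L := fun j => ⟨G j, hG j⟩
  have hdet : B.det ≠ 0 := det_ne_zero_of_expand_system hq0 hind hb hsys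
  have hLI := linearIndependent_algSubfield_toGerm (g := g) hind hq hq0 hb hsys
  set a := algebraMap L ℂ (algebraMap K L α) with ha
  have haK : algebraMap K ℂ α = a := IsScalarTower.algebraMap_apply K L ℂ α
  rw [haK] at hα0 hα1 hFα hv ⊢
  obtain ⟨R, hR, hRan⟩ : ∃ R > 0, ∀ j, AnalyticOnNhd ℂ (ev (G j)) (Metric.ball 0 R) := by
    have h : ∀ᶠ z in 𝓝 (0 : ℂ), ∀ j, AnalyticAt ℂ (ev (G j)) z :=
      eventually_all.mpr fun j => (analyticAt_ev (hG j)).eventually_analyticAt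
    obtain ⟨R, hR, h⟩ := Metric.eventually_nhds_iff_ball.mp h
    exact ⟨R, hR, fun j z hz => h z hz j⟩
  obtain ⟨k₀, hk₀R, hk₀⟩ := exists_regular_iterate hq hq0 hG hb hdet hsys hα0 hα1 hR
  obtain ⟨d, n, hd, hdn⟩ := exists_relation_expand_pow hq0 hdet hsys hfrel k₀
  obtain ⟨d, n, hdn, hne⟩ := exists_relation_nonvanishing (algebraMap K L α) hd hdn
  have hFfL : F =ᶠ[𝓝 0] ev fL := by rwa [hfL, ev_map]
  have hval := eval_mul_value_eq (pow_ne_zero k₀ hq0) hfLc hG hdn hF hFfL hα1 hFα hk₀R hRan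
  let i₀ : s := ⟨0, hs0⟩
  have hi₀ : ∀ z, ev (G i₀) z = 1 := ev_one
  have haev : ∀ p : L[X], p.aeval a = algebraMap L ℂ (p.eval (algebraMap K L α)) := fun p => by
    rw [ha, aeval_algebraMap_apply, coe_aeval_eq_eval]
  simp only [haev, ← hv] at hval
  set dα := d.eval (algebraMap K L α) with hdα
  set c : s → L := fun j => (n j).eval (algebraMap K L α) - if j = i₀ then dα * v else 0 with hc
  have hpow : ∀ k, ((algebraMap K L α) ^ q ^ k₀) ^ q ^ k = (algebraMap K L α) ^ q ^ (k₀ + k) :=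
    fun k => by rw [← pow_mul, ← pow_add]
  have hpow' : ∀ k, (a ^ q ^ k₀) ^ q ^ k = a ^ q ^ (k₀ + k) :=
    fun k => by rw [← pow_mul, ← pow_add]
  have hapow : algebraMap L ℂ ((algebraMap K L α) ^ q ^ k₀) = a ^ q ^ k₀ := map_pow _ _ _
  have hc0 : c = 0 := by
    refine eq_zero_of_value_relation (g := g) hLI hq (α := (algebraMap K L α) ^ q ^ k₀)
      (b := b) (B := B) ?_ ?_ ?_ ?_ ?_ ?_
    · rw [hapow, norm_pow]; positivity
    · rw [hapow, norm_pow]; exact pow_lt_one₀ (norm_nonneg _) hα1 (pow_ne_zero _ hq0)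
    · intro k; rw [hpow]; exact (hk₀ _ (Nat.le_add_right k₀ k)).1
    · intro k; rw [hpow]; exact (hk₀ _ (Nat.le_add_right k₀ k)).2.1
    · intro k j
      rw [hapow]
      simp only [hpow, hpow']
      exact (hk₀ _ (Nat.le_add_right k₀ k)).2.2 j
    · rw [hapow]
      simp only [hc, map_sub, mul_sub, Finset.sum_sub_distrib]
      rw [sub_eq_zero, Finset.sum_eq_single (a := i₀)
        (f := fun j => _ * algebraMap L ℂ (ite _ _ _))]
      · rw [if_pos rfl, map_mul]
        change _ = ev (G i₀) _ * _
        rw [hi₀, one_mul, hval]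
        exact Finset.sum_congr rfl fun j _ => mul_comm _ _
      · intro j _ hj
        rw [if_neg hj, map_zero, mul_zero]
      · simp
  have hcj : ∀ j, (n j).eval (algebraMap K L α) = if j = i₀ then dα * v else 0 := fun j =>
    sub_eq_zero.mp (congrFun hc0 j)
  have hdα0 : dα ≠ 0 := by
    intro h0
    refine hne.elim (fun h => h h0) fun ⟨j, hj⟩ => hj ?_
    rw [hcj, h0, zero_mul, ite_self]
  obtain ⟨ψ, hψ⟩ := (Algebra.linearMap K L).exists_leftInverse_of_injective
    (LinearMap.ker_eq_bot.mpr (algebraMap K L).injective)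
  let ℓ : L →ₗ[K] K := ψ ∘ₗ LinearMap.mulLeft K dα⁻¹
  have hψ1 : ψ 1 = 1 := by simpa using LinearMap.congr_fun hψ 1
  have hrelK := sum_coeffMap_mul ℓ (f := f) (d := d) (n := n)
    (g := fun j => PowerSeries.expand (q ^ k₀) (pow_ne_zero k₀ hq0) (GK j))
    (by simpa only [PowerSeries.map_expand, hmap] using hdn)
  have hvalK := eval_mul_value_eq (pow_ne_zero k₀ hq0) hf hGK hrelK hF hFf hα1 hFα hk₀R
    fun j => by rw [← ev_map (L := L), hmap]; exact hRan j
  have haevK : ∀ p : K[X], p.aeval a = algebraMap K ℂ (p.eval α) := fun p => by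
    rw [← haK, aeval_algebraMap_apply, coe_aeval_eq_eval]
  refine ⟨ψ v, ?_⟩
  simp only [haevK, eval_coeffMap, hcj, ← hdα] at hvalK
  have h1 : ℓ dα = 1 := by simp [ℓ, hdα0, hψ1]
  rw [h1, map_one, one_mul, Finset.sum_eq_single i₀] at hvalK
  · have h2 : ℓ (dα * v) = ψ v := by simp [ℓ, hdα0]
    rw [hvalK, if_pos rfl, h2, show GK i₀ = 1 from rfl, ev_one, mul_one]
  · intro j _ hj
    rw [if_neg hj, map_zero, map_zero, zero_mul]
  · simp

end

end Mahler

namespace Mahler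

theorem psSigma_eq_expand {q : ℕ} (hq : q ≠ 0) :
    psSigma q = fun f => PowerSeries.expand q hq f := by
  funext f
  ext n
  rw [PowerSeries.coeff_expand, psSigma, PowerSeries.coeff_mk]

theorem map_expand_iterate {R S : Type*} [CommRing R] [CommRing S] (φ : R →+* S) {q : ℕ}
    (hq : q ≠ 0) (i : ℕ) (f : PowerSeries R) :
    ((PowerSeries.expand q hq)^[i] f).map φ = (PowerSeries.expand q hq)^[i] (f.map φ) :=
  (Function.Semiconj.iterate_right (fun f => PowerSeries.map_expand q hq φ f) i) f

/-- A number field in `ℂ` has a finite extension containing a given algebraic number and the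
coefficients of finitely many given polynomials. -/
theorem exists_finite_extension (K : Subfield ℂ) {v : ℂ} (hv : IsAlgebraic ℚ v) (m : ℕ)
    {p : ℕ → Polynomial ℂ} (hp : ∀ i k, IsAlgebraic ℚ ((p i).coeff k)) :
    ∃ L : IntermediateField K ℂ, FiniteDimensional K L ∧ v ∈ L ∧
      ∀ i ≤ m, ∃ P : Polynomial L, P.map (algebraMap L ℂ) = p i := by
  classical
  let S : Finset ℂ := insert v ((Finset.range (m + 1)).biUnion fun i => (p i).coeffs)
  have hS : ∀ x ∈ (S : Set ℂ), IsIntegral K x := by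
    intro x hx
    simp only [S, Finset.coe_insert, Set.mem_insert_iff, Finset.mem_coe, Finset.mem_biUnion] at hx
    have hxalg : IsAlgebraic ℚ x := by
      rcases hx with rfl | ⟨i, -, hx⟩
      · exact hv
      · obtain ⟨k, -, rfl⟩ := Polynomial.mem_coeffs_iff.mp hx
        exact hp i k
    exact hxalg.isIntegral.tower_top
  refine ⟨IntermediateField.adjoin K (S : Set ℂ), IntermediateField.finiteDimensional_adjoin hS,
    IntermediateField.subset_adjoin K _ (by simp [S]), fun i hi => ?_⟩
  refine (Polynomial.mem_lifts (p i)).mp ((Polynomial.lifts_iff_coeff_lifts (p i)).mpr fun k => ?_)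
  by_cases hk : (p i).coeff k = 0
  · exact ⟨0, by rw [hk, map_zero]⟩
  refine ⟨⟨(p i).coeff k, IntermediateField.subset_adjoin K _ ?_⟩, rfl⟩
  simp only [S, Finset.coe_insert, Set.mem_insert_iff, Finset.mem_coe, Finset.mem_biUnion]
  exact Or.inr ⟨i, Finset.mem_range.mpr (by omega), Polynomial.coeff_mem_coeffs hk⟩

end Mahler

/-- If `K` is a number field, `f` an M_q-function with coefficients in `K`
and `α ∈ K` with `0 < |α| < 1` not a pole of `f`, then either `f(α) ∈ K` or `f(α)` is
transcendental. -/
theorem M_value_dichotomy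
    (q : ℕ) (hq : 2 ≤ q)
    (K : Subfield ℂ) [FiniteDimensional ℚ K] (hKalg : ∀ x ∈ K, IsAlgebraic ℚ x)
    (f : PowerSeries ℂ) (hf : IsM q f) (hfK : ∀ n, PowerSeries.coeff n f ∈ K)
    (α : ℂ) (hαK : α ∈ K) (hα0 : 0 < ‖α‖) (hα1 : ‖α‖ < 1)
    (v : ℂ) (hv : MahlerValue f α v) :
    v ∈ K ∨ Transcendental ℚ v := by
  rcases em (Transcendental ℚ v) with hvt | hvt
  · exact Or.inr hvt
  refine Or.inl ?_
  have hvalg : IsAlgebraic ℚ v := not_not.mp hvt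
  obtain ⟨-, m, p, hpalg, hp, hrel⟩ := hf
  obtain ⟨F, hF, hFf, hFα, rfl⟩ := hv
  have hq0 : q ≠ 0 := by omega
  obtain ⟨L, hLfin, hvL, hpL⟩ := Mahler.exists_finite_extension K hvalg m (p := p) hpalg
  have hLQ : FiniteDimensional ℚ L := FiniteDimensional.trans ℚ K L
  have hLnum : NumberField L := { to_charZero := inferInstance, to_finiteDimensional := hLQ }
  choose! P hP using hpL
  let fK : PowerSeries K := PowerSeries.mk fun n => ⟨PowerSeries.coeff n f, hfK n⟩
  have hfK' : (fK.map (algebraMap K L)).map (algebraMap L ℂ) = f := by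
    ext n
    simp only [PowerSeries.coeff_map, fK, PowerSeries.coeff_mk]
    rfl
  have hP0 : ∃ i ≤ m, P i ≠ 0 := by
    obtain ⟨i, hi, h⟩ := hp
    refine ⟨i, hi, fun h0 => h ?_⟩
    rw [← hP i hi, h0, Polynomial.map_zero]
  have hrelL : ∑ i ∈ Finset.range (m + 1), (P i : PowerSeries L) *
      (PowerSeries.expand q hq0)^[i] (fK.map (algebraMap K L)) = 0 := by
    refine PowerSeries.map_injective (algebraMap L ℂ) (algebraMap L ℂ).injective ?_
    rw [map_zero, map_sum, ← hrel]
    refine Finset.sum_congr rfl fun i hi => ?_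
    rw [map_mul, Mahler.map_expand_iterate, hfK', Mahler.psSigma_eq_expand hq0,
      ← hP i (Nat.le_of_lt_succ (Finset.mem_range.mp hi))]
    congr 1
    exact (Polynomial.polynomial_map_coe).symm
  have hcoeff : ∀ n, algebraMap K ℂ (PowerSeries.coeff n fK) = PowerSeries.coeff n f := fun n => by
    rw [PowerSeries.coeff_mk]
    rfl
  have hconv : Mahler.Conv fK := hFf.mono fun z hz => by
    simpa only [Mahler.SummableAt, hcoeff] using hz.summable
  have hFev : F =ᶠ[nhds 0] Mahler.ev fK := hFf.mono fun z hz => by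
    simpa only [Mahler.ev, hcoeff] using hz.tsum_eq.symm
  obtain ⟨w, hw⟩ := Mahler.exists_algebraMap_eq_value (L := L) hq hq0 hconv hP0 hrelL hF hFev
    (α := ⟨α, hαK⟩) hα0 hα1 hFα (v := ⟨F α, hvL⟩) rfl
  have hw' : (w : ℂ) = F α := hw
  exact hw' ▸ w.2
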